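/- A quotient of a nuclear C*-algebra by a closed two-sided ideal is nuclear. -/

import Mathlib

open Matrix

section CP
variable {E F : Type*}
  [NonUnitalNormedRing E] [StarRing E] [NormedSpace ℂ E]
  [NonUnitalNormedRing F] [StarRing F] [NormedSpace ℂ F]

/-- A linear map between C*-algebras is completely positive if each of its matrix
amplifications sends positive matrices to positive matrices. -/
def IsCompletelyPositive (φ : E →ₗ[ℂ] F) : Prop :=
  ∀ (k : ℕ) (N : Matrix (Fin k) (Fin k) E),
    ∃ M : Matrix (Fin k) (Fin k) F, (Nᴴ * N).map φ = Mᴴ * M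

end CP

/-- The C*-algebra of `n × n` complex matrices, realized as operators on
`ℂ^n`. -/
abbrev MatrixAlg (n : ℕ) : Type :=
  EuclideanSpace ℂ (Fin n) →L[ℂ] EuclideanSpace ℂ (Fin n)

/-- Nuclearity: the identity map approximately factors through matrix algebras
via completely positive contractions. -/
def IsNuclear (B : Type*) [NonUnitalNormedRing B] [StarRing B]
    [NormedSpace ℂ B] : Prop :=
  ∀ (s : Finset B) (ε : ℝ), 0 < ε →
    ∃ (k : ℕ) (φ : B →ₗ[ℂ] MatrixAlg k) (ρ : MatrixAlg k →ₗ[ℂ] B),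
      IsCompletelyPositive φ ∧ IsCompletelyPositive ρ ∧
      (∀ b : B, ‖φ b‖ ≤ ‖b‖) ∧ (∀ m : MatrixAlg k, ‖ρ m‖ ≤ ‖m‖) ∧
      ∀ b ∈ s, ‖ρ (φ b) - b‖ ≤ ε


section FinDim
open scoped InnerProductSpace
open ComplexConjugate

theorem nq_cs {ι : Type*} (s : Finset ι) (f g : ι → ℂ) :
    ‖∑ i ∈ s, f i * g i‖ ^ 2 ≤ (∑ i ∈ s, ‖f i‖ ^ 2) * ∑ i ∈ s, ‖g i‖ ^ 2 := by
  have h1 : ‖∑ i ∈ s, f i * g i‖ ≤ ∑ i ∈ s, ‖f i‖ * ‖g i‖ := by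
    refine (norm_sum_le _ _).trans (le_of_eq ?_)
    simp
  calc _ ≤ (∑ i ∈ s, ‖f i‖ * ‖g i‖) ^ 2 := by gcongr
    _ ≤ _ := Finset.sum_mul_sq_le_sq_mul_sq _ _ _

variable {K : Type*} [NormedAddCommGroup K] [InnerProductSpace ℂ K]

theorem nq_cs_inner {ι : Type*} (s : Finset ι) (f g : ι → K) :
    ‖∑ i ∈ s, ⟪f i, g i⟫_ℂ‖ ^ 2 ≤ (∑ i ∈ s, ‖f i‖ ^ 2) * ∑ i ∈ s, ‖g i‖ ^ 2 := by
  have h1 : ‖∑ i ∈ s, ⟪f i, g i⟫_ℂ‖ ≤ ∑ i ∈ s, ‖f i‖ * ‖g i‖ := by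
    refine (norm_sum_le _ _).trans (Finset.sum_le_sum fun i _ => norm_inner_le_norm _ _)
  calc _ ≤ (∑ i ∈ s, ‖f i‖ * ‖g i‖) ^ 2 := by gcongr
    _ ≤ _ := Finset.sum_mul_sq_le_sq_mul_sq _ _ _

variable [FiniteDimensional ℂ K] {N : Type*} [Fintype N]

noncomputable def nqHS (f : OrthonormalBasis N ℂ K) (T : K →L[ℂ] K) : ℝ := ∑ p, ‖T (f p)‖ ^ 2

theorem nqHS_nonneg (f : OrthonormalBasis N ℂ K) (T : K →L[ℂ] K) : 0 ≤ nqHS f T :=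
  Finset.sum_nonneg fun _ _ => by positivity

theorem nqHS_adj {M : Type*} [Fintype M] (f : OrthonormalBasis N ℂ K) (e : OrthonormalBasis M ℂ K)
    (T S : K →L[ℂ] K) (h : ∀ x y, ⟪T x, y⟫_ℂ = ⟪x, S y⟫_ℂ) : nqHS f T = nqHS e S := by
  unfold nqHS
  have h1 : ∀ p, ‖T (f p)‖ ^ 2 = ∑ m, ‖⟪e m, T (f p)⟫_ℂ‖ ^ 2 := fun p =>
    (e.sum_sq_norm_inner_right _).symm
  have h2 : ∀ p, ‖S (e p)‖ ^ 2 = ∑ m, ‖⟪f m, S (e p)⟫_ℂ‖ ^ 2 := fun p =>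
    (f.sum_sq_norm_inner_right _).symm
  simp_rw [h1, h2]
  rw [Finset.sum_comm]
  refine Finset.sum_congr rfl fun m _ => Finset.sum_congr rfl fun p _ => ?_
  rw [← h, norm_inner_symm]

theorem nqHS_left (f : OrthonormalBasis N ℂ K) (X T : K →L[ℂ] K) :
    nqHS f (X * T) ≤ ‖X‖ ^ 2 * nqHS f T := by
  unfold nqHS
  rw [Finset.mul_sum]
  refine Finset.sum_le_sum fun p _ => ?_
  rw [← mul_pow]
  gcongr
  exact X.le_opNorm _

open ContinuousLinearMap in
theorem nqHS_right (f : OrthonormalBasis N ℂ K) (T X : K →L[ℂ] K) :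
    nqHS f (T * X) ≤ ‖X‖ ^ 2 * nqHS f T := by
  have : CompleteSpace K := FiniteDimensional.complete ℂ K
  rw [nqHS_adj f f (T * X) (star X * star T), nqHS_adj f f T (star T)]
  · refine (nqHS_left _ _ _).trans ?_
    rw [norm_star]
  · intro x y; rw [star_eq_adjoint, adjoint_inner_right]
  · intro x y
    simp only [star_eq_adjoint, mul_apply_eq_comp]
    rw [adjoint_inner_right, adjoint_inner_right]

theorem nq_eig (f : OrthonormalBasis N ℂ K) (D k q : K →L[ℂ] K) (τ : K →L[ℂ] K)
    (hD : D = k - q) (hk : ∀ x, 0 ≤ (⟪x, k x⟫_ℂ).re) (hq : ∀ x, 0 ≤ (⟪x, q x⟫_ℂ).re)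
    (hks : ∀ x y, ⟪k x, y⟫_ℂ = ⟪x, k y⟫_ℂ) (hqs : ∀ x y, ⟪q x, y⟫_ℂ = ⟪x, q y⟫_ℂ)
    (hkq : k * k = q * q + τ) (hτ : ∀ x, 0 ≤ (⟪x, τ x⟫_ℂ).re) :
    nqHS f D ≤ (∑ p, ⟪f p, τ (f p)⟫_ℂ).re := by
  have hDs : ∀ x y, ⟪D x, y⟫_ℂ = ⟪x, D y⟫_ℂ := by
    intro x y; simp [hD, inner_sub_left, inner_sub_right, hks, hqs]
  have hsym : (D : K →ₗ[ℂ] K).IsSymmetric := hDs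
  let e := hsym.eigenvectorBasis rfl
  have hev : ∀ m, D (e m) = (hsym.eigenvalues rfl m : ℂ) • e m := fun m =>
    hsym.apply_eigenvectorBasis rfl m
  have h1 : nqHS f D = nqHS e D := nqHS_adj f e D D hDs
  have h2 : (∑ p, ⟪f p, τ (f p)⟫_ℂ) = ∑ m, ⟪e m, τ (e m)⟫_ℂ := by
    rw [← ContinuousLinearMap.coe_coe τ, ← LinearMap.trace_eq_sum_inner _ f, ← LinearMap.trace_eq_sum_inner _ e]
  rw [h1, h2, nqHS, Complex.re_sum]
  refine Finset.sum_le_sum fun m _ => ?_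
  set l := hsym.eigenvalues rfl m
  have hτe : τ = k * D + D * q := by
    rw [hD]; rw [mul_sub, sub_mul, ← sub_eq_iff_eq_add'.mpr hkq]; abel
  have hn : ‖e m‖ = 1 := e.orthonormal.1 m
  have h3 : ⟪e m, τ (e m)⟫_ℂ = l * (⟪e m, k (e m)⟫_ℂ + ⟪e m, q (e m)⟫_ℂ) := by
    rw [hτe]
    simp only [_root_.add_apply, mul_apply_eq_comp, inner_add_right]
    rw [← hDs (e m), hev, map_smul, inner_smul_left, inner_smul_right, Complex.conj_ofReal, mul_add]
  have h4 : (l : ℂ) = ⟪e m, k (e m)⟫_ℂ - ⟪e m, q (e m)⟫_ℂ := by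
    have : ⟪e m, D (e m)⟫_ℂ = l := by
      rw [hev, inner_smul_right, inner_self_eq_norm_sq_to_K, hn]; simp [l]
    rw [← this, hD]; simp [inner_sub_right]
  have h5 : ‖D (e m)‖ ^ 2 = l ^ 2 := by
    rw [hev, norm_smul, hn]; simp [l]
  rw [h5]
  have hke := hk (e m); have hqe := hq (e m)
  have hte := hτ (e m)
  rw [h3] at hte ⊢
  have h6 : l = (⟪e m, k (e m)⟫_ℂ).re - (⟪e m, q (e m)⟫_ℂ).re := by
    have := congrArg Complex.re h4; simpa using this
  simp only [Complex.mul_re, Complex.ofReal_re, Complex.ofReal_im, zero_mul, sub_zero, Complex.add_re] at hte ⊢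
  rcases le_or_gt 0 l with hl | hl
  · nlinarith [mul_nonneg hl hqe]
  · nlinarith


/-- The operator `∑ₗ nₗ |vₗ⟩⟨vₗ|`. -/
noncomputable def nqR {H ι : Type*} [NormedAddCommGroup H] [InnerProductSpace ℂ H] [Fintype ι]
    (n : ι → ℝ) (v : ι → H) : H →L[ℂ] H :=
  ∑ l, (n l : ℂ) • (innerSL ℂ (v l)).smulRight (v l)

theorem nqR_apply {H ι : Type*} [NormedAddCommGroup H] [InnerProductSpace ℂ H] [Fintype ι]
    (n : ι → ℝ) (v : ι → H) (z : H) : nqR n v z = ∑ l, ((n l : ℂ) * ⟪v l, z⟫_ℂ) • v l := by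
  simp only [nqR, ContinuousLinearMap.sum_apply, _root_.smul_apply,
    ContinuousLinearMap.smulRight_apply, innerSL_apply_apply, smul_smul]

theorem nqR_sym {H ι : Type*} [NormedAddCommGroup H] [InnerProductSpace ℂ H] [Fintype ι]
    (n : ι → ℝ) (v : ι → H) (x y : H) : ⟪nqR n v x, y⟫_ℂ = ⟪x, nqR n v y⟫_ℂ := by
  simp only [nqR_apply, sum_inner, inner_sum, inner_smul_left, inner_smul_right, map_mul,
    Complex.conj_ofReal, inner_conj_symm]
  refine Finset.sum_congr rfl fun l _ => by ring

theorem nqR_inner {H ι : Type*} [NormedAddCommGroup H] [InnerProductSpace ℂ H] [Fintype ι]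
    (n : ι → ℝ) (v : ι → H) (x : H) : ⟪x, nqR n v x⟫_ℂ = ((∑ l, n l * ‖⟪v l, x⟫_ℂ‖ ^ 2 : ℝ) : ℂ) := by
  simp only [nqR_apply, inner_sum, inner_smul_right]
  push_cast
  refine Finset.sum_congr rfl fun l _ => ?_
  rw [← inner_conj_symm x (v l), mul_assoc, Complex.mul_conj, Complex.normSq_eq_norm_sq]
  push_cast; rfl

theorem nqR_trace {ι : Type*} [Fintype ι] (f : OrthonormalBasis N ℂ K)
    (n : ι → ℝ) (v : ι → K) : (∑ p, ⟪f p, nqR n v (f p)⟫_ℂ) = ((∑ l, n l * ‖v l‖ ^ 2 : ℝ) : ℂ) := by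
  simp only [nqR_inner]
  rw [← Complex.ofReal_sum, Finset.sum_comm]
  simp only [← Finset.mul_sum, f.sum_sq_norm_inner_left]

/-- The interpolation inequality. -/
theorem nq_interp {V : Type*} [NormedAddCommGroup V] [InnerProductSpace ℂ V]
    [FiniteDimensional ℂ V]
    (μ : N → ℝ) (hμ : ∀ p, 0 < μ p) (L : EuclideanSpace ℂ (N × N) →ₗ[ℂ] V)
    (hL : ∀ X Y, ‖⟪L X, L Y⟫_ℂ‖ ^ 2 ≤ (∑ p, ∑ q, μ q ^ 2 * ‖X (p, q)‖ ^ 2) *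
      ∑ p, ∑ q, μ p ^ 2 * ‖Y (p, q)‖ ^ 2) (X : EuclideanSpace ℂ (N × N)) :
    ‖L X‖ ^ 2 ≤ ∑ p, ∑ q, μ p * μ q * ‖X (p, q)‖ ^ 2 := by
  classical
  set c : N × N → ℝ := fun z => Real.sqrt (μ z.1 * μ z.2) with hc
  have hcpos : ∀ z, 0 < c z := fun z => Real.sqrt_pos.2 (mul_pos (hμ _) (hμ _))
  have hcsq : ∀ z, c z ^ 2 = μ z.1 * μ z.2 := fun z => Real.sq_sqrt (mul_pos (hμ _) (hμ _)).le
  let Dg : (N × N → ℝ) → EuclideanSpace ℂ (N × N) →ₗ[ℂ] EuclideanSpace ℂ (N × N) := fun d =>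
    { toFun := fun Z => WithLp.toLp 2 fun z => (d z : ℂ) * Z z
      map_add' := by intro x y; ext z; simp [mul_add]
      map_smul' := by intro r x; ext z; simp; ring }
  have hDg : ∀ d Z z, (Dg d Z) z = (d z : ℂ) * Z z := fun d Z z => rfl
  let L' := L ∘ₗ Dg (fun z => (c z)⁻¹)
  let T := LinearMap.adjoint L' ∘ₗ L'
  have hT : ∀ Z Z', ⟪T Z, Z'⟫_ℂ = ⟪L' Z, L' Z'⟫_ℂ := fun Z Z' => by
    simp only [T, LinearMap.comp_apply]; rw [LinearMap.adjoint_inner_left]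
  have hsym : T.IsSymmetric := by
    intro x y
    rw [hT, ← inner_conj_symm x, hT, inner_conj_symm]
  let e := hsym.eigenvectorBasis rfl
  have hev : ∀ m, T (e m) = (hsym.eigenvalues rfl m : ℂ) • e m := fun m =>
    hsym.apply_eigenvectorBasis rfl m
  have hle : ∀ m, hsym.eigenvalues rfl m ≤ 1 := by
    intro m
    set l := hsym.eigenvalues rfl m
    set Z := e m with hZ
    let Z' := Dg (fun z => μ z.2 / μ z.1) Z
    set S : ℝ := ∑ p, ∑ q, μ q / μ p * ‖Z (p, q)‖ ^ 2 with hS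
    have h1 : ⟪T Z, Z'⟫_ℂ = (l * S : ℝ) := by
      rw [hev, inner_smul_left, Complex.conj_ofReal, PiLp.inner_apply, Fintype.sum_prod_type]
      simp only [Z', hDg, hS]
      push_cast
      congr 1
      refine Finset.sum_congr rfl fun p _ => Finset.sum_congr rfl fun q _ => ?_
      rw [RCLike.inner_apply, mul_assoc, RCLike.mul_conj]
      simp
    have h2 := hL (Dg (fun z => (c z)⁻¹) Z) (Dg (fun z => (c z)⁻¹) Z')
    have h3 : ⟪L (Dg (fun z => (c z)⁻¹) Z), L (Dg (fun z => (c z)⁻¹) Z')⟫_ℂ = (l * S : ℝ) := by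
      rw [← h1, hT]; rfl
    have hμ0 : ∀ p, μ p ≠ 0 := fun p => (hμ p).ne'
    have h4 : (∑ p, ∑ q, μ q ^ 2 * ‖(Dg (fun z => (c z)⁻¹) Z) (p, q)‖ ^ 2) = S := by
      refine Finset.sum_congr rfl fun p _ => Finset.sum_congr rfl fun q _ => ?_
      rw [hDg, norm_mul, mul_pow, Complex.norm_real, Real.norm_eq_abs, sq_abs, inv_pow, hcsq]
      field_simp [hμ0]
    have h5 : (∑ p, ∑ q, μ p ^ 2 * ‖(Dg (fun z => (c z)⁻¹) Z') (p, q)‖ ^ 2) = S := by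
      refine Finset.sum_congr rfl fun p _ => Finset.sum_congr rfl fun q _ => ?_
      rw [hDg, hDg, norm_mul, norm_mul, mul_pow, mul_pow, Complex.norm_real, Complex.norm_real,
        Real.norm_eq_abs, Real.norm_eq_abs, sq_abs, sq_abs, inv_pow, hcsq]
      field_simp [hμ0]
    rw [h3, h4, h5, Complex.norm_real, Real.norm_eq_abs, sq_abs] at h2
    have hSpos : 0 < S := by
      have hne : Z ≠ 0 := by
        have := e.orthonormal.1 m
        intro h0; rw [← hZ, h0] at this; simp at this
      obtain ⟨⟨p0, q0⟩, hpq⟩ : ∃ z, Z z ≠ 0 := by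
        by_contra! hcon; exact hne (by ext z; simpa using hcon z)
      have hnn : ∀ p q, 0 ≤ μ q / μ p * ‖Z (p, q)‖ ^ 2 := fun p q =>
        mul_nonneg (div_nonneg (hμ _).le (hμ _).le) (by positivity)
      have hp := hμ p0
      have hq := hμ q0
      refine Finset.sum_pos' (fun p _ => Finset.sum_nonneg fun q _ => hnn p q)
        ⟨p0, Finset.mem_univ _, Finset.sum_pos' (fun q _ => hnn p0 q) ⟨q0, Finset.mem_univ _, ?_⟩⟩
      have : 0 < ‖Z (p0, q0)‖ := norm_pos_iff.2 hpq
      positivity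
    by_contra! hlt
    have : S * S < (l * S) ^ 2 := by
      have h7 : S < l * S := by nlinarith
      nlinarith
    linarith
  have key : ∀ Z, ‖L' Z‖ ^ 2 ≤ ‖Z‖ ^ 2 := by
    intro Z
    have h1 : ((‖L' Z‖ ^ 2 : ℝ) : ℂ) = ∑ m, (hsym.eigenvalues rfl m * ‖⟪e m, Z⟫_ℂ‖ ^ 2 : ℝ) := by
      push_cast
      have : ((‖L' Z‖ : ℂ)) ^ 2 = ⟪T Z, Z⟫_ℂ := by
        rw [hT]; exact (inner_self_eq_norm_sq_to_K (𝕜 := ℂ) (L' Z)).symm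
      rw [this, ← e.sum_inner_mul_inner]
      refine Finset.sum_congr rfl fun m _ => ?_
      rw [hsym, hev, inner_smul_right, mul_assoc, ← inner_conj_symm Z, mul_comm (conj _),
        Complex.mul_conj, Complex.normSq_eq_norm_sq]
      push_cast; rfl
    have h2 : ‖L' Z‖ ^ 2 = ∑ m, (hsym.eigenvalues rfl m * ‖⟪e m, Z⟫_ℂ‖ ^ 2) := by
      exact_mod_cast h1
    rw [h2, ← e.sum_sq_norm_inner_right Z]
    refine Finset.sum_le_sum fun m _ => ?_
    have := hle m
    have := sq_nonneg ‖⟪e m, Z⟫_ℂ‖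
    nlinarith
  have h := key (Dg c X)
  have h1 : L' (Dg c X) = L X := by
    simp only [L', LinearMap.comp_apply]
    congr 1
    ext z
    rw [hDg, hDg]
    have : (c z : ℂ) ≠ 0 := by exact_mod_cast (hcpos z).ne'
    push_cast
    field_simp
  rw [h1] at h
  refine h.trans (le_of_eq ?_)
  rw [EuclideanSpace.norm_sq_eq, Fintype.sum_prod_type]
  refine Finset.sum_congr rfl fun p _ => Finset.sum_congr rfl fun q _ => ?_
  rw [hDg, norm_mul, mul_pow, Complex.norm_real, Real.norm_eq_abs, sq_abs, hcsq]

end FinDim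


section FinDim2
open scoped InnerProductSpace
open ComplexConjugate ContinuousLinearMap

variable {K : Type*} [NormedAddCommGroup K] [InnerProductSpace ℂ K] [CompleteSpace K]
  [FiniteDimensional ℂ K] {N : Type*} [Fintype N]

theorem nqR_mul {ι : Type*} [Fintype ι] (n : ι → ℝ) (v : ι → K)
    (hv : ∀ l l', l ≠ l' → ⟪v l, v l'⟫_ℂ = 0) (hn : ∀ l, n l * ‖v l‖ ^ 2 = n l) :
    nqR n v * nqR n v = nqR (fun l => n l ^ 2) v := by
  classical
  ext z
  rw [mul_apply_eq_comp, nqR_apply n v z, map_sum, nqR_apply]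
  refine Finset.sum_congr rfl fun l _ => ?_
  rw [map_smul, nqR_apply, Finset.sum_eq_single l]
  · rw [smul_smul]
    congr 1
    have h1 : ⟪v l, v l⟫_ℂ = ((‖v l‖ ^ 2 : ℝ) : ℂ) := by
      rw [inner_self_eq_norm_sq_to_K (𝕜 := ℂ) (v l)]; push_cast; rfl
    have h2 : (n l : ℂ) * ((‖v l‖ ^ 2 : ℝ) : ℂ) = n l := by exact_mod_cast hn l
    rw [h1, h2]; push_cast; ring
  · intro l' _ hne
    rw [hv l' l hne]; simp
  · simp

theorem nq_sum_w {M : Type*} [Fintype M] (f : OrthonormalBasis N ℂ K) (μ : N → ℝ)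
    (w : M → K) (hw : ∀ z, ∑ m, ‖⟪z, w m⟫_ℂ‖ ^ 2 ≤ ∑ q, μ q ^ 2 * ‖⟪f q, z⟫_ℂ‖ ^ 2)
    (X : K →L[ℂ] K) :
    ∑ m, ‖X (w m)‖ ^ 2 ≤ ∑ p, ∑ q, μ q ^ 2 * ‖⟪f p, X (f q)⟫_ℂ‖ ^ 2 := by
  have h1 : ∀ m, ‖X (w m)‖ ^ 2 = ∑ p, ‖⟪f p, X (w m)⟫_ℂ‖ ^ 2 := fun p =>
    (f.sum_sq_norm_inner_right _).symm
  simp_rw [h1]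
  rw [Finset.sum_comm]
  refine Finset.sum_le_sum fun p _ => ?_
  simp_rw [← adjoint_inner_left X]
  refine (hw _).trans (le_of_eq ?_)
  refine Finset.sum_congr rfl fun q _ => ?_
  rw [norm_inner_symm]

theorem nq_M {V : Type*} [NormedAddCommGroup V] [InnerProductSpace ℂ V]
    [FiniteDimensional ℂ V] {ι M : Type} [Fintype ι] [Fintype M]
    (n : ι → ℝ) (hn0 : ∀ l, 0 ≤ n l) (v : ι → K)
    (hv : ∀ l l', l ≠ l' → ⟪v l, v l'⟫_ℂ = 0) (hn : ∀ l, n l * ‖v l‖ ^ 2 = n l)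
    (τ : K →L[ℂ] K) (hτs : ∀ x y, ⟪τ x, y⟫_ℂ = ⟪x, τ y⟫_ℂ)
    (hτ : ∀ x, x ≠ 0 → 0 < (⟪x, τ x⟫_ℂ).re)
    (t : ℝ) (ht : LinearMap.trace ℂ K τ = (t : ℂ))
    (w : M → K) (hw : ∀ z, ∑ m, ‖⟪z, w m⟫_ℂ‖ ^ 2 ≤
      ∑ l, n l ^ 2 * ‖⟪v l, z⟫_ℂ‖ ^ 2 + (⟪z, τ z⟫_ℂ).re)
    (L : (K →L[ℂ] K) →ₗ[ℂ] V)
    (hL : ∀ X Y, ‖⟪L X, L Y⟫_ℂ‖ ^ 2 ≤ (∑ m, ‖X (w m)‖ ^ 2) * ∑ m, ‖adjoint Y (w m)‖ ^ 2)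
    (X : K →L[ℂ] K) :
    ‖L X‖ ^ 2 ≤ ∑ l, ∑ l', n l * n l' * ‖⟪v l, X (v l')⟫_ℂ‖ ^ 2 +
      ‖X‖ ^ 2 * (Real.sqrt t * (Real.sqrt (∑ l, n l ^ 2 + t) + Real.sqrt (∑ l, n l ^ 2))) := by
  classical
  set h := nqR (fun l => n l ^ 2) v with hh
  set q := nqR n v with hqdef
  have hqq : q * q = h := nqR_mul n v hv hn
  have hτ0 : ∀ x, 0 ≤ (⟪x, τ x⟫_ℂ).re := by
    intro x
    by_cases hx : x = 0
    · simp [hx]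
    · exact (hτ x hx).le
  set g := h + τ with hg
  have hgs : ∀ x y, ⟪g x, y⟫_ℂ = ⟪x, g y⟫_ℂ := by
    intro x y
    simp only [hg, _root_.add_apply, inner_add_left, inner_add_right, hh, nqR_sym, hτs]
  have hgi : ∀ z, (⟪z, g z⟫_ℂ).re = ∑ l, n l ^ 2 * ‖⟪v l, z⟫_ℂ‖ ^ 2 + (⟪z, τ z⟫_ℂ).re := by
    intro z
    simp only [hg, _root_.add_apply, inner_add_right, hh, nqR_inner, Complex.add_re,
      Complex.ofReal_re]
  have hsym : (g : K →ₗ[ℂ] K).IsSymmetric := hgs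
  let f := hsym.eigenvectorBasis rfl
  have hev : ∀ m, g (f m) = (hsym.eigenvalues rfl m : ℂ) • f m := fun m =>
    hsym.apply_eigenvectorBasis rfl m
  have hfn : ∀ m, ‖f m‖ = 1 := fun m => f.orthonormal.1 m
  have hlam : ∀ m, 0 < hsym.eigenvalues rfl m := by
    intro m
    have h1 := hgi (f m)
    rw [hev, inner_smul_right, inner_self_eq_norm_sq_to_K, hfn] at h1
    simp only [RCLike.ofReal_one, one_pow, mul_one, Complex.ofReal_re] at h1
    rw [h1]
    have h2 := hτ (f m) (fun h0 => by have := hfn m; rw [h0] at this; simp at this)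
    have : 0 ≤ ∑ l, n l ^ 2 * ‖⟪v l, f m⟫_ℂ‖ ^ 2 := Finset.sum_nonneg fun _ _ => by positivity
    linarith
  set μ : Fin (Module.finrank ℂ K) → ℝ := fun m => Real.sqrt (hsym.eigenvalues rfl m) with hμ
  have hμpos : ∀ m, 0 < μ m := fun m => Real.sqrt_pos.2 (hlam m)
  have hμsq : ∀ m, μ m ^ 2 = hsym.eigenvalues rfl m := fun m => Real.sq_sqrt (hlam m).le
  set k := nqR μ f with hk
  have horth : ∀ l l', l ≠ l' → ⟪f l, f l'⟫_ℂ = 0 := fun l l' hne => f.orthonormal.2 hne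
  have hkk : k * k = g := by
    rw [hk, nqR_mul μ f horth (by intro l; rw [hfn]; simp)]
    have hl : ((nqR (fun l => μ l ^ 2) f : K →L[ℂ] K) : K →ₗ[ℂ] K) = (g : K →ₗ[ℂ] K) := by
      refine f.toBasis.ext fun m => ?_
      simp only [OrthonormalBasis.coe_toBasis, ContinuousLinearMap.coe_coe]
      rw [hev, nqR_apply, Finset.sum_eq_single m]
      · rw [inner_self_eq_norm_sq_to_K, hfn, hμsq]; simp
      · intro b _ hb; rw [horth b m hb]; simp
      · simp
    exact ContinuousLinearMap.coe_injective hl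
  have hgf : ∀ z, (⟪z, g z⟫_ℂ).re = ∑ p, μ p ^ 2 * ‖⟪f p, z⟫_ℂ‖ ^ 2 := by
    intro z
    rw [← hkk, hk, nqR_mul μ f horth (by intro l; rw [hfn]; simp), nqR_inner, Complex.ofReal_re]
  have hw' : ∀ z, ∑ m, ‖⟪z, w m⟫_ℂ‖ ^ 2 ≤ ∑ p, μ p ^ 2 * ‖⟪f p, z⟫_ℂ‖ ^ 2 := by
    intro z; rw [← hgf, hgi]; exact hw z
  -- matrix units
  let op : EuclideanSpace ℂ (Fin (Module.finrank ℂ K) × Fin (Module.finrank ℂ K)) →ₗ[ℂ] (K →L[ℂ] K) :=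
    { toFun := fun Z => ∑ p, ∑ r, Z (p, r) • (innerSL ℂ (f r)).smulRight (f p)
      map_add' := by intro x y; simp [add_smul, Finset.sum_add_distrib]
      map_smul' := by intro c x; simp [smul_smul, Finset.smul_sum] }
  have hop : ∀ Z p r, ⟪f p, op Z (f r)⟫_ℂ = Z (p, r) := by
    intro Z p r
    simp only [op, LinearMap.coe_mk, AddHom.coe_mk, ContinuousLinearMap.sum_apply,
      _root_.smul_apply, ContinuousLinearMap.smulRight_apply, innerSL_apply_apply, inner_sum,
      inner_smul_right]
    rw [Finset.sum_eq_single p, Finset.sum_eq_single r]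
    · rw [inner_self_eq_norm_sq_to_K, inner_self_eq_norm_sq_to_K, hfn, hfn]; simp
    · intro b _ hb; rw [horth b r hb]; simp
    · simp
    · intro b _ hb; refine Finset.sum_eq_zero fun c _ => ?_
      rw [horth p b hb.symm]; simp
    · simp
  have hXop : X = op (WithLp.toLp 2 fun z => ⟪f z.1, X (f z.2)⟫_ℂ) := by
    apply ContinuousLinearMap.coe_injective
    refine f.toBasis.ext fun m => ?_
    apply f.repr.injective
    ext p
    simp only [OrthonormalBasis.coe_toBasis, ContinuousLinearMap.coe_coe, f.repr_apply_apply]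
    rw [hop]
  have hint := nq_interp μ hμpos (L ∘ₗ op) (by
    intro Z Z'
    refine (hL (op Z) (op Z')).trans ?_
    refine mul_le_mul ?_ ?_ (Finset.sum_nonneg fun _ _ => by positivity)
      (Finset.sum_nonneg fun _ _ => Finset.sum_nonneg fun _ _ => by positivity)
    · refine (nq_sum_w f μ w hw' (op Z)).trans (le_of_eq ?_)
      simp only [hop]
    · refine (nq_sum_w f μ w hw' (adjoint (op Z'))).trans (le_of_eq ?_)
      rw [Finset.sum_comm]
      refine Finset.sum_congr rfl fun p _ => Finset.sum_congr rfl fun r _ => ?_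
      rw [adjoint_inner_right, norm_inner_symm, hop]) (WithLp.toLp 2 fun z => ⟪f z.1, X (f z.2)⟫_ℂ)
  rw [LinearMap.comp_apply, ← hXop] at hint
  refine hint.trans ?_
  simp only
  -- trace forms
  let Tr : (K →L[ℂ] K) → (K →L[ℂ] K) → ℂ := fun a b => ∑ p, ⟪a (f p), X (b (adjoint X (f p)))⟫_ℂ
  have hTrb : ∀ a b, ‖Tr a b‖ ≤ ‖X‖ ^ 2 * (Real.sqrt (nqHS f a) * Real.sqrt (nqHS f b)) := by
    intro a b
    have h1 : ‖Tr a b‖ ^ 2 ≤ nqHS f a * nqHS f (X * (b * adjoint X)) := nq_cs_inner _ _ _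
    have h2 : nqHS f (X * (b * adjoint X)) ≤ ‖X‖ ^ 2 * (‖X‖ ^ 2 * nqHS f b) := by
      refine (nqHS_left _ _ _).trans ?_
      gcongr
      refine (nqHS_right _ _ _).trans (le_of_eq ?_)
      rw [← star_eq_adjoint, norm_star]
    have h3 : ‖Tr a b‖ ^ 2 ≤ (‖X‖ ^ 2 * (Real.sqrt (nqHS f a) * Real.sqrt (nqHS f b))) ^ 2 := by
      refine h1.trans ?_
      rw [mul_pow, mul_pow, Real.sq_sqrt (nqHS_nonneg _ _), Real.sq_sqrt (nqHS_nonneg _ _)]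
      have := mul_le_mul_of_nonneg_left h2 (nqHS_nonneg f a)
      nlinarith
    exact le_of_sq_le_sq h3 (by positivity)
  have hTrsum : Tr k k = Tr q q + Tr (k - q) k + Tr q (k - q) := by
    simp only [Tr, ← Finset.sum_add_distrib]
    refine Finset.sum_congr rfl fun p _ => ?_
    simp only [_root_.sub_apply, inner_sub_left, map_sub, inner_sub_right]
    ring
  have hgen : ∀ {J : Type} [Fintype J] (c : J → ℝ) (u : J → K),
      Tr (nqR c u) (nqR c u) = ((∑ l, ∑ l', c l * c l' * ‖⟪u l, X (u l')⟫_ℂ‖ ^ 2 : ℝ) : ℂ) := by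
    intro J _ c u
    have e1 : ∀ p, ⟪nqR c u (f p), X (nqR c u (adjoint X (f p)))⟫_ℂ =
        ∑ l, (c l : ℂ) * (⟪X (nqR c u (adjoint X (u l))), f p⟫_ℂ * ⟪f p, u l⟫_ℂ) := by
      intro p
      rw [nqR_apply c u (f p), sum_inner]
      refine Finset.sum_congr rfl fun l _ => ?_
      rw [inner_smul_left, map_mul, Complex.conj_ofReal, inner_conj_symm]
      have : ⟪u l, X (nqR c u (adjoint X (f p)))⟫_ℂ = ⟪X (nqR c u (adjoint X (u l))), f p⟫_ℂ := by
        rw [← adjoint_inner_left, ← nqR_sym, adjoint_inner_right]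
      rw [this]; ring
    simp only [Tr, e1]
    rw [Finset.sum_comm]
    simp only [← Finset.mul_sum, f.sum_inner_mul_inner]
    push_cast
    refine Finset.sum_congr rfl fun l _ => ?_
    rw [← adjoint_inner_right, nqR_sym, nqR_inner]
    push_cast
    rw [Finset.mul_sum]
    refine Finset.sum_congr rfl fun l' _ => ?_
    rw [adjoint_inner_right, norm_inner_symm]; ring
  have hkk2 : (∑ p, ∑ r, μ p * μ r * ‖⟪f p, X (f r)⟫_ℂ‖ ^ 2) = (Tr k k).re := by
    rw [hk, hgen, Complex.ofReal_re]
  have hqq2 : (∑ l, ∑ l', n l * n l' * ‖⟪v l, X (v l')⟫_ℂ‖ ^ 2) = (Tr q q).re := by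
    rw [hqdef, hgen, Complex.ofReal_re]
  have hHSself : ∀ {J : Type} [Fintype J] (c : J → ℝ) (u : J → K),
      (nqHS f (nqR c u)) = (∑ p, ⟪f p, (nqR c u * nqR c u) (f p)⟫_ℂ).re := by
    intro J _ c u
    rw [nqHS, Complex.re_sum]
    refine Finset.sum_congr rfl fun p _ => ?_
    rw [mul_apply_eq_comp, ← nqR_sym, inner_self_eq_norm_sq_to_K (𝕜 := ℂ)]
    norm_cast
  have hnn : (∑ p, ⟪f p, h (f p)⟫_ℂ) = ((∑ l, n l ^ 2 : ℝ) : ℂ) := by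
    rw [hh, nqR_trace]
    congr 1
    refine Finset.sum_congr rfl fun l _ => ?_
    rw [pow_two, mul_assoc, hn]
  have hτt : (∑ p, ⟪f p, τ (f p)⟫_ℂ) = t := by
    rw [← ht, LinearMap.trace_eq_sum_inner _ f]; rfl
  have hHSq : nqHS f q = ∑ l, n l ^ 2 := by
    rw [hqdef, hHSself, ← hqdef, hqq, hnn, Complex.ofReal_re]
  have hHSk : nqHS f k = ∑ l, n l ^ 2 + t := by
    rw [hk, hHSself, ← hk, hkk, hg]
    simp only [_root_.add_apply, inner_add_right, Finset.sum_add_distrib]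
    rw [hnn, hτt, Complex.add_re, Complex.ofReal_re, Complex.ofReal_re]
  have hHSD : nqHS f (k - q) ≤ t := by
    have := nq_eig f (k - q) k q τ rfl
      (fun x => by rw [hk, nqR_inner, Complex.ofReal_re]; exact Finset.sum_nonneg fun p _ => mul_nonneg (hμpos p).le (by positivity))
      (fun x => by rw [hqdef, nqR_inner, Complex.ofReal_re]; exact Finset.sum_nonneg fun p _ => mul_nonneg (hn0 p) (by positivity))
      (nqR_sym _ _) (nqR_sym _ _) (by rw [hkk, hqq]) hτ0
    rwa [hτt, Complex.ofReal_re] at this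
  rw [hkk2, hqq2, hTrsum, Complex.add_re, Complex.add_re, add_assoc]
  gcongr
  have b1 := (Complex.re_le_norm _).trans (hTrb (k - q) k)
  have b2 := (Complex.re_le_norm _).trans (hTrb q (k - q))
  rw [hHSk] at b1
  rw [hHSq] at b2
  have hs : Real.sqrt (nqHS f (k - q)) ≤ Real.sqrt t := Real.sqrt_le_sqrt hHSD
  have c1 : ‖X‖ ^ 2 * (Real.sqrt (nqHS f (k - q)) * Real.sqrt (∑ l, n l ^ 2 + t)) ≤
    ‖X‖ ^ 2 * (Real.sqrt t * Real.sqrt (∑ l, n l ^ 2 + t)) := by gcongr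
  have c2 : ‖X‖ ^ 2 * (Real.sqrt (∑ l, n l ^ 2) * Real.sqrt (nqHS f (k - q))) ≤
    ‖X‖ ^ 2 * (Real.sqrt (∑ l, n l ^ 2) * Real.sqrt t) := by gcongr
  linarith

end FinDim2


section Star
open scoped InnerProductSpace
open ComplexConjugate ContinuousLinearMap

variable {H : Type*} [NormedAddCommGroup H] [InnerProductSpace ℂ H] [CompleteSpace H]

noncomputable def nqE {ι : Type} [Fintype ι] (a : ι → H →L[ℂ] H) (x : H →L[ℂ] H) : H →L[ℂ] H :=
  ∑ j, adjoint (a j) ∘L x ∘L a j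

theorem nqE_inner {ι : Type} [Fintype ι] (a : ι → H →L[ℂ] H) (x : H →L[ℂ] H) (z y : H) :
    ⟪z, nqE a x y⟫_ℂ = ∑ j, ⟪a j z, x (a j y)⟫_ℂ := by
  simp [nqE, ContinuousLinearMap.sum_apply, inner_sum, adjoint_inner_right]

theorem nqE_apply_norm {ι : Type} [Fintype ι] (a : ι → H →L[ℂ] H)
    (ha : ∀ η, ∑ j, ‖a j η‖ ^ 2 ≤ ‖η‖ ^ 2) (x : H →L[ℂ] H) (z : H) :
    ‖nqE a x z‖ ^ 2 ≤ ∑ j, ‖x (a j z)‖ ^ 2 := by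
  set s := nqE a x z with hs
  have h1 : ((‖s‖ ^ 2 : ℝ) : ℂ) = ∑ j, ⟪a j s, x (a j z)⟫_ℂ := by
    rw [← nqE_inner, ← hs, inner_self_eq_norm_sq_to_K (𝕜 := ℂ)]; push_cast; rfl
  have h2 := nq_cs_inner Finset.univ (fun j => a j s) (fun j => x (a j z))
  rw [← h1, Complex.norm_real, Real.norm_eq_abs, sq_abs] at h2
  have h3 : (‖s‖ ^ 2) ^ 2 ≤ ‖s‖ ^ 2 * ∑ j, ‖x (a j z)‖ ^ 2 :=
    h2.trans (mul_le_mul_of_nonneg_right (ha s) (Finset.sum_nonneg fun _ _ => by positivity))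
  have h4 : 0 ≤ ∑ j, ‖x (a j z)‖ ^ 2 := (Finset.sum_nonneg fun _ _ => by positivity)
  by_contra! hc
  nlinarith

theorem nqE_norm {ι : Type} [Fintype ι] (a : ι → H →L[ℂ] H)
    (ha : ∀ η, ∑ j, ‖a j η‖ ^ 2 ≤ ‖η‖ ^ 2) (x : H →L[ℂ] H) : ‖nqE a x‖ ≤ ‖x‖ := by
  refine ContinuousLinearMap.opNorm_le_bound _ (norm_nonneg _) fun z => ?_
  refine le_of_sq_le_sq ?_ (by positivity)
  refine (nqE_apply_norm a ha x z).trans ?_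
  calc ∑ j, ‖x (a j z)‖ ^ 2 ≤ ∑ j, ‖x‖ ^ 2 * ‖a j z‖ ^ 2 := by
        refine Finset.sum_le_sum fun j _ => ?_
        rw [← mul_pow]; gcongr; exact x.le_opNorm _
    _ ≤ _ := by rw [← Finset.mul_sum, mul_pow]; gcongr; exact ha z

theorem nqE_adj {ι : Type} [Fintype ι] (a : ι → H →L[ℂ] H) (x : H →L[ℂ] H) (z y : H) :
    ⟪nqE a (adjoint x) z, y⟫_ℂ = ⟪z, nqE a x y⟫_ℂ := by
  rw [← inner_conj_symm, nqE_inner, nqE_inner, map_sum]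
  refine Finset.sum_congr rfl fun j _ => ?_
  rw [inner_conj_symm, adjoint_inner_left]

theorem nqE_add {ι : Type} [Fintype ι] (a : ι → H →L[ℂ] H) (x y : H →L[ℂ] H) :
    nqE a (x + y) = nqE a x + nqE a y := by
  simp [nqE, Finset.sum_add_distrib]

theorem nqE_smul {ι : Type} [Fintype ι] (a : ι → H →L[ℂ] H) (c : ℂ) (y : H →L[ℂ] H) :
    nqE a (c • y) = c • nqE a y := by
  simp [nqE, Finset.smul_sum]

theorem nqE_bessel {ι κ : Type} [Fintype ι] [Fintype κ] (a : ι → H →L[ℂ] H)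
    (ha : ∀ η, ∑ j, ‖a j η‖ ^ 2 ≤ ‖η‖ ^ 2) (m : κ → ℝ) (u : κ → H)
    (hu : ∀ z, ∑ q, ‖⟪u q, z⟫_ℂ‖ ^ 2 ≤ ‖z‖ ^ 2) (x : H →L[ℂ] H) :
    ∑ q, ∑ q', m q' ^ 2 * ‖⟪u q, nqE a x (u q')⟫_ℂ‖ ^ 2 ≤
      ∑ p : ι × κ, ‖x (a p.1 ((m p.2 : ℂ) • u p.2))‖ ^ 2 := by
  rw [Finset.sum_comm, Fintype.sum_prod_type, Finset.sum_comm (s := Finset.univ (α := ι))]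
  refine Finset.sum_le_sum fun q' _ => ?_
  rw [← Finset.mul_sum]
  have : ∀ j, ‖x (a j ((m q' : ℂ) • u q'))‖ ^ 2 = m q' ^ 2 * ‖x (a j (u q'))‖ ^ 2 := by
    intro j
    rw [map_smul, map_smul, norm_smul, mul_pow, Complex.norm_real, Real.norm_eq_abs, sq_abs]
  simp only [this]
  rw [← Finset.mul_sum]
  gcongr
  exact (hu _).trans (nqE_apply_norm a ha x _)

theorem nq_star {ι κ : Type} [Fintype ι] [Fintype κ]
    (a : ι → H →L[ℂ] H) (ha : ∀ η, ∑ j, ‖a j η‖ ^ 2 ≤ ‖η‖ ^ 2)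
    (n : ι → ℝ) (hn0 : ∀ l, 0 ≤ n l) (v : ι → H)
    (hv : ∀ l l', l ≠ l' → ⟪v l, v l'⟫_ℂ = 0) (hn : ∀ l, n l * ‖v l‖ ^ 2 = n l)
    (m : κ → ℝ) (hm0 : ∀ q, 0 ≤ m q) (u : κ → H)
    (hu : ∀ z, ∑ q, ‖⟪u q, z⟫_ℂ‖ ^ 2 ≤ ‖z‖ ^ 2)
    (M : κ → ι → ι → ℂ)
    (hM : ∀ η : ι → ℂ, ∑ q, ∑ j, ‖∑ l, M q j l * η l‖ ^ 2 ≤ ∑ l, ‖η l‖ ^ 2)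
    (r : ι × κ → H)
    (hr : ∀ p : ι × κ, a p.1 ((m p.2 : ℂ) • u p.2) = ∑ l, M p.2 p.1 l • (n l : ℂ) • v l + r p)
    (R : ℝ) (hR : ∑ p, ‖r p‖ ^ 2 ≤ R) (P : ℝ) (hP : ∑ l, n l ^ 2 ≤ P)
    (σ : ℝ) (hσ : 0 < σ) (x : H →L[ℂ] H) :
    ∑ q, ∑ q', m q * m q' * ‖⟪u q, nqE a x (u q')⟫_ℂ‖ ^ 2 ≤
      ∑ l, ∑ l', n l * n l' * ‖⟪v l, x (v l')⟫_ℂ‖ ^ 2 +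
      ‖x‖ ^ 2 * (Real.sqrt (σ * P + (1 + 1 / σ) * R + σ) *
        (Real.sqrt (P + (σ * P + (1 + 1 / σ) * R + σ)) + Real.sqrt P)) := by
  classical
  let gen : (ι × κ) ⊕ (ι ⊕ (ι × κ)) → H :=
    Sum.elim (fun p => a p.1 (u p.2)) (Sum.elim v r)
  let K : Submodule ℂ H := Submodule.span ℂ (Set.range gen)
  have : FiniteDimensional ℂ K := FiniteDimensional.span_of_finite ℂ (Set.finite_range _)
  have hK1 : ∀ j q, a j (u q) ∈ K := fun j q => Submodule.subset_span ⟨Sum.inl (j, q), rfl⟩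
  have hK2 : ∀ l, v l ∈ K := fun l => Submodule.subset_span ⟨Sum.inr (Sum.inl l), rfl⟩
  have hK3 : ∀ p, r p ∈ K := fun l => Submodule.subset_span ⟨Sum.inr (Sum.inr l), rfl⟩
  have hK4 : ∀ p : ι × κ, a p.1 ((m p.2 : ℂ) • u p.2) ∈ K := fun p => by
    rw [map_smul]; exact K.smul_mem _ (hK1 _ _)
  let v' : ι → K := fun l => ⟨v l, hK2 l⟩
  let r' : ι × κ → K := fun p => ⟨r p, hK3 p⟩
  let w' : ι × κ → K := fun p => ⟨_, hK4 p⟩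
  let PK := K.orthogonalProjection
  let lift : (K →L[ℂ] K) → (H →L[ℂ] H) := fun Y => K.subtypeL ∘L Y ∘L PK
  have hPK : ∀ z (hz : z ∈ K), PK z = ⟨z, hz⟩ := fun z hz =>
    Submodule.orthogonalProjection_mem_subspace_eq_self (⟨z, hz⟩ : K)
  let L : (K →L[ℂ] K) →ₗ[ℂ] EuclideanSpace ℂ (κ × κ) :=
    { toFun := fun Y => WithLp.toLp 2 fun z =>
        (Real.sqrt (m z.1 * m z.2) : ℂ) * ⟪u z.1, nqE a (lift Y) (u z.2)⟫_ℂ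
      map_add' := by
        intro x y; ext z
        have : lift (x + y) = lift x + lift y := by ext; simp [lift]
        simp [this, nqE_add, inner_add_right, mul_add]
      map_smul' := by
        intro c x; ext z
        have : lift (c • x) = c • lift x := by ext; simp [lift]
        simp [this, nqE_smul, inner_smul_right]; ring }
  have hLa : ∀ Y z, L Y z = (Real.sqrt (m z.1 * m z.2) : ℂ) * ⟪u z.1, nqE a (lift Y) (u z.2)⟫_ℂ :=
    fun _ _ => rfl
  have hlift : ∀ (Y : K →L[ℂ] K) p, ‖lift Y (a p.1 ((m p.2 : ℂ) • u p.2))‖ = ‖Y (w' p)‖ := by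
    intro Y p
    simp only [lift, ContinuousLinearMap.comp_apply]
    rw [hPK _ (hK4 p)]
    rfl
  have hladj : ∀ Y : K →L[ℂ] K, adjoint (lift Y) = lift (adjoint Y) := by
    intro Y
    simp only [lift, adjoint_comp, PK, Submodule.adjoint_orthogonalProjection,
      Submodule.adjoint_subtypeL]
    rfl
  have hL : ∀ X Y, ‖⟪L X, L Y⟫_ℂ‖ ^ 2 ≤ (∑ p, ‖X (w' p)‖ ^ 2) * ∑ p, ‖adjoint Y (w' p)‖ ^ 2 := by
    intro X Y
    have e1 : ⟪L X, L Y⟫_ℂ = ∑ z : κ × κ, ((m z.2 : ℂ) * conj ⟪u z.1, nqE a (lift X) (u z.2)⟫_ℂ) *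
        ((m z.1 : ℂ) * ⟪u z.1, nqE a (lift Y) (u z.2)⟫_ℂ) := by
      rw [PiLp.inner_apply]
      refine Finset.sum_congr rfl fun z _ => ?_
      rw [RCLike.inner_apply, hLa, hLa, map_mul, Complex.conj_ofReal]
      have : (Real.sqrt (m z.1 * m z.2) : ℂ) * (Real.sqrt (m z.1 * m z.2) : ℂ) = m z.1 * m z.2 := by
        rw [← Complex.ofReal_mul, Real.mul_self_sqrt (mul_nonneg (hm0 _) (hm0 _))]; push_cast; rfl
      linear_combination (conj ⟪u z.1, nqE a (lift X) (u z.2)⟫_ℂ * ⟪u z.1, nqE a (lift Y) (u z.2)⟫_ℂ) * this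
    rw [e1]
    refine (nq_cs _ _ _).trans ?_
    refine mul_le_mul ?_ ?_ (Finset.sum_nonneg fun _ _ => by positivity)
      (Finset.sum_nonneg fun _ _ => by positivity)
    · simp only [← hlift]
      refine le_trans (le_of_eq ?_) (nqE_bessel a ha m u hu (lift X))
      rw [Fintype.sum_prod_type]
      refine Finset.sum_congr rfl fun p _ => Finset.sum_congr rfl fun q _ => ?_
      rw [norm_mul, mul_pow, Complex.norm_real, Real.norm_eq_abs, sq_abs, RCLike.norm_conj]
    · simp only [← hlift]
      refine le_trans (le_of_eq ?_) (nqE_bessel a ha m u hu (lift (adjoint Y)))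
      rw [Fintype.sum_prod_type, Finset.sum_comm]
      refine Finset.sum_congr rfl fun p _ => Finset.sum_congr rfl fun q _ => ?_
      rw [norm_mul, mul_pow, Complex.norm_real, Real.norm_eq_abs, sq_abs, ← hladj,
        ← norm_inner_symm (nqE a (adjoint (lift Y)) (u q)), nqE_adj]
  set d : ℝ := ((Module.finrank ℂ K : ℕ) : ℝ) with hd
  have hd0 : 0 ≤ d := Nat.cast_nonneg _
  set c : ℝ := σ / (d + 1) with hc
  have hcpos : 0 < c := by positivity
  have hcd : c * d ≤ σ := by
    rw [hc, div_mul_eq_mul_div, div_le_iff₀ (by positivity)]; nlinarith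
  let τ : K →L[ℂ] K := nqR (fun l => σ * n l ^ 2) v' + nqR (fun _ => 1 + 1 / σ) r' + (c : ℂ) • 1
  have hτi : ∀ z, (⟪z, τ z⟫_ℂ) = ((∑ l, σ * n l ^ 2 * ‖⟪v' l, z⟫_ℂ‖ ^ 2 +
      ∑ p, (1 + 1 / σ) * ‖⟪r' p, z⟫_ℂ‖ ^ 2 + c * ‖z‖ ^ 2 : ℝ) : ℂ) := by
    intro z
    simp only [τ, _root_.add_apply, inner_add_right, nqR_inner, _root_.smul_apply,
      ContinuousLinearMap.one_apply, inner_smul_right]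
    rw [inner_self_eq_norm_sq_to_K (𝕜 := ℂ)]
    push_cast; rfl
  set t0 : ℝ := σ * ∑ l, n l ^ 2 + (1 + 1 / σ) * ∑ p, ‖r p‖ ^ 2 + c * d with ht0
  have htr : LinearMap.trace ℂ K τ = (t0 : ℂ) := by
    let e := stdOrthonormalBasis ℂ K
    rw [LinearMap.trace_eq_sum_inner _ e]
    have : ∀ p, ⟪e p, (τ : K →ₗ[ℂ] K) (e p)⟫_ℂ = ⟪e p, nqR (fun l => σ * n l ^ 2) v' (e p)⟫_ℂ +
      ⟪e p, nqR (fun _ => 1 + 1 / σ) r' (e p)⟫_ℂ + c := by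
      intro p
      simp only [ContinuousLinearMap.coe_coe, τ, _root_.add_apply, inner_add_right,
        _root_.smul_apply, ContinuousLinearMap.one_apply, inner_smul_right]
      rw [inner_self_eq_norm_sq_to_K (𝕜 := ℂ), e.orthonormal.1 p]; simp
    simp only [this, Finset.sum_add_distrib, nqR_trace]
    have e1 : ∑ l, σ * n l ^ 2 * ‖v' l‖ ^ 2 = σ * ∑ l, n l ^ 2 := by
      rw [Finset.mul_sum]
      refine Finset.sum_congr rfl fun l _ => ?_
      rw [mul_assoc, pow_two (n l), mul_assoc]
      have : n l * ‖v' l‖ ^ 2 = n l := hn l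
      rw [this]
    have e2 : ∑ p, (1 + 1 / σ) * ‖r' p‖ ^ 2 = (1 + 1 / σ) * ∑ p, ‖r p‖ ^ 2 := by
      rw [Finset.mul_sum]; rfl
    rw [e1, e2, Finset.sum_const, Finset.card_univ, Fintype.card_fin, ht0, hd]
    simp only [nsmul_eq_mul]
    push_cast; ring
  have hτs : ∀ x y, ⟪τ x, y⟫_ℂ = ⟪x, τ y⟫_ℂ := by
    intro x y
    simp only [τ, _root_.add_apply, inner_add_right, inner_add_left, nqR_sym, _root_.smul_apply,
      ContinuousLinearMap.one_apply, inner_smul_right, inner_smul_left, Complex.conj_ofReal]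
  have hτpos : ∀ x, x ≠ 0 → 0 < (⟪x, τ x⟫_ℂ).re := by
    intro z hz
    rw [hτi, Complex.ofReal_re]
    have h1 : 0 ≤ ∑ l, σ * n l ^ 2 * ‖⟪v' l, z⟫_ℂ‖ ^ 2 := Finset.sum_nonneg fun _ _ => by positivity
    have h2 : 0 ≤ ∑ p, (1 + 1 / σ) * ‖⟪r' p, z⟫_ℂ‖ ^ 2 := Finset.sum_nonneg fun _ _ => by positivity
    have h3 : 0 < ‖z‖ := norm_pos_iff.2 hz
    positivity
  have hw : ∀ z : K, ∑ p, ‖⟪z, w' p⟫_ℂ‖ ^ 2 ≤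
      ∑ l, n l ^ 2 * ‖⟪v' l, z⟫_ℂ‖ ^ 2 + (⟪z, τ z⟫_ℂ).re := by
    intro z
    rw [hτi, Complex.ofReal_re]
    let η : ι → ℂ := fun l => (n l : ℂ) * ⟪z, v' l⟫_ℂ
    have e1 : ∀ p, ⟪z, w' p⟫_ℂ = ∑ l, M p.2 p.1 l * η l + ⟪z, r' p⟫_ℂ := by
      intro p
      have : w' p = ∑ l, M p.2 p.1 l • (n l : ℂ) • v' l + r' p := by
        apply Subtype.ext
        simp only [w', hr p]
        simp [v', r']
      rw [this, inner_add_right, inner_sum]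
      simp only [inner_smul_right, η]
    have e2 : ∀ p, ‖⟪z, w' p⟫_ℂ‖ ^ 2 ≤ (1 + σ) * ‖∑ l, M p.2 p.1 l * η l‖ ^ 2 +
        (1 + 1 / σ) * ‖⟪r' p, z⟫_ℂ‖ ^ 2 := by
      intro p
      rw [e1, norm_inner_symm (r' p)]
      set A := ∑ l, M p.2 p.1 l * η l
      set B := ⟪z, r' p⟫_ℂ
      have h1 : ‖A + B‖ ^ 2 ≤ (‖A‖ + ‖B‖) ^ 2 := by gcongr; exact norm_add_le _ _
      have h2 : 2 * ‖A‖ * ‖B‖ ≤ σ * ‖A‖ ^ 2 + 1 / σ * ‖B‖ ^ 2 := by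
        have h3 : 0 ≤ (σ * ‖A‖ - ‖B‖) ^ 2 / σ := by positivity
        have h4 : (σ * ‖A‖ - ‖B‖) ^ 2 / σ = σ * ‖A‖ ^ 2 + 1 / σ * ‖B‖ ^ 2 - 2 * ‖A‖ * ‖B‖ := by
          field_simp; ring
        linarith
      nlinarith
    have e3 : ∑ p : ι × κ, ‖∑ l, M p.2 p.1 l * η l‖ ^ 2 ≤ ∑ l, n l ^ 2 * ‖⟪v' l, z⟫_ℂ‖ ^ 2 := by
      rw [Fintype.sum_prod_type, Finset.sum_comm]
      refine (hM η).trans (le_of_eq ?_)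
      refine Finset.sum_congr rfl fun l _ => ?_
      simp only [η]
      rw [norm_mul, mul_pow, Complex.norm_real, Real.norm_eq_abs, sq_abs, norm_inner_symm]
    have e4 : ∑ l, σ * n l ^ 2 * ‖⟪v' l, z⟫_ℂ‖ ^ 2 = σ * ∑ l, n l ^ 2 * ‖⟪v' l, z⟫_ℂ‖ ^ 2 := by
      rw [Finset.mul_sum]; simp only [mul_assoc]
    rw [e4]
    have e5 := Finset.sum_le_sum fun p (_ : p ∈ Finset.univ) => e2 p
    rw [Finset.sum_add_distrib, ← Finset.mul_sum] at e5
    have : 0 ≤ c * ‖z‖ ^ 2 := by positivity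
    nlinarith
  let X : K →L[ℂ] K := PK ∘L x ∘L K.subtypeL
  have hX : ‖X‖ ≤ ‖x‖ := by
    refine ContinuousLinearMap.opNorm_le_bound _ (norm_nonneg _) fun z => ?_
    exact (K.norm_orthogonalProjection_apply_le _).trans (x.le_opNorm _)
  have hXin : ∀ z y : K, ⟪z, X y⟫_ℂ = ⟪(z : H), x (y : H)⟫_ℂ := by
    intro z y
    simp only [X, ContinuousLinearMap.comp_apply, PK]
    exact Submodule.inner_orthogonalProjectionOnto_eq_of_mem_left z _
  have hXE : ∀ q q', ⟪u q, nqE a (lift X) (u q')⟫_ℂ = ⟪u q, nqE a x (u q')⟫_ℂ := by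
    intro q q'
    rw [nqE_inner, nqE_inner]
    refine Finset.sum_congr rfl fun j _ => ?_
    rw [← hXin ⟨_, hK1 j q⟩ ⟨_, hK1 j q'⟩]
    simp only [lift, ContinuousLinearMap.comp_apply]
    rw [hPK _ (hK1 j q')]; rfl
  have main := nq_M n hn0 v' (fun l l' h => hv l l' h) hn τ hτs hτpos t0 htr w' hw L hL X
  have hLX : ‖L X‖ ^ 2 = ∑ q, ∑ q', m q * m q' * ‖⟪u q, nqE a x (u q')⟫_ℂ‖ ^ 2 := by
    rw [EuclideanSpace.norm_sq_eq, Fintype.sum_prod_type]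
    refine Finset.sum_congr rfl fun q _ => Finset.sum_congr rfl fun q' _ => ?_
    rw [hLa, hXE, norm_mul, mul_pow, Complex.norm_real, Real.norm_eq_abs, sq_abs,
      Real.sq_sqrt (mul_nonneg (hm0 _) (hm0 _))]
  rw [hLX] at main
  refine main.trans ?_
  have ht : t0 ≤ σ * P + (1 + 1 / σ) * R + σ := by
    rw [ht0]; gcongr
  gcongr with l _ l' _
  · exact mul_nonneg (hn0 _) (hn0 _)
  · rw [hXin]

end Star


section CPC
open scoped InnerProductSpace ComplexOrder
open ComplexConjugate ContinuousLinearMap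

/-- completely positive contractions into matrices, Stinespring form -/
structure nqCPC {A : Type*} [NonUnitalNormedRing A] [StarRing A] [NormedSpace ℂ A] {ι : Type} [Fintype ι]
    (β : A →ₗ[ℂ] Matrix ι ι ℂ) : Prop where
  pos : ∀ (k : ℕ) (b : Fin k → A) (η : Fin k → ι → ℂ),
    0 ≤ ∑ p, ∑ q, star (η p) ⬝ᵥ (β (star (b p) * b q) *ᵥ η q)
  contr : ∀ (b : A) (η : ι → ℂ), (star η ⬝ᵥ (β (star b * b) *ᵥ η)).re ≤ ‖b‖ ^ 2 * ∑ j, ‖η j‖ ^ 2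
  bdd : ∃ K : ℝ, ∀ b j k, ‖β b j k‖ ≤ K * ‖b‖

variable {A : Type*} [NonUnitalCStarAlgebra A] {ι : Type} [Fintype ι]
variable {β : A →ₗ[ℂ] Matrix ι ι ℂ}

theorem nq_herm_aux {z w : ℂ} (h1 : (z + w).im = 0) (h2 : (Complex.I * z - Complex.I * w).im = 0) :
    w = conj z := by
  simp at h1 h2
  apply Complex.ext <;> simp <;> linarith

theorem nqCPC.cont (h : nqCPC β) (j k : ι) : Continuous fun b => β b j k := by
  obtain ⟨K, hK⟩ := h.bdd
  exact ((LinearMap.mk ⟨fun b => β b j k, by intros; simp⟩ (by intros; simp) : A →ₗ[ℂ] ℂ).mkContinuous K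
    (fun b => hK b j k)).continuous

theorem nqCPC.contq (h : nqCPC β) (x y : ι → ℂ) : Continuous fun b => x ⬝ᵥ (β b *ᵥ y) := by
  have := h.cont
  simp only [dotProduct, mulVec]
  fun_prop

theorem nqCPC.pos1 (h : nqCPC β) (b : A) (x : ι → ℂ) : 0 ≤ star x ⬝ᵥ (β (star b * b) *ᵥ x) := by
  simpa using h.pos 1 (fun _ => b) (fun _ => x)

theorem nqCPC.pos2 (h : nqCPC β) (b e : A) (x y : ι → ℂ) :
    0 ≤ star x ⬝ᵥ (β (star b * b) *ᵥ x) + star x ⬝ᵥ (β (star b * e) *ᵥ y)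
      + (star y ⬝ᵥ (β (star e * b) *ᵥ x) + star y ⬝ᵥ (β (star e * e) *ᵥ y)) := by
  simpa using h.pos 2 ![b, e] ![x, y]

theorem nqCPC.herm2 (h : nqCPC β) (b e : A) (x y : ι → ℂ) :
    star y ⬝ᵥ (β (star e * b) *ᵥ x) = conj (star x ⬝ᵥ (β (star b * e) *ᵥ y)) := by
  have key : ∀ y, (star x ⬝ᵥ (β (star b * e) *ᵥ y) + star y ⬝ᵥ (β (star e * b) *ᵥ x)).im = 0 := by
    intro y
    have h1 := (Complex.nonneg_iff.1 (h.pos2 b e x y)).2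
    have h2 := (Complex.nonneg_iff.1 (h.pos1 b x)).2
    have h3 := (Complex.nonneg_iff.1 (h.pos1 e y)).2
    simp only [Complex.add_im] at *
    linarith
  apply nq_herm_aux (key y)
  have := key (Complex.I • y)
  simpa [mulVec_smul, sub_eq_add_neg] using this

theorem nq_apx (A : Type*) [NonUnitalCStarAlgebra A] : ∃ l : Filter A, l.NeBot ∧ (∀ b : A, Filter.Tendsto (fun e => e * b) l (nhds b))
    ∧ (∀ b : A, Filter.Tendsto (fun e => b * e) l (nhds b)) ∧ (∀ᶠ e in l, ‖e‖ ≤ 1) ∧ ∀ᶠ e in l, star e = e := by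
  letI := CStarAlgebra.spectralOrder A
  haveI := CStarAlgebra.spectralOrderedRing A
  have H := CStarAlgebra.increasingApproximateUnit A
  exact ⟨_, H.neBot, H.tendsto_mul_right, H.tendsto_mul_left, H.eventually_norm, by
    filter_upwards [H.eventually_nonneg] with e he
    exact he.isSelfAdjoint⟩

theorem nqCPC.herm (h : nqCPC β) (b : A) (x y : ι → ℂ) :
    star y ⬝ᵥ (β b *ᵥ x) = conj (star x ⬝ᵥ (β (star b) *ᵥ y)) := by
  obtain ⟨l, hl, h1, h2, h3, h4⟩ := nq_apx A
  have t1 : Filter.Tendsto (fun e => star y ⬝ᵥ (β (e * b) *ᵥ x)) l (nhds (star y ⬝ᵥ (β b *ᵥ x))) :=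
    ((h.contq (star y) x).tendsto b).comp (h1 b)
  have t2 : Filter.Tendsto (fun e => conj (star x ⬝ᵥ (β (star b * e) *ᵥ y))) l
      (nhds (conj (star x ⬝ᵥ (β (star b) *ᵥ y)))) :=
    (Complex.continuous_conj.tendsto _).comp (((h.contq (star x) y).tendsto (star b)).comp (h2 (star b)))
  refine tendsto_nhds_unique_of_eventuallyEq t1 t2 ?_
  filter_upwards [h4] with e he
  conv_lhs => rw [← he]
  exact h.herm2 b e x y

theorem nqCPC.herm_entry [DecidableEq ι] (h : nqCPC β) (b : A) (j k : ι) : β b j k = conj (β (star b) k j) := by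
  have := h.herm b (Pi.single k 1) (Pi.single j 1)
  simpa [← Pi.single_star, Matrix.mulVec_single_one, dotProduct_single, single_dotProduct, Matrix.col_apply] using this

theorem nqCPC.schwarz (h : nqCPC β) (b : A) (x : ι → ℂ) :
    ∑ j, ‖(β b *ᵥ x) j‖ ^ 2 ≤ (star x ⬝ᵥ (β (star b * b) *ᵥ x)).re := by
  obtain ⟨l, hl, h1, h2, h3, h4⟩ := nq_apx A
  set w := β b *ᵥ x with hw
  have t1 : Filter.Tendsto (fun e => (star w ⬝ᵥ (β (e * b) *ᵥ x)).re) l (nhds (star w ⬝ᵥ (β b *ᵥ x)).re) :=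
    (Complex.continuous_re.tendsto _).comp (((h.contq (star w) x).tendsto b).comp (h1 b))
  have hww : (star w ⬝ᵥ (β b *ᵥ x)).re = ∑ j, ‖w j‖ ^ 2 := by
    rw [← hw]; simp [dotProduct, ← Complex.normSq_apply, Complex.normSq_eq_norm_sq]
  rw [hww] at t1
  have : ∀ᶠ e in l, 2 * (star w ⬝ᵥ (β (e * b) *ᵥ x)).re ≤ (star x ⬝ᵥ (β (star b * b) *ᵥ x)).re + ∑ j, ‖w j‖ ^ 2 := by
    filter_upwards [h3, h4] with e he1 he2
    have p := (Complex.nonneg_iff.1 (h.pos2 b e x (-w))).1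
    have hh := h.herm2 e b (-w) x
    have hc := h.contr e w
    rw [hh] at p
    have hS : 0 ≤ ∑ j, ‖w j‖ ^ 2 := by positivity
    have : ‖e‖ ^ 2 * ∑ j, ‖w j‖ ^ 2 ≤ ∑ j, ‖w j‖ ^ 2 := by
      have : ‖e‖ ^ 2 ≤ 1 := by nlinarith [norm_nonneg e]
      nlinarith
    simp [mulVec_neg] at p
    rw [he2] at *
    linarith
  have := le_of_tendsto (t1.const_mul 2) this
  linarith

theorem nqCPC.contr' (h : nqCPC β) (b : A) (x : ι → ℂ) :
    ∑ j, ‖(β b *ᵥ x) j‖ ^ 2 ≤ ‖b‖ ^ 2 * ∑ j, ‖x j‖ ^ 2 := (h.schwarz b x).trans (h.contr b x)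

/-- (9) -/
theorem nqCPC.nine (h : nqCPC β) {κ : Type} [Fintype κ] (b : κ → A) (hb : ‖∑ q, star (b q) * b q‖ ≤ 1) (x : ι → ℂ) :
    ∑ q, ∑ j, ‖(β (b q) *ᵥ x) j‖ ^ 2 ≤ ∑ j, ‖x j‖ ^ 2 := by
  have h1 : ∑ q, ∑ j, ‖(β (b q) *ᵥ x) j‖ ^ 2 ≤ (star x ⬝ᵥ (β (∑ q, star (b q) * b q) *ᵥ x)).re := by
    rw [map_sum, Matrix.sum_mulVec, dotProduct_sum, Complex.re_sum]
    exact Finset.sum_le_sum fun q _ => h.schwarz _ _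
  refine h1.trans ?_
  letI := CStarAlgebra.spectralOrder A
  haveI := CStarAlgebra.spectralOrderedRing A
  have hn : 0 ≤ ∑ q, star (b q) * b q := Finset.sum_nonneg fun q _ => star_mul_self_nonneg _
  obtain ⟨c, hc⟩ := CStarAlgebra.nonneg_iff_eq_star_mul_self.1 hn
  rw [hc] at hb ⊢
  refine (h.contr c x).trans ?_
  rw [CStarRing.norm_star_mul_self, ← pow_two] at hb
  have : 0 ≤ ∑ j, ‖x j‖ ^ 2 := by positivity
  nlinarith

variable {H : Type*} [NormedAddCommGroup H] [InnerProductSpace ℂ H]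

theorem nq_gram_eq {κ : Type*} [Fintype κ] (R : Matrix κ ι ℂ) (x : ι → H) :
    ((∑ r, ‖∑ k, R r k • x k‖ ^ 2 : ℝ) : ℂ) = ∑ j, ∑ k, (Rᴴ * R) j k * ⟪x j, x k⟫_ℂ := by
  have h : ∀ r, ((‖∑ k, R r k • x k‖ ^ 2 : ℝ) : ℂ) = ∑ j, ∑ k, conj (R r j) * R r k * ⟪x j, x k⟫_ℂ := by
    intro r
    have : ((‖∑ k, R r k • x k‖ ^ 2 : ℝ) : ℂ) = ⟪∑ j, R r j • x j, ∑ k, R r k • x k⟫_ℂ := by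
      rw [inner_self_eq_norm_sq_to_K (𝕜 := ℂ)]; push_cast; rfl
    rw [this, sum_inner]
    refine Finset.sum_congr rfl fun j _ => ?_
    rw [inner_sum]
    refine Finset.sum_congr rfl fun k _ => ?_
    rw [inner_smul_left, inner_smul_right]; ring
  rw [Complex.ofReal_sum, Finset.sum_congr rfl fun r _ => h r, Finset.sum_comm]
  refine Finset.sum_congr rfl fun j _ => ?_
  rw [Finset.sum_comm]
  refine Finset.sum_congr rfl fun k _ => ?_
  rw [Matrix.mul_apply, Finset.sum_mul]
  rfl

theorem nq_gram [DecidableEq ι] {M : Matrix ι ι ℂ} (hM : M.PosSemidef) (x : ι → H) :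
    0 ≤ (∑ j, ∑ k, M j k * ⟪x j, x k⟫_ℂ).re := by
  open scoped MatrixOrder in
  obtain ⟨R, hR⟩ := CStarAlgebra.nonneg_iff_eq_star_mul_self.1 (Matrix.nonneg_iff_posSemidef.2 hM)
  have := nq_gram_eq R x
  rw [← Matrix.star_eq_conjTranspose, ← hR] at this
  rw [← this, Complex.ofReal_re]
  positivity

theorem nqCPC.schwarzH [DecidableEq ι] (h : nqCPC β) (b : A) (x : ι → H) :
    ∑ j, ‖∑ k, β b j k • x k‖ ^ 2 ≤ (∑ j, ∑ k, β (star b * b) j k * ⟪x j, x k⟫_ℂ).re := by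
  have hP : (β (star b * b) - (β b)ᴴ * β b).PosSemidef := by
    refine Matrix.PosSemidef.of_dotProduct_mulVec_nonneg ?_ fun y => ?_
    · refine Matrix.IsHermitian.sub ?_ (Matrix.isHermitian_conjTranspose_mul_self _)
      ext j k
      rw [Matrix.conjTranspose_apply, h.herm_entry (star b * b) j k]; simp
    · rw [Matrix.sub_mulVec, dotProduct_sub, ← Matrix.mulVec_mulVec, Matrix.dotProduct_mulVec (star y) (β b)ᴴ,
        ← Matrix.star_mulVec]
      have h1 := h.schwarz b y
      have h2 := h.pos1 b y
      rw [Complex.nonneg_iff] at *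
      have h3 : star (β b *ᵥ y) ⬝ᵥ (β b *ᵥ y) = ((∑ j, ‖(β b *ᵥ y) j‖ ^ 2 : ℝ) : ℂ) := by
        simp only [dotProduct, Pi.star_apply]
        push_cast
        exact Finset.sum_congr rfl fun j _ => Complex.conj_mul' _
      rw [h3, Complex.sub_re, Complex.sub_im, Complex.ofReal_re, Complex.ofReal_im]
      exact ⟨by linarith, by linarith [h2.2]⟩
  have := nq_gram hP x
  have e : ((∑ j, ‖∑ k, β b j k • x k‖ ^ 2 : ℝ) : ℂ) = ∑ j, ∑ k, ((β b)ᴴ * β b) j k * ⟪x j, x k⟫_ℂ := nq_gram_eq _ x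
  simp only [Matrix.sub_apply, sub_mul, Finset.sum_sub_distrib, Complex.sub_re] at this
  rw [← e, Complex.ofReal_re] at this
  linarith

end CPC


section NucForward
open scoped InnerProductSpace ComplexOrder
open ComplexConjugate ContinuousLinearMap

noncomputable def nqTheta {A A' : Type*} [NonUnitalCStarAlgebra A] [NonUnitalCStarAlgebra A'] {ι : Type} [Fintype ι]
    (a : ι → A) (f : A' →ₗ[ℂ] Matrix ι ι ℂ) (x : A') : A := ∑ j, ∑ k, f x j k • (star (a j) * a k)

def nqK (A : Type*) [NonUnitalCStarAlgebra A] : Prop :=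
  ∀ (F : Finset A) (ε : ℝ), 0 < ε → ∃ (ι : Type) (_ : Fintype ι) (a : ι → A) (β : A →ₗ[ℂ] Matrix ι ι ℂ),
    nqCPC β ∧ ‖∑ j, star (a j) * a j‖ ≤ 1 ∧ ∀ b ∈ F, ‖nqTheta a β b - b‖ ≤ ε

/-- block diagonal sum of maps -/
noncomputable def nqSig {A : Type*} [NonUnitalCStarAlgebra A] {κ : Type} [DecidableEq κ] {ι : κ → Type}
    (f : ∀ t, A →ₗ[ℂ] Matrix (ι t) (ι t) ℂ) : A →ₗ[ℂ] Matrix (Σ t, ι t) (Σ t, ι t) ℂ where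
  toFun x := Matrix.blockDiagonal' fun t => f t x
  map_add' x y := by simp only [map_add]; exact Matrix.blockDiagonal'_add (fun t => f t x) (fun t => f t y)
  map_smul' c x := by simp only [map_smul]; exact Matrix.blockDiagonal'_smul c (fun t => f t x)

variable {A : Type*} [NonUnitalCStarAlgebra A]

theorem nq_inner_nonneg {H : Type*} [NormedAddCommGroup H] [InnerProductSpace ℂ H] (x : H) : 0 ≤ ⟪x, x⟫_ℂ := by
  rw [inner_self_eq_norm_sq_to_K (𝕜 := ℂ)]
  refine le_of_le_of_eq (Complex.zero_le_real.2 (sq_nonneg ‖x‖)) ?_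
  push_cast; rfl

theorem nqSig_quad {κ : Type} [Fintype κ] [DecidableEq κ] {ι : κ → Type} [∀ t, Fintype (ι t)]
    (M : ∀ t, Matrix (ι t) (ι t) ℂ) (x y : (Σ t, ι t) → ℂ) :
    star x ⬝ᵥ (Matrix.blockDiagonal' M *ᵥ y) = ∑ t, star (fun j => x ⟨t, j⟩) ⬝ᵥ (M t *ᵥ fun j => y ⟨t, j⟩) := by
  simp only [dotProduct, Fintype.sum_sigma, mulVec]
  refine Finset.sum_congr rfl fun t _ => Finset.sum_congr rfl fun j _ => ?_
  congr 1
  rw [Finset.sum_eq_single t]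
  · simp
  · intro t' _ h
    refine Finset.sum_eq_zero fun k _ => ?_
    rw [Matrix.blockDiagonal'_apply_ne _ _ _ h.symm, zero_mul]
  · simp

theorem nqCPC.sig {κ : Type} [Fintype κ] [DecidableEq κ] {ι : κ → Type} [∀ t, Fintype (ι t)]
    {f : ∀ t, A →ₗ[ℂ] Matrix (ι t) (ι t) ℂ} (hf : ∀ t, nqCPC (f t)) : nqCPC (nqSig f) where
  pos k b η := by
    have : ∑ p, ∑ q, star (η p) ⬝ᵥ (nqSig f (star (b p) * b q) *ᵥ η q) =
        ∑ t, ∑ p, ∑ q, star (fun j => η p ⟨t, j⟩) ⬝ᵥ (f t (star (b p) * b q) *ᵥ fun j => η q ⟨t, j⟩) := by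
      conv_rhs => rw [Finset.sum_comm]
      refine Finset.sum_congr rfl fun p _ => ?_
      conv_rhs => rw [Finset.sum_comm]
      exact Finset.sum_congr rfl fun q _ => nqSig_quad _ _ _
    rw [this]
    exact Finset.sum_nonneg fun t _ => (hf t).pos k b fun p j => η p ⟨t, j⟩
  contr b η := by
    have : star η ⬝ᵥ (nqSig f (star b * b) *ᵥ η) = _ := nqSig_quad _ _ _
    rw [this, Complex.re_sum, Fintype.sum_sigma, Finset.mul_sum]
    exact Finset.sum_le_sum fun t _ => (hf t).contr b _
  bdd := by
    choose K hK using fun t => (hf t).bdd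
    refine ⟨∑ t, |K t|, ?_⟩
    rintro b ⟨t, j⟩ ⟨t', k⟩
    have h0 : 0 ≤ ∑ t, |K t| := Finset.sum_nonneg fun t _ => abs_nonneg _
    by_cases h : t = t'
    · subst h
      have : nqSig f b ⟨t, j⟩ ⟨t, k⟩ = f t b j k := Matrix.blockDiagonal'_apply_eq (fun t => f t b) _ _ _
      rw [this]
      refine (hK t b j k).trans (mul_le_mul_of_nonneg_right ?_ (norm_nonneg _))
      exact (le_abs_self _).trans (Finset.single_le_sum (f := fun t => |K t|) (fun t _ => abs_nonneg _) (Finset.mem_univ t))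
    · have : nqSig f b ⟨t, j⟩ ⟨t', k⟩ = 0 := Matrix.blockDiagonal'_apply_ne (fun t => f t b) _ _ h
      rw [this, norm_zero]; positivity

theorem nqSig_theta {A' : Type*} [NonUnitalCStarAlgebra A'] {κ : Type} [Fintype κ] [DecidableEq κ] {ι : κ → Type} [∀ t, Fintype (ι t)]
    (f : ∀ t, A' →ₗ[ℂ] Matrix (ι t) (ι t) ℂ) (a : (Σ t, ι t) → A) (x : A') :
    nqTheta a (nqSig f) x = ∑ t, nqTheta (fun j => a ⟨t, j⟩) (f t) x := by
  simp only [nqTheta, Fintype.sum_sigma]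
  refine Finset.sum_congr rfl fun t _ => Finset.sum_congr rfl fun j _ => ?_
  rw [Finset.sum_eq_single t]
  · refine Finset.sum_congr rfl fun k _ => ?_
    have : nqSig f x ⟨t, j⟩ ⟨t, k⟩ = f t x j k := Matrix.blockDiagonal'_apply_eq (fun t => f t x) _ _ _
    rw [this]
  · intro t' _ h
    refine Finset.sum_eq_zero fun k _ => ?_
    have : nqSig f x ⟨t, j⟩ ⟨t', k⟩ = 0 := Matrix.blockDiagonal'_apply_ne (fun t => f t x) _ _ h.symm
    rw [this, zero_smul]
  · simp

/-- the star-isomorphism of matrices with operators -/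
noncomputable abbrev nqT (n : ℕ) : Matrix (Fin n) (Fin n) ℂ ≃⋆ₐ[ℂ] MatrixAlg n := Matrix.toEuclideanCLM (n := Fin n) (𝕜 := ℂ)

noncomputable def nqMat {n : ℕ} (φ : A →ₗ[ℂ] MatrixAlg n) : A →ₗ[ℂ] Matrix (Fin n) (Fin n) ℂ where
  toFun b := (nqT n).symm (φ b)
  map_add' x y := by rw [map_add, map_add]
  map_smul' c x := by rw [map_smul, map_smul]; rfl

theorem nqT_surj {n : ℕ} (m : MatrixAlg n) : ∃ M, nqT n M = m := ⟨(nqT n).symm m, StarAlgEquiv.apply_symm_apply _ _⟩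

theorem nq_cp_row {E F : Type*} [NonUnitalNormedRing E] [StarRing E] [NormedSpace ℂ E]
    [NonUnitalNormedRing F] [StarRing F] [NormedSpace ℂ F] {φ : E →ₗ[ℂ] F} (h : IsCompletelyPositive φ) {k : ℕ} (b : Fin k → E) :
    ∃ M : Fin k → Fin k → F, ∀ p q, φ (star (b p) * b q) = ∑ r, star (M r p) * M r q := by
  obtain ⟨M, hM⟩ := h k (Matrix.of fun r p => if r.val = 0 then b p else 0)
  refine ⟨M, fun p q => ?_⟩
  have := congrFun (congrFun hM p) q
  rw [Matrix.map_apply, Matrix.mul_apply, Matrix.mul_apply] at this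
  simp only [Matrix.conjTranspose_apply, Matrix.of_apply] at this
  rw [← this, Finset.sum_eq_single (⟨0, p.pos⟩ : Fin k)]
  · simp
  · intro r _ hr
    have : r.val ≠ 0 := fun h => hr (Fin.ext h)
    simp [this]
  · simp

theorem nqMat_quad {n : ℕ} (m : MatrixAlg n) (x y : Fin n → ℂ) :
    star x ⬝ᵥ ((nqT n).symm m *ᵥ y) = ⟪WithLp.toLp 2 x, m (WithLp.toLp 2 y)⟫_ℂ := by
  obtain ⟨M, rfl⟩ := nqT_surj m
  rw [StarAlgEquiv.symm_apply_apply, Matrix.toEuclideanCLM_toLp, EuclideanSpace.inner_toLp_toLp, dotProduct_comm]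

theorem nqMat_cpc {n : ℕ} (φ : A →ₗ[ℂ] MatrixAlg n) (hφ : IsCompletelyPositive φ) (hn : ∀ b, ‖φ b‖ ≤ ‖b‖) :
    nqCPC (nqMat φ) where
  pos k b η := by
    obtain ⟨M, key⟩ := nq_cp_row hφ b
    have : ∑ p, ∑ q, star (η p) ⬝ᵥ (nqMat φ (star (b p) * b q) *ᵥ η q) =
      ∑ r, ⟪∑ p, M r p (WithLp.toLp 2 (η p)), ∑ q, M r q (WithLp.toLp 2 (η q))⟫_ℂ := by
      simp only [sum_inner, inner_sum]
      conv_rhs => rw [Finset.sum_comm]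
      refine Finset.sum_comm.trans <| Finset.sum_congr rfl fun q _ => ?_
      conv_rhs => rw [Finset.sum_comm]
      refine Finset.sum_congr rfl fun p _ => ?_
      refine (nqMat_quad _ _ _).trans ?_
      rw [key, ContinuousLinearMap.sum_apply, inner_sum]
      refine Finset.sum_congr rfl fun r _ => ?_
      rw [mul_apply_eq_comp, ContinuousLinearMap.star_eq_adjoint, ContinuousLinearMap.adjoint_inner_right]
    rw [this]
    refine Finset.sum_nonneg fun r _ => ?_
    exact nq_inner_nonneg _
  contr b η := by
    have : star η ⬝ᵥ (nqMat φ (star b * b) *ᵥ η) = _ := nqMat_quad _ _ _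
    rw [this]
    have h1 := norm_inner_le_norm (𝕜 := ℂ) (WithLp.toLp 2 η) (φ (star b * b) (WithLp.toLp 2 η))
    have h2 := (φ (star b * b)).le_opNorm (WithLp.toLp 2 η)
    have h3 := hn (star b * b)
    rw [CStarRing.norm_star_mul_self] at h3
    have h4 := EuclideanSpace.norm_sq_eq (WithLp.toLp 2 η : EuclideanSpace ℂ (Fin n))
    simp only at h4
    rw [← h4]
    refine (Complex.re_le_norm _).trans (h1.trans ?_)
    set N := ‖(WithLp.toLp 2 η : EuclideanSpace ℂ (Fin n))‖
    have hN : 0 ≤ N := norm_nonneg _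
    calc _ ≤ N * ((‖b‖ * ‖b‖) * N) := by gcongr; exact h2.trans (by gcongr)
      _ = _ := by ring
  bdd := by
    refine ⟨1, fun b j k => ?_⟩
    have h0 : nqMat φ b j k = ⟪WithLp.toLp 2 (Pi.single j 1), φ b (WithLp.toLp 2 (Pi.single k 1))⟫_ℂ := by
      rw [← nqMat_quad]
      simp [← Pi.single_star, Matrix.mulVec_single_one, Matrix.col_apply, nqMat]
    have h1 := norm_inner_le_norm (𝕜 := ℂ) (WithLp.toLp 2 (Pi.single j (1:ℂ)) : EuclideanSpace ℂ (Fin n)) (φ b (WithLp.toLp 2 (Pi.single k 1)))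
    have h2 := (φ b).le_opNorm (WithLp.toLp 2 (Pi.single k 1))
    have h3 := hn b
    have hs : ∀ k : Fin n, ‖(WithLp.toLp 2 (Pi.single k (1:ℂ)) : EuclideanSpace ℂ (Fin n))‖ = 1 := by
      intro k
      have := EuclideanSpace.norm_single (𝕜 := ℂ) k (1:ℂ)
      rw [norm_one] at this; exact this
    rw [hs] at h1 h2
    rw [h0]; linarith

theorem nqK_of_nuclear (h : IsNuclear A) : nqK A := by
  intro F ε hε
  obtain ⟨n, φ, ρ, h1, h2, h3, h4, h5⟩ := h F ε hε
  obtain ⟨w, hw⟩ := nq_cp_row h2 (fun p => nqT n (Matrix.single ⟨0, p.pos⟩ p 1))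
  have key : ∀ p q, ρ (nqT n (Matrix.single p q 1)) = ∑ r, star (w r p) * w r q := by
    intro p q
    rw [← hw, ← map_star, ← map_mul, Matrix.star_eq_conjTranspose, Matrix.conjTranspose_single]
    simp
  have hρ : ∀ M : Matrix (Fin n) (Fin n) ℂ, ρ (nqT n M) = ∑ r, ∑ p, ∑ q, M p q • (star (w r p) * w r q) := by
    intro M
    conv_lhs => rw [Matrix.matrix_eq_sum_single M]
    simp only [map_sum]
    conv_rhs => rw [Finset.sum_comm]
    refine Finset.sum_congr rfl fun p _ => ?_
    conv_rhs => rw [Finset.sum_comm]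
    refine Finset.sum_congr rfl fun q _ => ?_
    rw [← Finset.smul_sum, ← key, ← map_smul, ← map_smul, Matrix.smul_single, smul_eq_mul, mul_one]
  refine ⟨Σ _ : Fin n, Fin n, inferInstance, fun x => w x.1 x.2, nqSig fun _ => nqMat φ,
    nqCPC.sig fun _ => nqMat_cpc φ h1 h3, ?_, fun b hb => ?_⟩
  · have : ∑ x : (Σ _ : Fin n, Fin n), star (w x.1 x.2) * w x.1 x.2 = ρ (nqT n 1) := by
      rw [hρ, Fintype.sum_sigma]
      refine Finset.sum_congr rfl fun r _ => Finset.sum_congr rfl fun p _ => ?_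
      simp [Matrix.one_apply]
    rw [this]
    refine (h4 _).trans ?_
    rw [map_one]
    exact ContinuousLinearMap.norm_id_le
  · rw [nqSig_theta]
    have : ρ (φ b) = ∑ t : Fin n, nqTheta (fun j => w t j) (nqMat φ) b := by
      obtain ⟨M, hM⟩ := nqT_surj (φ b)
      have h6 : nqMat φ b = M := by
        change (nqT n).symm (φ b) = M
        rw [← hM, StarAlgEquiv.symm_apply_apply]
      rw [← hM, hρ]
      simp only [nqTheta, h6]
    rw [← this]; exact h5 b hb

end NucForward


section NucBackward
open scoped InnerProductSpace ComplexOrder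
open ComplexConjugate ContinuousLinearMap

variable {A : Type*} [NonUnitalCStarAlgebra A]

theorem nq_gramA2 {n k : Type} [Fintype n] [Fintype k] (R Q : Matrix k n ℂ) (a : n → A) :
    ∑ r, star (∑ j, R r j • a j) * (∑ l, Q r l • a l) = ∑ j, ∑ l, (Rᴴ * Q) j l • (star (a j) * a l) := by
  have h : ∀ r, star (∑ j, R r j • a j) * (∑ l, Q r l • a l) = ∑ j, ∑ l, (conj (R r j) * Q r l) • (star (a j) * a l) := by
    intro r
    rw [star_sum, Finset.sum_mul_sum]
    refine Finset.sum_congr rfl fun j _ => Finset.sum_congr rfl fun l _ => ?_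
    rw [star_smul, smul_mul_smul_comm]; rfl
  rw [Finset.sum_congr rfl fun r _ => h r, Finset.sum_comm]
  refine Finset.sum_congr rfl fun j _ => ?_
  rw [Finset.sum_comm]
  refine Finset.sum_congr rfl fun l _ => ?_
  rw [← Finset.sum_smul, Matrix.mul_apply]; rfl

theorem nq_gramA {n k : Type} [Fintype n] [Fintype k] (R : Matrix k n ℂ) (a : n → A) :
    ∑ r, star (∑ j, R r j • a j) * (∑ l, R r l • a l) = ∑ j, ∑ l, (Rᴴ * R) j l • (star (a j) * a l) :=
  nq_gramA2 R R a

theorem nq_sum_star {κ : Type} [Fintype κ] (Y : κ → A) : ∃ M : A, ∑ t, star (Y t) * Y t = star M * M := by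
  letI := CStarAlgebra.spectralOrder A
  haveI := CStarAlgebra.spectralOrderedRing A
  exact CStarAlgebra.nonneg_iff_eq_star_mul_self.1 (Finset.sum_nonneg fun t _ => star_mul_self_nonneg _)

theorem nq_csA {n : Type} [Fintype n] (a z : n → A) :
    ‖∑ j, star (a j) * z j‖ ^ 2 ≤ ‖∑ j, star (a j) * a j‖ * ‖∑ j, star (z j) * z j‖ := by
  letI := CStarAlgebra.spectralOrder A
  haveI := CStarAlgebra.spectralOrderedRing A
  let x : WithCStarModule A (n → A) := (WithCStarModule.equiv A _).symm fun j => star (z j)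
  let y : WithCStarModule A (n → A) := (WithCStarModule.equiv A _).symm fun j => star (a j)
  have h := CStarModule.norm_inner_le (A := A) (WithCStarModule A (n → A)) (x := x) (y := y)
  have h1 : inner A x y = ∑ j, star (a j) * z j := by
    rw [WithCStarModule.pi_inner]
    refine Finset.sum_congr rfl fun j _ => ?_
    simp [x, y, WithCStarModule.inner_def]
  have hx : ‖x‖ ^ 2 = ‖∑ j, star (z j) * z j‖ := by
    rw [WithCStarModule.pi_norm_sq]
    congr 1
    refine Finset.sum_congr rfl fun j _ => ?_
    simp [x, WithCStarModule.inner_def]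
  have hy : ‖y‖ ^ 2 = ‖∑ j, star (a j) * a j‖ := by
    rw [WithCStarModule.pi_norm_sq]
    congr 1
    refine Finset.sum_congr rfl fun j _ => ?_
    simp [y, WithCStarModule.inner_def]
  rw [← hx, ← hy, ← h1, ← mul_pow, mul_comm]
  exact pow_le_pow_left₀ (norm_nonneg _) h 2

theorem nq_sum_factor {k : ℕ} {κ : Type} [Fintype κ] (y : κ → Fin k → A) :
    ∃ M : Matrix (Fin k) (Fin k) A, ∀ p q, ∑ t, star (y t p) * y t q = (Mᴴ * M) p q := by
  letI := CStarAlgebra.spectralOrder A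
  haveI := CStarAlgebra.spectralOrderedRing A
  let Y : κ → CStarMatrix (Fin k) (Fin k) A := fun t => CStarMatrix.ofMatrix (Matrix.of fun r p => if r.val = 0 then y t p else 0)
  obtain ⟨M, hM⟩ := nq_sum_star Y
  refine ⟨CStarMatrix.ofMatrix.symm M, fun p q => ?_⟩
  have h1 : (star M * M) p q = ((CStarMatrix.ofMatrix.symm M)ᴴ * (CStarMatrix.ofMatrix.symm M)) p q := by
    rw [CStarMatrix.mul_apply, Matrix.mul_apply]; rfl
  rw [← h1, ← hM]
  have h2 : ∀ s : Finset κ, (∑ t ∈ s, star (Y t) * Y t) p q = ∑ t ∈ s, (star (Y t) * Y t) p q := by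
    classical
    intro s
    induction s using Finset.induction_on with
    | empty => simp
    | insert a s ha ih => rw [Finset.sum_insert ha, Finset.sum_insert ha, CStarMatrix.add_apply, ih]
  rw [h2]
  refine Finset.sum_congr rfl fun t _ => ?_
  rw [CStarMatrix.mul_apply, Finset.sum_eq_single (⟨0, p.pos⟩ : Fin k)]
  · simp [Y, CStarMatrix.star_apply]
  · intro r _ hr
    have : r.val ≠ 0 := fun h => hr (Fin.ext h)
    simp [this, Y]
  · simp

noncomputable def nqRho {n : ℕ} (a : Fin n → A) : MatrixAlg n →ₗ[ℂ] A where
  toFun m := ∑ j, ∑ l, (nqT n).symm m j l • (star (a j) * a l)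
  map_add' x y := by simp [add_smul, Finset.sum_add_distrib]
  map_smul' c x := by simp [mul_smul, Finset.smul_sum]

theorem nqRho_T {n : ℕ} (a : Fin n → A) (M : Matrix (Fin n) (Fin n) ℂ) :
    nqRho a (nqT n M) = ∑ j, ∑ l, M j l • (star (a j) * a l) := by
  change ∑ j, ∑ l, (nqT n).symm (nqT n M) j l • (star (a j) * a l) = _
  rw [StarAlgEquiv.symm_apply_apply]

theorem nqRho_cp {n : ℕ} (a : Fin n → A) : IsCompletelyPositive (nqRho a) := by
  intro k N
  choose X hX using fun r p => nqT_surj (N r p)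
  obtain ⟨M, hM⟩ := nq_sum_factor (κ := Fin k × Fin n) (fun t p => ∑ j, X t.1 p t.2 j • a j)
  refine ⟨M, ?_⟩
  ext p q
  rw [← hM, Matrix.map_apply, Matrix.mul_apply, map_sum, Fintype.sum_prod_type]
  refine Finset.sum_congr rfl fun r _ => ?_
  rw [Matrix.conjTranspose_apply, ← hX, ← hX, ← map_star, ← map_mul, nqRho_T]
  exact (nq_gramA2 (X r p) (X r q) a).symm

theorem nqRho_norm {n : ℕ} (a : Fin n → A) (ha : ‖∑ j, star (a j) * a j‖ ≤ 1) (m : MatrixAlg n) :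
    ‖nqRho a m‖ ≤ ‖m‖ := by
  obtain ⟨M, rfl⟩ := nqT_surj m
  set m := nqT n M with hm
  have h1 : nqRho a m = ∑ j, star (a j) * ∑ l, M j l • a l := by
    rw [hm, nqRho_T]
    refine Finset.sum_congr rfl fun j _ => ?_
    rw [Finset.mul_sum]
    exact Finset.sum_congr rfl fun l _ => (mul_smul_comm _ _ _).symm
  have h2 := nq_csA a fun j => ∑ l, M j l • a l
  rw [← h1, nq_gramA] at h2
  have h3 : star m * m ≤ algebraMap ℝ _ (‖m‖ ^ 2) := by
    have := CStarAlgebra.star_mul_le_algebraMap_norm_sq (a := m)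
    simpa using this
  obtain ⟨c, hc⟩ := CStarAlgebra.nonneg_iff_eq_star_mul_self.1 (sub_nonneg.2 h3)
  obtain ⟨R, rfl⟩ := nqT_surj c
  rw [hm, ← map_star, ← map_star, ← map_mul, ← map_mul, Matrix.star_eq_conjTranspose, Matrix.star_eq_conjTranspose] at hc
  have h4 : nqRho a (algebraMap ℝ _ (‖m‖ ^ 2)) = (‖m‖ ^ 2) • ∑ j, star (a j) * a j := by
    have : algebraMap ℝ (MatrixAlg n) (‖m‖ ^ 2) = ((‖m‖ ^ 2 : ℝ) : ℂ) • nqT n 1 := by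
      rw [map_one, Algebra.algebraMap_eq_smul_one]; rfl
    rw [this, map_smul, nqRho_T]
    simp [Matrix.one_apply]
    norm_cast
  have h5 := congrArg (nqRho a) hc
  rw [map_sub, ← hm, h4, nqRho_T, nqRho_T, ← nq_gramA, ← nq_gramA] at h5
  rw [← nq_gramA] at h2
  set S := ∑ r, star (∑ j, M r j • a j) * ∑ l, M r l • a l with hS
  letI := CStarAlgebra.spectralOrder A
  haveI := CStarAlgebra.spectralOrderedRing A
  have hS0 : 0 ≤ S := Finset.sum_nonneg fun r _ => star_mul_self_nonneg _
  have hle : S ≤ (‖m‖ ^ 2) • ∑ j, star (a j) * a j := by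
    rw [← sub_nonneg, h5]
    exact Finset.sum_nonneg fun r _ => star_mul_self_nonneg _
  have h6 : ‖S‖ ≤ ‖m‖ ^ 2 := by
    refine (CStarAlgebra.norm_le_norm_of_nonneg_of_le hS0 hle).trans ?_
    rw [norm_smul, Real.norm_of_nonneg (by positivity)]
    nlinarith [sq_nonneg ‖m‖]
  refine le_of_sq_le_sq (h2.trans ?_) (norm_nonneg _)
  nlinarith [norm_nonneg S, norm_nonneg (∑ j, star (a j) * a j)]

noncomputable def nqPhi {ι : Type} [Fintype ι] {n : ℕ} (e : ι ≃ Fin n) (β : A →ₗ[ℂ] Matrix ι ι ℂ) : A →ₗ[ℂ] MatrixAlg n where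
  toFun b := nqT n ((β b).submatrix e.symm e.symm)
  map_add' x y := by rw [map_add β, ← map_add (nqT n)]; rfl
  map_smul' c x := by rw [map_smul β, RingHom.id_apply, ← map_smul (nqT n)]; rfl

theorem nqPhi_cp {ι : Type} [Fintype ι] {n : ℕ} (e : ι ≃ Fin n) (β : A →ₗ[ℂ] Matrix ι ι ℂ) (h : nqCPC β) :
    IsCompletelyPositive (nqPhi e β) := by
  classical
  intro k N
  let G : Matrix (Fin k × ι) (Fin k × ι) ℂ := Matrix.of fun x y => β ((Nᴴ * N) x.1 y.1) x.2 y.2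
  have hG : G.PosSemidef := by
    have hq : ∀ η : Fin k × ι → ℂ, star η ⬝ᵥ (G *ᵥ η) = ∑ r, ∑ p, ∑ q,
        star (fun j => η (p, j)) ⬝ᵥ (β (star (N r p) * N r q) *ᵥ fun j => η (q, j)) := by
      intro η
      have h1 : star η ⬝ᵥ (G *ᵥ η) = ∑ p, ∑ q, star (fun j => η (p, j)) ⬝ᵥ (β ((Nᴴ * N) p q) *ᵥ fun j => η (q, j)) := by
        simp only [dotProduct, mulVec, Fintype.sum_prod_type, Finset.mul_sum, G, Matrix.of_apply, Pi.star_apply]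
        refine Finset.sum_congr rfl fun p _ => ?_
        rw [Finset.sum_comm]
      rw [h1]
      conv_rhs => rw [Finset.sum_comm]
      refine Finset.sum_congr rfl fun p _ => ?_
      conv_rhs => rw [Finset.sum_comm]
      refine Finset.sum_congr rfl fun q _ => ?_
      rw [Matrix.mul_apply, map_sum, Matrix.sum_mulVec, dotProduct_sum]
      rfl
    refine Matrix.PosSemidef.of_dotProduct_mulVec_nonneg ?_ fun η => ?_
    · ext x y
      simp only [Matrix.conjTranspose_apply, G, Matrix.of_apply]
      rw [h.herm_entry _ x.2 y.2]
      have : star ((Nᴴ * N) x.1 y.1) = (Nᴴ * N) y.1 x.1 := by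
        rw [← Matrix.conjTranspose_apply, Matrix.conjTranspose_mul, Matrix.conjTranspose_conjTranspose]
      rw [this]; rfl
    · rw [hq]
      exact Finset.sum_nonneg fun r _ => h.pos k (fun p => N r p) fun p j => η (p, j)
  open scoped MatrixOrder in
  obtain ⟨R, hR⟩ := CStarAlgebra.nonneg_iff_eq_star_mul_self.1 (Matrix.nonneg_iff_posSemidef.2 hG)
  refine ⟨Matrix.of fun r p => nqT n (Matrix.of fun i j => R (r, e.symm i) (p, e.symm j)), ?_⟩
  ext1 p q
  rw [Matrix.mul_apply, Matrix.map_apply]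
  simp only [Matrix.conjTranspose_apply, Matrix.of_apply]
  simp only [← map_star, ← map_mul, ← map_sum]
  change nqT n _ = nqT n _
  congr 1
  ext i j
  have := congrFun (congrFun hR (p, e.symm i)) (q, e.symm j)
  simp only [G, Matrix.of_apply] at this
  rw [Matrix.submatrix_apply, this, Matrix.mul_apply, Fintype.sum_prod_type, Matrix.sum_apply]
  refine Finset.sum_congr rfl fun r _ => ?_
  rw [Matrix.mul_apply, ← e.symm.sum_comp]
  rfl

theorem nuclear_of_nqK (h : nqK A) : IsNuclear A := by
  intro F ε hε
  obtain ⟨ι, _, a, β, h1, h2, h3⟩ := h F ε hε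
  let e := Fintype.equivFin ι
  refine ⟨Fintype.card ι, nqPhi e β, nqRho fun i => a (e.symm i), nqPhi_cp e β h1, nqRho_cp _, fun b => ?_, ?_, fun b hb => ?_⟩
  · refine ContinuousLinearMap.opNorm_le_bound _ (norm_nonneg _) fun x => ?_
    refine le_of_sq_le_sq ?_ (by positivity)
    rw [mul_pow, EuclideanSpace.norm_sq_eq, EuclideanSpace.norm_sq_eq]
    have := h1.contr' b fun j => x (e j)
    rw [← e.symm.sum_comp, ← e.symm.sum_comp] at this
    simp only [Equiv.apply_symm_apply] at this
    refine le_of_eq_of_le ?_ this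
    refine Finset.sum_congr rfl fun i _ => ?_
    congr 2
    change ((β b).submatrix e.symm e.symm *ᵥ x.ofLp) i = _
    simp only [mulVec, dotProduct]
    rw [← e.sum_comp]
    simp
  · refine nqRho_norm _ ?_
    rwa [e.symm.sum_comp (fun j => star (a j) * a j)]
  · have : nqRho (fun i => a (e.symm i)) (nqPhi e β b) = nqTheta a β b := by
      refine (nqRho_T _ _).trans ?_
      rw [nqTheta, ← e.symm.sum_comp]
      refine Finset.sum_congr rfl fun i _ => ?_
      rw [← e.symm.sum_comp]; rfl
    rw [this]; exact h3 b hb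

end NucBackward


section Levels
open scoped InnerProductSpace ComplexOrder
open ComplexConjugate ContinuousLinearMap

variable {A : Type*} [NonUnitalCStarAlgebra A] {ι : Type} [Fintype ι]

noncomputable def nqConj (C : Matrix ι ι ℂ) (β : A →ₗ[ℂ] Matrix ι ι ℂ) : A →ₗ[ℂ] Matrix ι ι ℂ where
  toFun b := C * β b * Cᴴ
  map_add' x y := by rw [map_add, Matrix.mul_add, Matrix.add_mul]
  map_smul' c x := by simp

theorem nqConj_quad (C M : Matrix ι ι ℂ) (x y : ι → ℂ) :
    star x ⬝ᵥ ((C * M * Cᴴ) *ᵥ y) = star (Cᴴ *ᵥ x) ⬝ᵥ (M *ᵥ (Cᴴ *ᵥ y)) := by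
  rw [Matrix.star_mulVec, Matrix.conjTranspose_conjTranspose, ← Matrix.dotProduct_mulVec, Matrix.mulVec_mulVec,
    Matrix.mulVec_mulVec, Matrix.mul_assoc]

theorem nq_normsq (x : ι → ℂ) : star x ⬝ᵥ x = ((∑ j, ‖x j‖ ^ 2 : ℝ) : ℂ) := by
  simp only [dotProduct, Pi.star_apply]
  push_cast
  exact Finset.sum_congr rfl fun j _ => Complex.conj_mul' _

theorem nqCPC.conj [DecidableEq ι] {β : A →ₗ[ℂ] Matrix ι ι ℂ} (h : nqCPC β) (C : Matrix ι ι ℂ) (hC : C * Cᴴ = 1) :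
    nqCPC (nqConj C β) where
  pos k b η := by
    have := h.pos k b fun p => Cᴴ *ᵥ η p
    simp only [← nqConj_quad] at this
    exact this
  contr b η := by
    have := h.contr b (Cᴴ *ᵥ η)
    rw [← nqConj_quad] at this
    have e : ∑ j, ‖(Cᴴ *ᵥ η) j‖ ^ 2 = ∑ j, ‖η j‖ ^ 2 := by
      have h1 := nq_normsq (Cᴴ *ᵥ η)
      have h2 := nqConj_quad C 1 η η
      rw [Matrix.mul_one, hC, Matrix.one_mulVec, Matrix.one_mulVec, h1, nq_normsq] at h2
      exact_mod_cast h2.symm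
    rw [e] at this
    exact this
  bdd := by
    obtain ⟨K, hK⟩ := h.bdd
    refine ⟨∑ j, ∑ k, ∑ l, ∑ m, ‖C j l‖ * |K| * ‖C k m‖, fun b j k => ?_⟩
    have h0 : nqConj C β b j k = ∑ m, ∑ l, C j l * β b l m * Cᴴ m k := by
      change (C * β b * Cᴴ) j k = _
      simp only [Matrix.mul_apply, Finset.sum_mul]
    rw [h0, Finset.sum_comm]
    have h1 : ‖∑ l, ∑ m, C j l * β b l m * Cᴴ m k‖ ≤ (∑ l, ∑ m, ‖C j l‖ * |K| * ‖C k m‖) * ‖b‖ := by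
      rw [Finset.sum_mul]
      refine norm_sum_le_of_le _ fun l _ => ?_
      rw [Finset.sum_mul]
      refine norm_sum_le_of_le _ fun m _ => ?_
      rw [norm_mul, norm_mul, Matrix.conjTranspose_apply, norm_star]
      have : ‖β b l m‖ ≤ |K| * ‖b‖ := (hK b l m).trans (by gcongr; exact le_abs_self _)
      calc _ ≤ ‖C j l‖ * (|K| * ‖b‖) * ‖C k m‖ := by gcongr
        _ = _ := by ring
    refine h1.trans (mul_le_mul_of_nonneg_right ?_ (norm_nonneg _))
    refine le_trans ?_ (Finset.single_le_sum (f := fun j => ∑ k, ∑ l, ∑ m, ‖C j l‖ * |K| * ‖C k m‖) (fun j _ => by positivity) (Finset.mem_univ j))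
    exact Finset.single_le_sum (f := fun k => ∑ l, ∑ m, ‖C j l‖ * |K| * ‖C k m‖) (fun j _ => by positivity) (Finset.mem_univ k)

theorem nqTheta_conj [DecidableEq ι] (β : A →ₗ[ℂ] Matrix ι ι ℂ) (C : Matrix ι ι ℂ) (hC : Cᴴ * C = 1) (a : ι → A) (b : A) :
    nqTheta (fun i => ∑ j, C i j • a j) (nqConj C β) b = nqTheta a β b := by
  have h1 : ∀ i, ∑ k, nqConj C β b i k • (star (∑ j, C i j • a j) * ∑ j, C k j • a j) =
      star (∑ j, C i j • a j) * ∑ j, (nqConj C β b * C) i j • a j := by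
    intro i
    simp only [← mul_smul_comm, ← Finset.mul_sum]
    congr 1
    simp only [Finset.smul_sum, Matrix.mul_apply, Finset.sum_smul, smul_smul]
    exact Finset.sum_comm
  unfold nqTheta
  rw [Finset.sum_congr rfl fun i _ => h1 i]
  have := nq_gramA2 C (nqConj C β b * C) a
  rw [this]
  have h2 : Cᴴ * (nqConj C β b * C) = β b := by
    change Cᴴ * (C * β b * Cᴴ * C) = β b
    rw [Matrix.mul_assoc, hC, Matrix.mul_one, ← Matrix.mul_assoc, hC, Matrix.one_mul]
  rw [h2]

variable {H : Type*} [NormedAddCommGroup H] [InnerProductSpace ℂ H]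

theorem nq_diag [DecidableEq ι] (x : ι → H) : ∃ C : Matrix ι ι ℂ, C * Cᴴ = 1 ∧ Cᴴ * C = 1 ∧
    ∀ i k, i ≠ k → ⟪∑ j, C i j • x j, ∑ l, C k l • x l⟫_ℂ = 0 := by
  let G : Matrix ι ι ℂ := Matrix.of fun j k => ⟪x j, x k⟫_ℂ
  have hG : G.IsHermitian := by
    ext j k
    simp [G, Matrix.conjTranspose_apply]
  set V : Matrix ι ι ℂ := (hG.eigenvectorUnitary : Matrix ι ι ℂ) with hV
  have hV1 : Vᴴ * V = 1 := (Matrix.mem_unitaryGroup_iff'.1 hG.eigenvectorUnitary.2)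
  have hV2 : V * Vᴴ = 1 := (Matrix.mem_unitaryGroup_iff.1 hG.eigenvectorUnitary.2)
  have hD : Vᴴ * G * V = Matrix.diagonal (RCLike.ofReal ∘ hG.eigenvalues) := by
    have := hG.spectral_theorem
    rw [Unitary.conjStarAlgAut_apply] at this
    have h3 : G = V * Matrix.diagonal (RCLike.ofReal ∘ hG.eigenvalues) * Vᴴ := this
    have h4 : Vᴴ * G * V = Vᴴ * (V * Matrix.diagonal (RCLike.ofReal ∘ hG.eigenvalues) * Vᴴ) * V := by rw [← h3]
    rw [h4]
    simp only [Matrix.mul_assoc]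
    rw [hV1, Matrix.mul_one, ← Matrix.mul_assoc, hV1, Matrix.one_mul]
  have e1 : (Vᵀ)ᴴ = (Vᴴ)ᵀ := rfl
  refine ⟨Vᵀ, ?_, ?_, fun i k hik => ?_⟩
  · rw [e1, ← Matrix.transpose_mul, hV1, Matrix.transpose_one]
  · rw [e1, ← Matrix.transpose_mul, hV2, Matrix.transpose_one]
  · have : ⟪∑ j, Vᵀ i j • x j, ∑ l, Vᵀ k l • x l⟫_ℂ = (Vᴴ * G * V) i k := by
      rw [inner_sum, Matrix.mul_apply]
      refine Finset.sum_congr rfl fun l _ => ?_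
      rw [sum_inner, Matrix.mul_apply, Finset.sum_mul]
      refine Finset.sum_congr rfl fun j _ => ?_
      rw [inner_smul_left, inner_smul_right]
      simp [G, Matrix.conjTranspose_apply]; ring
    rw [this, hD, Matrix.diagonal_apply_ne _ hik]

variable [CompleteSpace H]

structure nqLevel (π : A →⋆ₙₐ[ℂ] (H →L[ℂ] H)) (ξ : H) where
  ι : Type
  fin : Fintype ι
  dec : DecidableEq ι
  a : ι → A
  β : A →ₗ[ℂ] Matrix ι ι ℂ
  cpc : nqCPC β
  hn : ‖∑ j, star (a j) * a j‖ ≤ 1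
  orth : ∀ j k, j ≠ k → ⟪π (a j) ξ, π (a k) ξ⟫_ℂ = 0

attribute [instance] nqLevel.fin nqLevel.dec

variable {π : A →⋆ₙₐ[ℂ] (H →L[ℂ] H)} {ξ : H}

theorem nqLevel_exists (hK : nqK A) (π : A →⋆ₙₐ[ℂ] (H →L[ℂ] H)) (ξ : H) (F : Finset A) (ε : ℝ) (hε : 0 < ε) :
    ∃ L : nqLevel π ξ, ∀ b ∈ F, ‖nqTheta L.a L.β b - b‖ ≤ ε := by
  classical
  obtain ⟨ι, _, a, β, h1, h2, h3⟩ := hK F ε hε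
  obtain ⟨C, c1, c2, c3⟩ := nq_diag fun j => π (a j) ξ
  refine ⟨⟨ι, inferInstance, inferInstance, fun i => ∑ j, C i j • a j, nqConj C β, h1.conj C c1, ?_, ?_⟩, ?_⟩
  · rw [nq_gramA, c2]
    simpa [Matrix.one_apply] using h2
  · intro j k hjk
    have := c3 j k hjk
    simpa [ContinuousLinearMap.sum_apply] using this
  · intro b hb
    simp only
    rw [nqTheta_conj β C c2]; exact h3 b hb

theorem nq_pi_star (π : A →⋆ₙₐ[ℂ] (H →L[ℂ] H)) (b : A) (x y : H) : ⟪π b x, y⟫_ℂ = ⟪x, π (star b) y⟫_ℂ := by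
  rw [map_star, ContinuousLinearMap.star_eq_adjoint, ContinuousLinearMap.adjoint_inner_right]

theorem nq_pi_mul (π : A →⋆ₙₐ[ℂ] (H →L[ℂ] H)) (b c : A) (x : H) : π (b * c) x = π b (π c x) := by
  rw [map_mul, mul_apply_eq_comp]

theorem nq_pi_norm (π : A →⋆ₙₐ[ℂ] (H →L[ℂ] H)) (b : A) (x : H) : ‖π b x‖ ≤ ‖b‖ * ‖x‖ :=
  ((π b).le_opNorm x).trans (by gcongr; exact NonUnitalStarAlgHom.norm_apply_le π b)

namespace nqLevel
variable (L : nqLevel π ξ)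

theorem ha (η : H) : ∑ j, ‖π (L.a j) η‖ ^ 2 ≤ ‖η‖ ^ 2 := by
  have h : ((∑ j, ‖π (L.a j) η‖ ^ 2 : ℝ) : ℂ) = ⟪η, π (∑ j, star (L.a j) * L.a j) η⟫_ℂ := by
    rw [map_sum, ContinuousLinearMap.sum_apply, inner_sum]
    push_cast
    refine Finset.sum_congr rfl fun j _ => ?_
    rw [nq_pi_mul, ← nq_pi_star, inner_self_eq_norm_sq_to_K (𝕜 := ℂ)]; rfl
  have h1 : ‖⟪η, π (∑ j, star (L.a j) * L.a j) η⟫_ℂ‖ ≤ ‖η‖ ^ 2 := by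
    refine (norm_inner_le_norm _ _).trans ?_
    have := nq_pi_norm π (∑ j, star (L.a j) * L.a j) η
    nlinarith [norm_nonneg η, L.hn]
  rw [← h, Complex.norm_real] at h1
  exact (le_abs_self _).trans h1

noncomputable def n (j : L.ι) : ℝ := ‖π (L.a j) ξ‖
noncomputable def v (j : L.ι) : H := ((L.n j)⁻¹ : ℂ) • π (L.a j) ξ

theorem n0 (j : L.ι) : 0 ≤ L.n j := norm_nonneg _

theorem nv (j : L.ι) : (L.n j : ℂ) • L.v j = π (L.a j) ξ := by
  unfold v
  by_cases h : L.n j = 0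
  · have : π (L.a j) ξ = 0 := norm_eq_zero.1 h
    simp [this]
  · rw [smul_smul, mul_inv_cancel₀ (by exact_mod_cast h), one_smul]

theorem hv (j k : L.ι) (h : j ≠ k) : ⟪L.v j, L.v k⟫_ℂ = 0 := by
  unfold v
  rw [inner_smul_left, inner_smul_right, L.orth j k h]; simp

theorem v_norm (j : L.ι) : ‖L.v j‖ = 1 ∨ L.v j = 0 := by
  by_cases h : L.n j = 0
  · right; simp [v, h]
  · left
    unfold v
    rw [norm_smul, norm_inv, Complex.norm_real, Real.norm_of_nonneg (L.n0 j)]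
    exact inv_mul_cancel₀ h

theorem hnv (j : L.ι) : L.n j * ‖L.v j‖ ^ 2 = L.n j := by
  rcases L.v_norm j with h | h
  · rw [h]; ring
  · have := L.nv j
    rw [h, smul_zero] at this
    have : L.n j = 0 := by rw [n, ← this, norm_zero]
    simp [this]

theorem P : ∑ j, L.n j ^ 2 ≤ ‖ξ‖ ^ 2 := L.ha ξ

theorem vsum_norm (c : L.ι → ℂ) : ‖∑ j, c j • L.v j‖ ^ 2 = ∑ j, ‖c j‖ ^ 2 * ‖L.v j‖ ^ 2 := by
  have : ((‖∑ j, c j • L.v j‖ ^ 2 : ℝ) : ℂ) = ((∑ j, ‖c j‖ ^ 2 * ‖L.v j‖ ^ 2 : ℝ) : ℂ) := by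
    have h0 := inner_self_eq_norm_sq_to_K (𝕜 := ℂ) (∑ j, c j • L.v j)
    push_cast
    refine h0.symm.trans ?_
    rw [sum_inner]
    refine Finset.sum_congr rfl fun j _ => ?_
    rw [inner_sum, Finset.sum_eq_single j]
    · rw [inner_smul_left, inner_smul_right, inner_self_eq_norm_sq_to_K (𝕜 := ℂ), ← mul_assoc, Complex.conj_mul']; rfl
    · intro k _ hk
      rw [inner_smul_left, inner_smul_right, L.hv j k hk.symm]; simp
    · simp
  exact_mod_cast this

theorem bessel (z : H) : ∑ j, ‖⟪L.v j, z⟫_ℂ‖ ^ 2 ≤ ‖z‖ ^ 2 := by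
  set w := ∑ j, ⟪L.v j, z⟫_ℂ • L.v j with hw
  set S := ∑ j, ‖⟪L.v j, z⟫_ℂ‖ ^ 2 with hS
  have h1 : ‖w‖ ^ 2 = S := by
    rw [hw, vsum_norm]
    refine Finset.sum_congr rfl fun j _ => ?_
    rcases L.v_norm j with h | h <;> simp [h]
  have h2 : ⟪w, z⟫_ℂ = (S : ℂ) := by
    rw [hw, sum_inner, hS]
    push_cast
    refine Finset.sum_congr rfl fun j _ => ?_
    rw [inner_smul_left, Complex.conj_mul']
  have h3 : S ≤ ‖w‖ * ‖z‖ := by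
    have := norm_inner_le_norm (𝕜 := ℂ) w z
    rw [h2, Complex.norm_real] at this
    exact (le_abs_self _).trans this
  nlinarith [norm_nonneg w, norm_nonneg z, sq_nonneg (‖w‖ - ‖z‖)]

noncomputable def d (b : A) : ℝ := 2 * ‖b‖ * ‖nqTheta L.a L.β b - b‖ + ‖nqTheta L.a L.β (star b * b) - star b * b‖

theorem theta_inner (T : H →L[ℂ] H) (hT : ∀ c x, T (π c x) = π c (T x)) (b : A) (x y : H) : ⟪x, T (π (nqTheta L.a L.β b) y)⟫_ℂ =
    ∑ j, ∑ k, L.β b j k * ⟪π (L.a j) x, T (π (L.a k) y)⟫_ℂ := by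
  simp only [nqTheta, map_sum, ContinuousLinearMap.sum_apply, inner_sum]
  refine Finset.sum_congr rfl fun j _ => Finset.sum_congr rfl fun k _ => ?_
  rw [map_smul, _root_.smul_apply, map_smul, inner_smul_right, nq_pi_mul, hT, ← nq_pi_star]

/-- (4) -/
theorem four (b : A) (η : H) : ∑ j, ‖π (L.a j) (π b η) - ∑ k, L.β b j k • π (L.a k) η‖ ^ 2 ≤ L.d b * ‖η‖ ^ 2 := by
  have h1 : ∀ j, ‖π (L.a j) (π b η) - ∑ k, L.β b j k • π (L.a k) η‖ ^ 2 = ‖π (L.a j) (π b η)‖ ^ 2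
      - 2 * (⟪π (L.a j) (π b η), ∑ k, L.β b j k • π (L.a k) η⟫_ℂ).re + ‖∑ k, L.β b j k • π (L.a k) η‖ ^ 2 := by
    intro j
    exact norm_sub_sq (𝕜 := ℂ) _ _
  rw [Finset.sum_congr rfl fun j _ => h1 j, Finset.sum_add_distrib, Finset.sum_sub_distrib, ← Finset.mul_sum, ← Complex.re_sum]
  have h2 := L.ha (π b η)
  have h3 := L.cpc.schwarzH b fun j => π (L.a j) η
  have h4 := L.theta_inner (ContinuousLinearMap.id ℂ H) (fun _ _ => rfl) (star b * b) η η
  have h5 := L.theta_inner (ContinuousLinearMap.id ℂ H) (fun _ _ => rfl) b (π b η) η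
  simp only [ContinuousLinearMap.id_apply] at h4 h5
  rw [← h4] at h3
  have h6 : ∑ j, ⟪π (L.a j) (π b η), ∑ k, L.β b j k • π (L.a k) η⟫_ℂ = ⟪π b η, π (nqTheta L.a L.β b) η⟫_ℂ := by
    rw [h5]
    refine Finset.sum_congr rfl fun j _ => ?_
    rw [inner_sum]
    exact Finset.sum_congr rfl fun k _ => inner_smul_right _ _ _
  rw [h6]
  have e1 : ‖π b η‖ ^ 2 = (⟪π b η, π b η⟫_ℂ).re := (inner_self_eq_norm_sq (𝕜 := ℂ) _).symm
  have e2 : (⟪π b η, π b η⟫_ℂ).re = (⟪η, π (star b * b) η⟫_ℂ).re := by rw [nq_pi_mul, ← nq_pi_star]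
  have b1 : |(⟪π b η, π (nqTheta L.a L.β b - b) η⟫_ℂ).re| ≤ ‖b‖ * ‖nqTheta L.a L.β b - b‖ * ‖η‖ ^ 2 := by
    refine (Complex.abs_re_le_norm _).trans ((norm_inner_le_norm _ _).trans ?_)
    calc _ ≤ (‖b‖ * ‖η‖) * (‖nqTheta L.a L.β b - b‖ * ‖η‖) := by gcongr <;> exact nq_pi_norm _ _ _
      _ = _ := by ring
  have b2 : |(⟪η, π (nqTheta L.a L.β (star b * b) - star b * b) η⟫_ℂ).re| ≤ ‖nqTheta L.a L.β (star b * b) - star b * b‖ * ‖η‖ ^ 2 := by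
    refine (Complex.abs_re_le_norm _).trans ((norm_inner_le_norm _ _).trans ?_)
    calc _ ≤ ‖η‖ * (‖nqTheta L.a L.β (star b * b) - star b * b‖ * ‖η‖) := by gcongr; exact nq_pi_norm _ _ _
      _ = _ := by ring
  rw [map_sub, _root_.sub_apply, inner_sub_right, Complex.sub_re] at b1 b2
  rw [abs_le] at b1 b2
  unfold d
  nlinarith [b1.1, b1.2, b2.1, b2.2]

end nqLevel
end Levels


section LevLim
open scoped InnerProductSpace ComplexOrder
open ComplexConjugate ContinuousLinearMap Filter Topology

variable {A : Type*} [NonUnitalCStarAlgebra A]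
variable {H : Type*} [NormedAddCommGroup H] [InnerProductSpace ℂ H] [CompleteSpace H]
variable {π : A →⋆ₙₐ[ℂ] (H →L[ℂ] H)} {ξ : H}

namespace nqLevel
variable (L : nqLevel π ξ)

noncomputable def E (x : H →L[ℂ] H) : H →L[ℂ] H := nqE (fun j => π (L.a j)) x

theorem E_inner (x : H →L[ℂ] H) (z y : H) : ⟪z, L.E x y⟫_ℂ = ∑ j, ⟪π (L.a j) z, x (π (L.a j) y)⟫_ℂ := nqE_inner _ _ _ _

theorem E_norm (x : H →L[ℂ] H) : ‖L.E x‖ ≤ ‖x‖ := nqE_norm _ L.ha x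

theorem d0 (b : A) : 0 ≤ L.d b := by unfold d; positivity

theorem fiveA (T : H →L[ℂ] H) (b : A) (ζ η : H) :
    ‖⟪ζ, L.E T (π b η)⟫_ℂ - ∑ j, ∑ k, L.β b j k * ⟪π (L.a j) ζ, T (π (L.a k) η)⟫_ℂ‖ ≤ ‖ζ‖ * ‖T‖ * ‖η‖ * √(L.d b) := by
  have h1 : ⟪ζ, L.E T (π b η)⟫_ℂ - ∑ j, ∑ k, L.β b j k * ⟪π (L.a j) ζ, T (π (L.a k) η)⟫_ℂ =
      ∑ j, ⟪π (L.a j) ζ, T (π (L.a j) (π b η) - ∑ k, L.β b j k • π (L.a k) η)⟫_ℂ := by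
    rw [E_inner, ← Finset.sum_sub_distrib]
    refine Finset.sum_congr rfl fun j _ => ?_
    rw [map_sub, inner_sub_right, map_sum, inner_sum]
    simp only [map_smul, inner_smul_right]
  rw [h1]
  refine le_of_sq_le_sq ?_ (by positivity)
  refine (nq_cs_inner _ _ _).trans ?_
  have h2 : ∑ j, ‖T (π (L.a j) (π b η) - ∑ k, L.β b j k • π (L.a k) η)‖ ^ 2 ≤ ‖T‖ ^ 2 * (L.d b * ‖η‖ ^ 2) := by
    refine le_trans ?_ (mul_le_mul_of_nonneg_left (L.four b η) (by positivity))
    rw [Finset.mul_sum]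
    refine Finset.sum_le_sum fun j _ => ?_
    rw [← mul_pow]
    exact pow_le_pow_left₀ (norm_nonneg _) (T.le_opNorm _) 2
  calc _ ≤ ‖ζ‖ ^ 2 * (‖T‖ ^ 2 * (L.d b * ‖η‖ ^ 2)) := mul_le_mul (L.ha ζ) h2 (by positivity) (by positivity)
    _ = _ := by rw [mul_pow, Real.sq_sqrt (L.d0 b)]; ring

theorem seven (T : H →L[ℂ] H) (b : A) (ζ η : H) :
    ‖⟪ζ, L.E T (π b η)⟫_ℂ - ⟪π (star b) ζ, L.E T η⟫_ℂ‖ ≤ ‖ζ‖ * ‖T‖ * ‖η‖ * (√(L.d b) + √(L.d (star b))) := by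
  have h1 := L.fiveA T b ζ η
  have h2 := L.fiveA (adjoint T) (star b) η ζ
  have e1 : ⟪π (star b) ζ, L.E T η⟫_ℂ = conj ⟪η, L.E (adjoint T) (π (star b) ζ)⟫_ℂ := by
    rw [inner_conj_symm]; exact (nqE_adj _ _ _ _).symm
  have e2 : ∑ j, ∑ k, L.β b j k * ⟪π (L.a j) ζ, T (π (L.a k) η)⟫_ℂ =
      conj (∑ j, ∑ k, L.β (star b) j k * ⟪π (L.a j) η, adjoint T (π (L.a k) ζ)⟫_ℂ) := by
    rw [Finset.sum_comm, map_sum]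
    refine Finset.sum_congr rfl fun k _ => ?_
    rw [map_sum]
    refine Finset.sum_congr rfl fun j _ => ?_
    rw [map_mul, inner_conj_symm, adjoint_inner_left, ← L.cpc.herm_entry]
  have h3 : ‖⟪π (star b) ζ, L.E T η⟫_ℂ - ∑ j, ∑ k, L.β b j k * ⟪π (L.a j) ζ, T (π (L.a k) η)⟫_ℂ‖ ≤
      ‖η‖ * ‖T‖ * ‖ζ‖ * √(L.d (star b)) := by
    rw [e1, e2, ← map_sub, RCLike.norm_conj]
    simpa using h2
  have := norm_sub_le_norm_sub_add_norm_sub ⟪ζ, L.E T (π b η)⟫_ℂ (∑ j, ∑ k, L.β b j k * ⟪π (L.a j) ζ, T (π (L.a k) η)⟫_ℂ) ⟪π (star b) ζ, L.E T η⟫_ℂ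
  rw [norm_sub_rev] at h3
  linarith

theorem five (T : H →L[ℂ] H) (hT : ∀ c x, T (π c x) = π c (T x)) (b : A) (ζ η : H) :
    ‖⟪ζ, L.E T (π b η)⟫_ℂ - ⟪ζ, T (π b η)⟫_ℂ‖ ≤ ‖ζ‖ * ‖T‖ * ‖η‖ * (√(L.d b) + ‖nqTheta L.a L.β b - b‖) := by
  have h1 := L.fiveA T b ζ η
  rw [← L.theta_inner T hT] at h1
  have h2 : ‖⟪ζ, T (π (nqTheta L.a L.β b) η)⟫_ℂ - ⟪ζ, T (π b η)⟫_ℂ‖ ≤ ‖ζ‖ * ‖T‖ * ‖η‖ * ‖nqTheta L.a L.β b - b‖ := by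
    rw [← inner_sub_right, ← map_sub, ← _root_.sub_apply, ← map_sub]
    refine (norm_inner_le_norm _ _).trans ?_
    calc _ ≤ ‖ζ‖ * (‖T‖ * (‖nqTheta L.a L.β b - b‖ * ‖η‖)) := by
          gcongr; exact (T.le_opNorm _).trans (by gcongr; exact nq_pi_norm _ _ _)
      _ = _ := by ring
  have := norm_sub_le_norm_sub_add_norm_sub ⟪ζ, L.E T (π b η)⟫_ℂ ⟪ζ, T (π (nqTheta L.a L.β b) η)⟫_ℂ ⟪ζ, T (π b η)⟫_ℂ
  linarith

noncomputable def Y (b : A) : H →L[ℂ] H := ∑ j, ∑ l, L.β b l j • (innerSL ℂ (L.v l)).smulRight (L.v j)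

theorem Y_apply (b : A) (x : H) : L.Y b x = ∑ j, (∑ l, L.β b l j * ⟪L.v l, x⟫_ℂ) • L.v j := by
  simp only [Y, ContinuousLinearMap.sum_apply, _root_.smul_apply, ContinuousLinearMap.smulRight_apply, innerSL_apply_apply, Finset.sum_smul, smul_smul]

theorem Y_inner (b : A) (z x : H) : ⟪z, L.Y b x⟫_ℂ = ∑ j, ∑ l, L.β b l j * ⟪L.v l, x⟫_ℂ * ⟪z, L.v j⟫_ℂ := by
  rw [Y_apply, inner_sum]
  refine Finset.sum_congr rfl fun j _ => ?_
  rw [inner_smul_right, Finset.sum_mul]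

theorem Y_norm (b : A) : ‖L.Y b‖ ≤ ‖b‖ := by
  refine opNorm_le_bound _ (norm_nonneg _) fun x => ?_
  refine le_of_sq_le_sq ?_ (by positivity)
  rw [Y_apply, vsum_norm]
  have h := L.cpc.contr' (star b) fun l => conj ⟪L.v l, x⟫_ℂ
  have h1 : ∀ j, ‖∑ l, L.β b l j * ⟪L.v l, x⟫_ℂ‖ = ‖(L.β (star b) *ᵥ fun l => conj ⟪L.v l, x⟫_ℂ) j‖ := by
    intro j
    rw [← RCLike.norm_conj]
    congr 1
    rw [map_sum]
    refine Finset.sum_congr rfl fun l _ => ?_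
    change _ = L.β (star b) j l * conj ⟪L.v l, x⟫_ℂ
    rw [map_mul, L.cpc.herm_entry (star b) j l, star_star]
  calc _ ≤ ∑ j, ‖(L.β (star b) *ᵥ fun l => conj ⟪L.v l, x⟫_ℂ) j‖ ^ 2 := by
        refine Finset.sum_le_sum fun j _ => ?_
        rw [h1]
        have : ‖L.v j‖ ^ 2 ≤ 1 := by rcases L.v_norm j with h | h <;> simp [h]
        nlinarith [sq_nonneg ‖(L.β (star b) *ᵥ fun l => conj ⟪L.v l, x⟫_ℂ) j‖]
    _ ≤ ‖b‖ ^ 2 * ‖x‖ ^ 2 := by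
        refine h.trans ?_
        rw [norm_star]
        gcongr
        simp only [RCLike.norm_conj]
        exact L.bessel x
    _ = _ := by ring

theorem Y_add (b c : A) : L.Y (b + c) = L.Y b + L.Y c := by
  simp [Y, add_smul, Finset.sum_add_distrib]

theorem Y_smul (z : ℂ) (c : A) : L.Y (z • c) = z • L.Y c := by
  simp [Y, mul_smul, Finset.smul_sum]

theorem E_add (x y : H →L[ℂ] H) : L.E (x + y) = L.E x + L.E y := nqE_add _ _ _
theorem E_smul (z : ℂ) (x : H →L[ℂ] H) : L.E (z • x) = z • L.E x := nqE_smul _ _ _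

end nqLevel

theorem nq_ulim {I : Type*} (U : Ultrafilter I) (f : I → ℂ) (M : ℝ) (hf : ∀ i, ‖f i‖ ≤ M) :
    ∃ z, ‖z‖ ≤ M ∧ Tendsto f U (𝓝 z) := by
  have := (isCompact_closedBall (0 : ℂ) M).ultrafilter_le_nhds (U.map f) (by
    rw [le_principal_iff]
    exact mem_map.2 (Filter.univ_mem' fun i => by simpa using hf i))
  obtain ⟨z, hz, h⟩ := this
  exact ⟨z, by simpa using hz, h⟩

theorem nq_wot {I : Type*} (U : Ultrafilter I) (T : I → H →L[ℂ] H) (M : ℝ) (hM : ∀ i, ‖T i‖ ≤ M) (hM0 : 0 ≤ M) :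
    ∃ S : H →L[ℂ] H, ‖S‖ ≤ M ∧ ∀ ζ η, Tendsto (fun i => ⟪ζ, T i η⟫_ℂ) U (𝓝 ⟪ζ, S η⟫_ℂ) := by
  have hb : ∀ v w i, ‖⟪T i v, w⟫_ℂ‖ ≤ M * ‖v‖ * ‖w‖ := fun v w i =>
    (norm_inner_le_norm _ _).trans (by gcongr; exact ((T i).le_opNorm v).trans (by gcongr; exact hM i))
  choose B hB1 hB2 using fun v w => nq_ulim U (fun i => ⟪T i v, w⟫_ℂ) (M * ‖v‖ * ‖w‖) (hb v w)
  let B' : H →L⋆[ℂ] H →L[ℂ] ℂ := LinearMap.mkContinuous₂ (LinearMap.mk₂'ₛₗ (starRingEnd ℂ) (RingHom.id ℂ) B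
    (fun v v' w => tendsto_nhds_unique (hB2 _ _) (by simpa [inner_add_left] using (hB2 v w).add (hB2 v' w)))
    (fun c v w => tendsto_nhds_unique (hB2 _ _) (by simpa [inner_smul_left, mul_comm] using (hB2 v w).const_mul (conj c)))
    (fun v w w' => tendsto_nhds_unique (hB2 _ _) (by simpa [inner_add_right] using (hB2 v w).add (hB2 v w')))
    (fun c v w => tendsto_nhds_unique (hB2 _ _) (by simpa [inner_smul_right] using (hB2 v w).const_mul c))) M hB1
  have hS : ∀ v w, ⟪InnerProductSpace.continuousLinearMapOfBilin B' v, w⟫_ℂ = B v w := fun v w =>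
    InnerProductSpace.continuousLinearMapOfBilin_apply B' v w
  refine ⟨InnerProductSpace.continuousLinearMapOfBilin B', ?_, fun ζ η => ?_⟩
  · refine opNorm_le_bound _ hM0 fun x => ?_
    set y := InnerProductSpace.continuousLinearMapOfBilin B' x with hy
    have h1 := hB1 x y
    rw [← hS, ← hy, inner_self_eq_norm_sq_to_K (𝕜 := ℂ)] at h1
    simp at h1
    by_cases h0 : ‖y‖ = 0
    · rw [h0]; positivity
    · have : 0 < ‖y‖ := lt_of_le_of_ne (norm_nonneg _) (Ne.symm h0)
      nlinarith
  · have := (Complex.continuous_conj.tendsto _).comp (hB2 η ζ)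
    rw [← hS, inner_conj_symm] at this
    refine this.congr fun i => ?_
    simp

end LevLim


section Kappa
open scoped InnerProductSpace ComplexOrder
open ComplexConjugate ContinuousLinearMap Filter Topology

variable {A : Type*} [NonUnitalCStarAlgebra A]
variable {H : Type*} [NormedAddCommGroup H] [InnerProductSpace ℂ H] [CompleteSpace H]
variable {π : A →⋆ₙₐ[ℂ] (H →L[ℂ] H)} {ξ : H}

theorem nq_comm_adj (T : H →L[ℂ] H) (hT : ∀ c x, T (π c x) = π c (T x)) : ∀ c x, adjoint T (π c x) = π c (adjoint T x) := by
  intro c x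
  refine ext_inner_right ℂ fun y => ?_
  rw [adjoint_inner_left, nq_pi_star, nq_pi_star, ← hT, adjoint_inner_left]

namespace nqLevel
variable (L : nqLevel π ξ)

noncomputable def S (x y : H →L[ℂ] H) : ℂ :=
  ∑ j, ∑ l, (L.n j * L.n l : ℂ) * (⟪L.v j, x (L.v l)⟫_ℂ * conj ⟪L.v j, y (L.v l)⟫_ℂ)

noncomputable def Q (x : H →L[ℂ] H) : ℝ := ∑ j, ∑ l, L.n j * L.n l * ‖⟪L.v j, x (L.v l)⟫_ℂ‖ ^ 2

theorem Q0 (x : H →L[ℂ] H) : 0 ≤ L.Q x :=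
  Finset.sum_nonneg fun j _ => Finset.sum_nonneg fun l _ => mul_nonneg (mul_nonneg (L.n0 j) (L.n0 l)) (by positivity)

theorem v_le (j : L.ι) : ‖L.v j‖ ≤ 1 := by rcases L.v_norm j with h | h <;> simp [h]

theorem Q_le (x : H →L[ℂ] H) : L.Q x ≤ ‖x‖ ^ 2 * ‖ξ‖ ^ 2 := by
  have h1 : L.Q x ≤ ∑ j, ∑ l, (L.n j ^ 2 * ‖⟪L.v j, x (L.v l)⟫_ℂ‖ ^ 2 / 2 + L.n l ^ 2 * ‖⟪L.v j, x (L.v l)⟫_ℂ‖ ^ 2 / 2) := by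
    refine Finset.sum_le_sum fun j _ => Finset.sum_le_sum fun l _ => ?_
    nlinarith [mul_nonneg (sq_nonneg (L.n j - L.n l)) (sq_nonneg ‖⟪L.v j, x (L.v l)⟫_ℂ‖)]
  have h2 : ∑ j, ∑ l, L.n j ^ 2 * ‖⟪L.v j, x (L.v l)⟫_ℂ‖ ^ 2 / 2 ≤ ‖x‖ ^ 2 * ‖ξ‖ ^ 2 / 2 := by
    have : ∀ j, ∑ l, L.n j ^ 2 * ‖⟪L.v j, x (L.v l)⟫_ℂ‖ ^ 2 / 2 ≤ ‖x‖ ^ 2 / 2 * L.n j ^ 2 := by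
      intro j
      have hb := L.bessel (adjoint x (L.v j))
      have e : ∀ l, ‖⟪L.v l, adjoint x (L.v j)⟫_ℂ‖ = ‖⟪L.v j, x (L.v l)⟫_ℂ‖ := fun l => by
        rw [adjoint_inner_right, norm_inner_symm]
      simp only [e] at hb
      have h3 : ‖adjoint x (L.v j)‖ ≤ ‖x‖ := by
        refine ((adjoint x).le_opNorm _).trans ?_
        rw [LinearIsometryEquiv.norm_map]
        exact mul_le_of_le_one_right (norm_nonneg _) (L.v_le j)
      rw [← Finset.sum_div, ← Finset.mul_sum]
      nlinarith [mul_le_mul_of_nonneg_left (hb.trans (pow_le_pow_left₀ (norm_nonneg _) h3 2)) (sq_nonneg (L.n j))]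
    refine (Finset.sum_le_sum fun j _ => this j).trans ?_
    rw [← Finset.mul_sum]
    nlinarith [L.P, sq_nonneg ‖x‖]
  have h4 : ∑ j, ∑ l, L.n l ^ 2 * ‖⟪L.v j, x (L.v l)⟫_ℂ‖ ^ 2 / 2 ≤ ‖x‖ ^ 2 * ‖ξ‖ ^ 2 / 2 := by
    rw [Finset.sum_comm]
    have : ∀ l, ∑ j, L.n l ^ 2 * ‖⟪L.v j, x (L.v l)⟫_ℂ‖ ^ 2 / 2 ≤ ‖x‖ ^ 2 / 2 * L.n l ^ 2 := by
      intro l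
      have hb := L.bessel (x (L.v l))
      have h3 : ‖x (L.v l)‖ ≤ ‖x‖ := (x.le_opNorm _).trans (mul_le_of_le_one_right (norm_nonneg _) (L.v_le l))
      rw [← Finset.sum_div, ← Finset.mul_sum]
      nlinarith [mul_le_mul_of_nonneg_left (hb.trans (pow_le_pow_left₀ (norm_nonneg _) h3 2)) (sq_nonneg (L.n l))]
    refine (Finset.sum_le_sum fun j _ => this j).trans ?_
    rw [← Finset.mul_sum]
    nlinarith [L.P, sq_nonneg ‖x‖]
  simp only [Finset.sum_add_distrib] at h1
  linarith

theorem S_le (x y : H →L[ℂ] H) : ‖L.S x y‖ ≤ (‖x‖ ^ 2 + ‖y‖ ^ 2) * ‖ξ‖ ^ 2 := by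
  have h : ‖L.S x y‖ ≤ L.Q x + L.Q y := by
    unfold S Q
    rw [← Finset.sum_add_distrib]
    refine norm_sum_le_of_le _ fun j _ => ?_
    rw [← Finset.sum_add_distrib]
    refine norm_sum_le_of_le _ fun l _ => ?_
    have h0 : (L.n j * L.n l : ℂ) = ((L.n j * L.n l : ℝ) : ℂ) := by push_cast; rfl
    have h1 := mul_nonneg (L.n0 j) (L.n0 l)
    rw [h0, norm_mul, norm_mul, RCLike.norm_conj, Complex.norm_real, Real.norm_of_nonneg h1, ← mul_add]
    refine mul_le_mul_of_nonneg_left ?_ h1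
    nlinarith [sq_nonneg (‖⟪L.v j, x (L.v l)⟫_ℂ‖ - ‖⟪L.v j, y (L.v l)⟫_ℂ‖), sq_nonneg (‖⟪L.v j, x (L.v l)⟫_ℂ‖ + ‖⟪L.v j, y (L.v l)⟫_ℂ‖)]
  linarith [L.Q_le x, L.Q_le y]

theorem Q_add (x y : H →L[ℂ] H) (z : ℂ) : L.Q (x + z • y) = L.Q x + 2 * (conj z * L.S x y).re + ‖z‖ ^ 2 * L.Q y := by
  unfold Q S
  simp only [Finset.mul_sum, Complex.re_sum, ← Finset.sum_add_distrib]
  refine Finset.sum_congr rfl fun j _ => Finset.sum_congr rfl fun l _ => ?_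
  rw [_root_.add_apply, _root_.smul_apply, inner_add_right, inner_smul_right, ← Complex.normSq_eq_norm_sq, Complex.normSq_add,
    Complex.normSq_mul, Complex.normSq_eq_norm_sq, Complex.normSq_eq_norm_sq, Complex.normSq_eq_norm_sq, map_mul]
  have h0 : conj z * ((L.n j * L.n l : ℂ) * (⟪L.v j, x (L.v l)⟫_ℂ * conj ⟪L.v j, y (L.v l)⟫_ℂ)) =
    ((L.n j * L.n l : ℝ) : ℂ) * (⟪L.v j, x (L.v l)⟫_ℂ * (conj z * conj ⟪L.v j, y (L.v l)⟫_ℂ)) := by push_cast; ring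
  rw [h0, Complex.re_ofReal_mul]
  ring

theorem S_symm (x y : H →L[ℂ] H) : L.S x (adjoint y) = L.S y (adjoint x) := by
  unfold S
  conv_rhs => rw [Finset.sum_comm]
  refine Finset.sum_congr rfl fun j _ => Finset.sum_congr rfl fun l _ => ?_
  rw [adjoint_inner_right, adjoint_inner_right, inner_conj_symm, inner_conj_symm]
  ring

theorem S_Y (a : A) (T : H →L[ℂ] H) (hT : ∀ c x, T (π c x) = π c (T x)) :
    L.S (L.Y a) (adjoint T) = ⟪ξ, T (π (nqTheta L.a L.β a) ξ)⟫_ℂ := by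
  rw [L.theta_inner T hT]
  unfold S
  conv_rhs => rw [Finset.sum_comm]
  refine Finset.sum_congr rfl fun j _ => Finset.sum_congr rfl fun l _ => ?_
  have h1 : ⟪L.v j, L.Y a (L.v l)⟫_ℂ = L.β a l j * (‖L.v l‖ ^ 2 : ℝ) * (‖L.v j‖ ^ 2 : ℝ) := by
    rw [Y_inner, Finset.sum_eq_single j, Finset.sum_eq_single l]
    · rw [inner_self_eq_norm_sq_to_K (𝕜 := ℂ), inner_self_eq_norm_sq_to_K (𝕜 := ℂ)]; push_cast; rfl
    · intro k _ hk
      rw [L.hv k l hk]; simp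
    · simp
    · intro k _ hk
      rw [L.hv j k hk.symm]; simp
    · simp
  have h2 : ∀ j, (L.n j : ℂ) * (‖L.v j‖ ^ 2 : ℝ) = L.n j := fun j => by exact_mod_cast L.hnv j
  rw [h1, adjoint_inner_right, inner_conj_symm, ← L.nv l, ← L.nv j, map_smul, inner_smul_left, inner_smul_right, Complex.conj_ofReal]
  calc _ = ((L.n j : ℂ) * (‖L.v j‖ ^ 2 : ℝ)) * ((L.n l : ℂ) * (‖L.v l‖ ^ 2 : ℝ)) * (L.β a l j * ⟪L.v l, T (L.v j)⟫_ℂ) := by ring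
    _ = _ := by rw [h2, h2]; ring

theorem Y_pos (k : ℕ) (b : Fin k → A) (x : Fin k → H) :
    0 ≤ ∑ p, ∑ q, ⟪x q, L.Y (star (b p) * b q) (x p)⟫_ℂ := by
  have h := L.cpc.pos k b fun p j => ⟪x p, L.v j⟫_ℂ
  refine h.trans_eq ?_
  refine Finset.sum_congr rfl fun p _ => Finset.sum_congr rfl fun q _ => ?_
  rw [Y_inner]
  conv_rhs => rw [Finset.sum_comm]
  refine Finset.sum_congr rfl fun j _ => ?_
  simp only [Matrix.mulVec, dotProduct, Finset.mul_sum, Pi.star_apply]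
  refine Finset.sum_congr rfl fun l _ => ?_
  have : star ⟪x p, L.v j⟫_ℂ = ⟪L.v j, x p⟫_ℂ := inner_conj_symm _ _
  rw [this]; ring

theorem EY_pos (k : ℕ) (b : Fin k → A) (x : Fin k → H) :
    0 ≤ ∑ p, ∑ q, ⟪x q, L.E (L.Y (star (b p) * b q)) (x p)⟫_ℂ := by
  have : ∑ p, ∑ q, ⟪x q, L.E (L.Y (star (b p) * b q)) (x p)⟫_ℂ =
      ∑ t, ∑ p, ∑ q, ⟪π (L.a t) (x q), L.Y (star (b p) * b q) (π (L.a t) (x p))⟫_ℂ := by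
    simp only [E_inner]
    conv_rhs => rw [Finset.sum_comm]
    refine Finset.sum_congr rfl fun p _ => ?_
    conv_rhs => rw [Finset.sum_comm]
  rw [this]
  exact Finset.sum_nonneg fun t _ => L.Y_pos k b fun p => π (L.a t) (x p)

end nqLevel

theorem nq_kappa {I : Type*} (U : Ultrafilter I) (L : I → nqLevel π ξ) :
    ∃ κ : A →ₗ[ℂ] (H →L[ℂ] H), (∀ a, ‖κ a‖ ≤ ‖a‖) ∧
      ∀ a ζ η, Tendsto (fun i => ⟪ζ, (L i).E ((L i).Y a) η⟫_ℂ) U (𝓝 ⟪ζ, κ a η⟫_ℂ) := by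
  choose κ h1 h2 using fun a : A => nq_wot U (fun i => (L i).E ((L i).Y a)) ‖a‖
    (fun i => ((L i).E_norm _).trans ((L i).Y_norm a)) (norm_nonneg _)
  refine ⟨⟨⟨κ, fun a b => ?_⟩, fun z a => ?_⟩, h1, h2⟩
  · ext η
    refine ext_inner_left ℂ fun ζ => tendsto_nhds_unique (h2 _ _ _) ?_
    have := (h2 a ζ η).add (h2 b ζ η)
    simpa only [nqLevel.Y_add, nqLevel.E_add, _root_.add_apply, inner_add_right] using this
  · ext η
    refine ext_inner_left ℂ fun ζ => tendsto_nhds_unique (h2 _ _ _) ?_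
    have := (h2 a ζ η).const_mul z
    simpa only [nqLevel.Y_smul, nqLevel.E_smul, _root_.smul_apply, inner_smul_right, RingHom.id_apply] using this

end Kappa


section Lim
open scoped InnerProductSpace ComplexOrder
open ComplexConjugate ContinuousLinearMap Filter Topology

variable {A : Type*} [NonUnitalCStarAlgebra A]
variable {H : Type*} [NormedAddCommGroup H] [InnerProductSpace ℂ H] [CompleteSpace H]
variable {π : A →⋆ₙₐ[ℂ] (H →L[ℂ] H)} {ξ : H} {I : Type*} {U : Ultrafilter I} {L : I → nqLevel π ξ}
  (hL : ∀ b, Tendsto (fun i => ‖nqTheta (L i).a (L i).β b - b‖) U (𝓝 0))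
include hL

theorem nq_d_tendsto (b : A) : Tendsto (fun i => (L i).d b) U (𝓝 0) := by
  have := ((hL b).const_mul (2 * ‖b‖)).add (hL (star b * b))
  simpa [nqLevel.d] using this

theorem nq_claim1 (a : A) (T : H →L[ℂ] H) (hT : ∀ c x, T (π c x) = π c (T x)) :
    Tendsto (fun i => (L i).S ((L i).Y a) (adjoint T)) U (𝓝 ⟪ξ, T (π a ξ)⟫_ℂ) := by
  rw [tendsto_iff_norm_sub_tendsto_zero]
  refine squeeze_zero (g := fun i => ‖ξ‖ * ‖T‖ * ‖ξ‖ * ‖nqTheta (L i).a (L i).β a - a‖) (fun _ => norm_nonneg _) (fun i => ?_)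
    (by simpa using (hL a).const_mul (‖ξ‖ * ‖T‖ * ‖ξ‖))
  rw [nqLevel.S_Y _ _ _ hT, ← inner_sub_right, ← map_sub, ← _root_.sub_apply, ← map_sub]
  refine (norm_inner_le_norm _ _).trans ?_
  calc _ ≤ ‖ξ‖ * (‖T‖ * (‖nqTheta (L i).a (L i).β a - a‖ * ‖ξ‖)) := by
        gcongr; exact (T.le_opNorm _).trans (by gcongr; exact nq_pi_norm _ _ _)
    _ = _ := by ring

theorem nq_E_tendsto (K : nqLevel π ξ) (j : K.ι) (ζ : H) (T : H →L[ℂ] H) (hT : ∀ c x, T (π c x) = π c (T x)) :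
    Tendsto (fun i => ⟪ζ, (L i).E T (K.v j)⟫_ℂ) U (𝓝 ⟪ζ, T (K.v j)⟫_ℂ) := by
  have h : Tendsto (fun i => ⟪ζ, (L i).E T (π (K.a j) ξ)⟫_ℂ) U (𝓝 ⟪ζ, T (π (K.a j) ξ)⟫_ℂ) := by
    rw [tendsto_iff_norm_sub_tendsto_zero]
    refine squeeze_zero (fun _ => norm_nonneg _) (fun i => (L i).five T hT (K.a j) ζ ξ) ?_
    have := ((nq_d_tendsto hL (K.a j)).sqrt.add (hL (K.a j))).const_mul (‖ζ‖ * ‖T‖ * ‖ξ‖)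
    simpa using this
  have := h.const_mul ((K.n j)⁻¹ : ℂ)
  simpa only [nqLevel.v, map_smul, inner_smul_right] using this

variable {κ : A →ₗ[ℂ] (H →L[ℂ] H)} (hk : ∀ a, ‖κ a‖ ≤ ‖a‖)
  (hκ : ∀ a ζ η, Tendsto (fun i => ⟪ζ, (L i).E ((L i).Y a) η⟫_ℂ) U (𝓝 ⟪ζ, κ a η⟫_ℂ))
include hκ

theorem nq_kappa_comm (a c : A) (x : H) : κ a (π c x) = π c (κ a x) := by
  refine ext_inner_left ℂ fun ζ => ?_
  have h1 := (hκ a ζ (π c x)).sub (hκ a (π (star c) ζ) x)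
  have h2 : Tendsto (fun i => ⟪ζ, (L i).E ((L i).Y a) (π c x)⟫_ℂ - ⟪π (star c) ζ, (L i).E ((L i).Y a) x⟫_ℂ) U (𝓝 0) := by
    refine squeeze_zero_norm (a := fun i => ‖ζ‖ * ‖a‖ * ‖x‖ * (√((L i).d c) + √((L i).d (star c)))) (fun i => ?_) ?_
    · refine ((L i).seven _ c ζ x).trans ?_
      gcongr
      exact (L i).Y_norm a
    · have := ((nq_d_tendsto hL c).sqrt.add (nq_d_tendsto hL (star c)).sqrt).const_mul (‖ζ‖ * ‖a‖ * ‖x‖)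
      simpa using this
  have h3 := sub_eq_zero.1 (tendsto_nhds_unique h1 h2)
  rw [h3, nq_pi_star, star_star]

theorem nq_step (K : nqLevel π ξ) (a : A) (z : ℂ) (T : H →L[ℂ] H) (hT : ∀ c x, T (π c x) = π c (T x)) (q : ℝ)
    (hq : Tendsto (fun i => (L i).Q ((L i).Y a + z • T)) U (𝓝 q)) : K.Q (κ a + z • T) ≤ q := by
  have hlim : Tendsto (fun i => K.Q ((L i).E ((L i).Y a + z • T))) U (𝓝 (K.Q (κ a + z • T))) := by
    unfold nqLevel.Q
    refine tendsto_finset_sum _ fun j _ => tendsto_finset_sum _ fun l _ => ?_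
    refine Tendsto.const_mul _ (Tendsto.pow (Tendsto.norm ?_) 2)
    have := (hκ a (K.v j) (K.v l)).add ((nq_E_tendsto hL K l (K.v j) T hT).const_mul z)
    simpa only [nqLevel.E_add, nqLevel.E_smul, _root_.add_apply, _root_.smul_apply, inner_add_right, inner_smul_right] using this
  let Rr : I → ℝ := fun i => ∑ q : K.ι, (L i).d (K.a q) * ‖ξ‖ ^ 2
  have hRr : Tendsto Rr U (𝓝 0) := by
    have := tendsto_finset_sum (Finset.univ : Finset K.ι) fun q _ => (nq_d_tendsto hL (K.a q)).mul_const (‖ξ‖ ^ 2)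
    simpa using this
  let C := (‖a‖ + ‖z‖ * ‖T‖) ^ 2
  set P := ‖ξ‖ ^ 2 with hP
  let err : ℝ → ℝ → ℝ := fun σ R => √(σ * P + (1 + 1 / σ) * R + σ) * (√(P + (σ * P + (1 + 1 / σ) * R + σ)) + √P)
  have key : ∀ i σ, 0 < σ → K.Q ((L i).E ((L i).Y a + z • T)) ≤ (L i).Q ((L i).Y a + z • T) + C * err σ (Rr i) := by
    intro i σ hσ
    have hM : ∀ η : (L i).ι → ℂ, ∑ q, ∑ j, ‖∑ l, (L i).β (K.a q) j l * η l‖ ^ 2 ≤ ∑ l, ‖η l‖ ^ 2 :=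
      fun η => (L i).cpc.nine K.a K.hn η
    have := nq_star (fun j => π ((L i).a j)) (L i).ha (L i).n (L i).n0 (L i).v (L i).hv (L i).hnv K.n K.n0 K.v K.bessel
      (fun q j l => (L i).β (K.a q) j l) hM
      (fun p => π ((L i).a p.1) (π (K.a p.2) ξ) - ∑ l, (L i).β (K.a p.2) p.1 l • π ((L i).a l) ξ)
      (fun p => by
        rw [K.nv]
        simp only [(L i).nv]
        abel) (Rr i) (by
        rw [Fintype.sum_prod_type_right]
        exact Finset.sum_le_sum fun q _ => (L i).four (K.a q) ξ) P (L i).P σ hσ ((L i).Y a + z • T)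
    refine (le_of_eq ?_).trans (this.trans ?_)
    · rfl
    · refine add_le_add le_rfl (mul_le_mul_of_nonneg_right ?_ (by positivity))
      refine pow_le_pow_left₀ (norm_nonneg _) ((norm_add_le _ _).trans ?_) 2
      rw [norm_smul]
      gcongr
      exact (L i).Y_norm a
  have key2 : ∀ σ, 0 < σ → K.Q (κ a + z • T) ≤ q + C * err σ 0 := by
    intro σ hσ
    refine le_of_tendsto_of_tendsto' hlim (hq.add (Tendsto.const_mul C ?_)) fun i => key i σ hσ
    have hc : Continuous (err σ) := by fun_prop
    exact (hc.tendsto 0).comp hRr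
  have hc : Continuous fun σ => q + C * (√(σ * P + σ) * (√(P + (σ * P + σ)) + √P)) := by fun_prop
  have h0 := (hc.tendsto 0).mono_left (nhdsWithin_le_nhds (s := Set.Ioi 0))
  simp only [zero_mul, add_zero, Real.sqrt_zero, mul_zero] at h0
  refine ge_of_tendsto h0 ?_
  filter_upwards [self_mem_nhdsWithin] with σ hσ
  have := key2 σ hσ
  simpa [err] using this

theorem nq_claim2 (a : A) (T : H →L[ℂ] H) (hT : ∀ c x, T (π c x) = π c (T x)) :
    Tendsto (fun k => (L k).S (κ a) (adjoint T)) U (𝓝 ⟪ξ, T (π a ξ)⟫_ℂ) := by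
  obtain ⟨s, -, hs⟩ := nq_ulim U (fun k => (L k).S (κ a) (adjoint T)) _ fun k => (L k).S_le _ _
  obtain ⟨D, -, hD⟩ := nq_ulim U (fun k => ((L k).Q (adjoint T) : ℂ)) (‖adjoint T‖ ^ 2 * ‖ξ‖ ^ 2) fun k => by
    rw [Complex.norm_real, Real.norm_of_nonneg ((L k).Q0 _)]; exact (L k).Q_le _
  have hD' : Tendsto (fun k => (L k).Q (adjoint T)) U (𝓝 D.re) := (Complex.continuous_re.tendsto _).comp hD
  have hT' := nq_comm_adj T hT
  set l := ⟪ξ, T (π a ξ)⟫_ℂ with hl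
  have hc1 := nq_claim1 hL a T hT
  have hre : ∀ (f : I → ℂ) (w z : ℂ), Tendsto f U (𝓝 w) → Tendsto (fun i => 2 * (conj z * f i).re) U (𝓝 (2 * (conj z * w).re)) :=
    fun f w z h => ((Complex.continuous_re.tendsto _).comp (h.const_mul (conj z))).const_mul 2
  have key : ∀ z : ℂ, 2 * (conj z * (s - l)).re ≤ ‖a‖ ^ 2 * ‖ξ‖ ^ 2 := by
    intro z
    obtain ⟨y, -, hy⟩ := nq_ulim U (fun i => ((L i).Q ((L i).Y a) : ℂ)) (‖a‖ ^ 2 * ‖ξ‖ ^ 2) fun i => by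
      rw [Complex.norm_real, Real.norm_of_nonneg ((L i).Q0 _)]
      exact ((L i).Q_le _).trans (by gcongr; exact (L i).Y_norm a)
    have hy' : Tendsto (fun i => (L i).Q ((L i).Y a)) U (𝓝 y.re) := (Complex.continuous_re.tendsto _).comp hy
    have hyl : y.re ≤ ‖a‖ ^ 2 * ‖ξ‖ ^ 2 := le_of_tendsto' hy' fun i =>
      ((L i).Q_le _).trans (by gcongr; exact (L i).Y_norm a)
    have hq : Tendsto (fun i => (L i).Q ((L i).Y a + z • adjoint T)) U (𝓝 (y.re + 2 * (conj z * l).re + ‖z‖ ^ 2 * D.re)) := by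
      simp only [nqLevel.Q_add]
      exact (hy'.add (hre _ _ z hc1)).add (hD'.const_mul _)
    have h3 : ∀ k, 2 * (conj z * (L k).S (κ a) (adjoint T)).re + ‖z‖ ^ 2 * (L k).Q (adjoint T) ≤ y.re + 2 * (conj z * l).re + ‖z‖ ^ 2 * D.re := by
      intro k
      have := nq_step hL hκ (L k) a z (adjoint T) hT' _ hq
      rw [nqLevel.Q_add] at this
      linarith [(L k).Q0 (κ a)]
    have h4 := le_of_tendsto' ((hre _ _ z hs).add (hD'.const_mul (‖z‖ ^ 2))) h3
    rw [mul_sub, Complex.sub_re]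
    linarith
  have : s = l := by
    by_contra hne
    have h5 : 0 < ‖s - l‖ ^ 2 := by have := norm_pos_iff.2 (sub_ne_zero.2 hne); positivity
    have h6 := key (((‖a‖ ^ 2 * ‖ξ‖ ^ 2 + 1) / ‖s - l‖ ^ 2 : ℝ) * (s - l))
    rw [map_mul, Complex.conj_ofReal, mul_assoc, Complex.conj_mul', Complex.re_ofReal_mul] at h6
    have h7 : (((‖s - l‖ : ℂ) ^ 2)).re = ‖s - l‖ ^ 2 := by
      rw [← Complex.ofReal_pow, Complex.ofReal_re]
    rw [h7, div_mul_cancel₀ _ h5.ne'] at h6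
    have : 0 ≤ ‖a‖ ^ 2 * ‖ξ‖ ^ 2 := by positivity
    linarith
  rwa [this] at hs

theorem nq_claim4 (a b : A) (ha : π a = 0) : ⟪ξ, κ a (π b ξ)⟫_ℂ = 0 := by
  have h1 := nq_claim2 hL hκ b (κ a) fun c x => nq_kappa_comm hL hκ a c x
  have h2 := nq_claim2 hL hκ a (κ b) fun c x => nq_kappa_comm hL hκ b c x
  simp only [nqLevel.S_symm _ (κ b) (κ a)] at h1
  rw [ha] at h2
  simpa using tendsto_nhds_unique h1 h2

noncomputable def nqF (κ : A →ₗ[ℂ] (H →L[ℂ] H)) (K : nqLevel π ξ) : A →ₗ[ℂ] Matrix K.ι K.ι ℂ where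
  toFun a := Matrix.of fun j l => ⟪K.v l, κ a (K.v j)⟫_ℂ
  map_add' a b := by ext; simp [inner_add_right]
  map_smul' z a := by ext; simp [inner_smul_right]

omit hκ hL in
theorem nqF_quad (K : nqLevel π ξ) (c : A) (x y : K.ι → ℂ) :
    star x ⬝ᵥ (nqF κ K c *ᵥ y) = ⟪∑ l, conj (y l) • K.v l, κ c (∑ j, conj (x j) • K.v j)⟫_ℂ := by
  rw [map_sum, inner_sum]
  refine Finset.sum_congr rfl fun j _ => ?_
  rw [map_smul, inner_smul_right, sum_inner]
  congr 1
  refine Finset.sum_congr rfl fun l _ => ?_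
  rw [inner_smul_left, Complex.conj_conj]
  exact mul_comm _ _

omit hL in
theorem nqF_cpc (hk : ∀ a, ‖κ a‖ ≤ ‖a‖) (K : nqLevel π ξ) : nqCPC (nqF κ K) where
  pos k b η := by
    simp only [nqF_quad]
    refine ge_of_tendsto' (tendsto_finset_sum _ fun p _ => tendsto_finset_sum _ fun q _ => hκ _ _ _) fun i =>
      (L i).EY_pos k b fun p => ∑ l, conj (η p l) • K.v l
  contr b η := by
    rw [nqF_quad]
    set w := ∑ j, conj (η j) • K.v j with hw
    have h1 : ‖w‖ ^ 2 ≤ ∑ j, ‖η j‖ ^ 2 := by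
      rw [hw, K.vsum_norm]
      refine Finset.sum_le_sum fun j _ => ?_
      rw [RCLike.norm_conj]
      exact mul_le_of_le_one_right (by positivity) (pow_le_one₀ (norm_nonneg _) (K.v_le j))
    calc _ ≤ ‖w‖ * (‖star b * b‖ * ‖w‖) := (Complex.re_le_norm _).trans ((norm_inner_le_norm _ _).trans (by
            gcongr; exact ((κ _).le_opNorm _).trans (by gcongr; exact hk _)))
      _ = ‖b‖ ^ 2 * ‖w‖ ^ 2 := by rw [CStarRing.norm_star_mul_self]; ring
      _ ≤ _ := by gcongr
  bdd := ⟨1, fun b j l => by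
    refine (norm_inner_le_norm (𝕜 := ℂ) (K.v l) (κ b (K.v j))).trans ?_
    have h1 := K.v_le l
    have h2 := ((κ b).le_opNorm (K.v j)).trans (mul_le_mul (hk b) (K.v_le j) (norm_nonneg _) (norm_nonneg _))
    nlinarith [norm_nonneg (K.v l), norm_nonneg (κ b (K.v j))]⟩

theorem nqF_zero (K : nqLevel π ξ) (a : A) (ha : π a = 0) : nqF κ K a = 0 := by
  ext j l
  change ⟪K.v l, κ a (K.v j)⟫_ℂ = 0
  unfold nqLevel.v
  rw [map_smul, inner_smul_left, inner_smul_right, nq_pi_star, ← nq_kappa_comm hL hκ, ← nq_pi_mul, nq_claim4 hL hκ a _ ha]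
  simp

omit hκ hL in
theorem nqF_S (K : nqLevel π ξ) (a : A) (T : H →L[ℂ] H) (hT : ∀ c x, T (π c x) = π c (T x)) :
    ⟪ξ, T (π (nqTheta K.a (nqF κ K) a) ξ)⟫_ℂ = K.S (κ a) (adjoint T) := by
  unfold nqLevel.S
  simp only [nqTheta, map_sum, ContinuousLinearMap.sum_apply, inner_sum]
  rw [Finset.sum_comm]
  refine Finset.sum_congr rfl fun j _ => Finset.sum_congr rfl fun k _ => ?_
  rw [map_smul, _root_.smul_apply, map_smul, inner_smul_right, nq_pi_mul, hT, ← nq_pi_star, ← K.nv, ← K.nv, map_smul,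
    inner_smul_left, inner_smul_right, adjoint_inner_right, inner_conj_symm, Complex.conj_ofReal]
  change ⟪K.v j, κ a (K.v k)⟫_ℂ * _ = _
  ring

end Lim

section MainLem
open scoped InnerProductSpace ComplexOrder
open ComplexConjugate ContinuousLinearMap Filter Topology
variable {A : Type*} [NonUnitalCStarAlgebra A]
variable {H : Type*} [NormedAddCommGroup H] [InnerProductSpace ℂ H] [CompleteSpace H]

theorem nq_main (hK : nqK A) (π : A →⋆ₙₐ[ℂ] (H →L[ℂ] H)) (ξ : H) {τ : Type} [Fintype τ] (x : τ → A) (T : τ → H →L[ℂ] H)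
    (hT : ∀ t c y, T t (π c y) = π c (T t y)) (ε : ℝ) (hε : 0 < ε) :
    ∃ (ι : Type) (_ : Fintype ι) (a : ι → A) (f : A →ₗ[ℂ] Matrix ι ι ℂ), nqCPC f ∧ ‖∑ j, star (a j) * a j‖ ≤ 1 ∧
      (∀ b, π b = 0 → f b = 0) ∧ ∀ t, ‖⟪ξ, T t (π (nqTheta a f (x t)) ξ)⟫_ℂ - ⟪ξ, T t (π (x t) ξ)⟫_ℂ‖ < ε := by
  classical
  choose L hL using fun i : Finset A × ℕ => nqLevel_exists hK π ξ i.1 (1 / ((i.2 : ℝ) + 1)) (by positivity)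
  let U : Ultrafilter (Finset A × ℕ) := Ultrafilter.of atTop
  have hU : (U : Filter (Finset A × ℕ)) ≤ atTop := Ultrafilter.of_le _
  have hL' : ∀ b, Tendsto (fun i => ‖nqTheta (L i).a (L i).β b - b‖) U (𝓝 0) := by
    intro b
    refine Tendsto.mono_left ?_ hU
    have h1 : Tendsto (fun i : Finset A × ℕ => 1 / ((i.2 : ℝ) + 1)) atTop (𝓝 0) := by
      rw [← prod_atTop_atTop_eq]
      exact tendsto_one_div_add_atTop_nhds_zero_nat.comp tendsto_snd
    refine squeeze_zero' (.of_forall fun _ => norm_nonneg _) ?_ h1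
    filter_upwards [eventually_ge_atTop (({b} : Finset A), 0)] with i hi
    exact hL i b (hi.1 (Finset.mem_singleton_self b))
  obtain ⟨κ, hk, hκ⟩ := nq_kappa U L
  have h2 : ∀ᶠ k in (U : Filter _), ∀ t, ‖(L k).S (κ (x t)) (adjoint (T t)) - ⟪ξ, T t (π (x t) ξ)⟫_ℂ‖ < ε := by
    rw [eventually_all]
    intro t
    have := nq_claim2 hL' hκ (x t) (T t) (hT t)
    rw [tendsto_iff_norm_sub_tendsto_zero] at this
    exact this.eventually (gt_mem_nhds hε)
  obtain ⟨k, hk2⟩ := h2.exists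
  refine ⟨(L k).ι, inferInstance, (L k).a, nqF κ (L k), nqF_cpc hκ hk _, (L k).hn, fun b hb => nqF_zero hL' hκ _ b hb, fun t => ?_⟩
  rw [nqF_S _ _ _ (hT t)]
  exact hk2 t

end MainLem


section Push
open scoped InnerProductSpace ComplexOrder
open ComplexConjugate ContinuousLinearMap Filter Topology

variable {B C : Type*} [NonUnitalCStarAlgebra B] [NonUnitalCStarAlgebra C]

theorem nq_qspec (c : C) (hc : IsSelfAdjoint c) (x : ℝ) (hx : x ∈ quasispectrum ℝ c) : |x| ≤ ‖c‖ := by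
  have := (norm_cfcₙ_le_iff (id : ℝ → ℝ) c ‖c‖).1 (by rw [cfcₙ_id ℝ c]) x hx
  simpa using this

theorem nq_lift_sa (q : B →⋆ₙₐ[ℂ] C) (hq : Function.Surjective q) (c : C) (hc : IsSelfAdjoint c) :
    ∃ b, q b = c ∧ ‖b‖ ≤ ‖c‖ := by
  obtain ⟨b0, rfl⟩ := hq c
  have hqc : Continuous q := AddMonoidHomClass.continuous_of_bound q 1 fun x => by simpa using NonUnitalStarAlgHom.norm_apply_le q x
  set b : B := (1 / 2 : ℂ) • (b0 + star b0) with hb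
  have hbs : IsSelfAdjoint b := by
    rw [IsSelfAdjoint, hb, star_smul, star_add, star_star, add_comm]; simp
  have hqb : q b = q b0 := by
    have : star (q b0) = q b0 := hc
    rw [hb, map_smul, map_add, map_star, this, ← two_smul ℂ, smul_smul]; norm_num
  rw [← hqb] at hc ⊢
  set r := ‖q b‖
  have hr : 0 ≤ r := norm_nonneg _
  let g : ℝ → ℝ := fun t => max (-r) (min t r)
  have hg : Continuous g := by fun_prop
  have hg0 : g 0 = 0 := by simp [g, hr]
  refine ⟨cfcₙ g b, ?_, ?_⟩
  · rw [NonUnitalStarAlgHom.map_cfcₙ q g b hg.continuousOn hg0 hqc hbs hc]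
    conv_rhs => rw [← cfcₙ_id ℝ (q b)]
    refine cfcₙ_congr fun x hx => ?_
    have := abs_le.1 (nq_qspec _ hc x hx)
    simp only [g, id]
    rw [min_eq_left this.2, max_eq_right this.1]
  · refine norm_cfcₙ_le fun x _ => ?_
    rw [Real.norm_eq_abs, abs_le]
    exact ⟨le_max_left _ _, max_le (by linarith) (min_le_right _ _)⟩

theorem nq_lift_sq (q : B →⋆ₙₐ[ℂ] C) (hq : Function.Surjective q) (c : C) :
    ∃ d, q (star d * d) = star c * c ∧ ‖d‖ ≤ ‖c‖ := by
  letI := CStarAlgebra.spectralOrder C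
  haveI := CStarAlgebra.spectralOrderedRing C
  obtain ⟨b, rfl⟩ := hq c
  have hqc : Continuous q := AddMonoidHomClass.continuous_of_bound q 1 fun x => by simpa using NonUnitalStarAlgHom.norm_apply_le q x
  set r := ‖q b‖
  have hr : 0 ≤ r := norm_nonneg _
  let g : ℝ → ℝ := fun t => √(min t (r ^ 2))
  have hg : Continuous g := by fun_prop
  have hg0 : g 0 = 0 := by simp [g, sq_nonneg]
  have hs : IsSelfAdjoint (star (q b) * q b) := IsSelfAdjoint.star_mul_self _
  have e : q (cfcₙ g (star b * b)) = cfcₙ g (star (q b) * q b) := by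
    have := NonUnitalStarAlgHom.map_cfcₙ q g (star b * b) hg.continuousOn hg0 hqc (IsSelfAdjoint.star_mul_self _) (by
      rw [map_mul, map_star]; exact hs)
    rw [this, map_mul, map_star]
  refine ⟨cfcₙ g (star b * b), ?_, ?_⟩
  · have h1 : IsSelfAdjoint (cfcₙ g (star (q b) * q b)) := cfcₙ_predicate _ _
    rw [map_mul, map_star, e, h1.star_eq, ← cfcₙ_mul g g _ hg.continuousOn hg0 hg.continuousOn hg0]
    conv_rhs => rw [← cfcₙ_id ℝ (star (q b) * q b)]
    refine cfcₙ_congr fun x hx => ?_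
    have h2 : 0 ≤ x := quasispectrum_nonneg_of_nonneg _ (star_mul_self_nonneg (q b)) x hx
    have h3 := (abs_le.1 (nq_qspec _ hs x hx)).2
    rw [CStarRing.norm_star_mul_self, ← sq] at h3
    simp only [g, id]
    rw [min_eq_left h3, Real.mul_self_sqrt h2]
  · refine norm_cfcₙ_le fun x _ => ?_
    rw [Real.norm_of_nonneg (Real.sqrt_nonneg _)]
    exact Real.sqrt_le_iff.2 ⟨hr, min_le_right _ _⟩

theorem nq_sa_decomp (c : C) : ∃ x y : C, IsSelfAdjoint x ∧ IsSelfAdjoint y ∧ c = x + Complex.I • y ∧ ‖x‖ ≤ ‖c‖ ∧ ‖y‖ ≤ ‖c‖ :=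
  ⟨realPart c, imaginaryPart c, (realPart c).2, (imaginaryPart c).2, (realPart_add_I_smul_imaginaryPart c).symm,
    realPart.norm_le c, imaginaryPart.norm_le c⟩

/-- the factorization of a map through the quotient -/
theorem nq_descend {ι : Type} [Fintype ι] (q : B →⋆ₙₐ[ℂ] C) (hq : Function.Surjective q) (f : B →ₗ[ℂ] Matrix ι ι ℂ)
    (hf : nqCPC f) (h0 : ∀ b, q b = 0 → f b = 0) : ∃ g : C →ₗ[ℂ] Matrix ι ι ℂ, nqCPC g ∧ ∀ b, g (q b) = f b := by
  have hw : ∀ b b', q b = q b' → f b = f b' := fun b b' h =>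
    sub_eq_zero.1 (by rw [← map_sub]; exact h0 _ (by rw [map_sub, h, sub_self]))
  let s := Function.surjInv hq
  have hs : ∀ c, q (s c) = c := Function.surjInv_eq hq
  let g : C →ₗ[ℂ] Matrix ι ι ℂ := { 
    toFun := fun c => f (s c)
    map_add' := fun x y => by rw [← map_add]; exact hw _ _ (by rw [map_add, hs, hs, hs])
    map_smul' := fun z y => by rw [RingHom.id_apply, ← map_smul]; exact hw _ _ (by rw [map_smul, hs, hs]) }
  have hg : ∀ b, g (q b) = f b := fun b => hw _ _ (hs _)
  obtain ⟨K, hK⟩ := hf.bdd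
  refine ⟨g, ⟨fun k b η => ?_, fun b η => ?_, ⟨2 * |K|, fun b j k => ?_⟩⟩, hg⟩
  · have : ∀ p p', g (star (b p) * b p') = f (star (s (b p)) * s (b p')) := fun p p' => by
      rw [← hg, map_mul q, map_star q, hs, hs]
    simp only [this]
    exact hf.pos k (fun p => s (b p)) η
  · obtain ⟨d, hd1, hd2⟩ := nq_lift_sq q hq b
    rw [← hd1, hg]
    exact (hf.contr d η).trans (by gcongr)
  · obtain ⟨x, y, hx, hy, rfl, nx, ny⟩ := nq_sa_decomp b
    obtain ⟨x', rfl, nx'⟩ := nq_lift_sa q hq x hx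
    obtain ⟨y', rfl, ny'⟩ := nq_lift_sa q hq y hy
    rw [map_add, map_smul, hg, hg, Matrix.add_apply, Matrix.smul_apply]
    refine (norm_add_le _ _).trans ?_
    rw [norm_smul, Complex.norm_I, one_mul]
    have h1 : ‖f x' j k‖ ≤ |K| * ‖q x' + Complex.I • q y'‖ := (hK _ _ _).trans (by
      gcongr; exacts [le_abs_self _, nx'.trans nx])
    have h2 : ‖f y' j k‖ ≤ |K| * ‖q x' + Complex.I • q y'‖ := (hK _ _ _).trans (by
      gcongr; exacts [le_abs_self _, ny'.trans ny])
    linarith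

variable {H : Type*} [NormedAddCommGroup H] [InnerProductSpace ℂ H] [CompleteSpace H]

theorem nq_push (hK : nqK B) (q : B →⋆ₙₐ[ℂ] C) (hq : Function.Surjective q) (π : C →⋆ₙₐ[ℂ] (H →L[ℂ] H)) (ξ : H)
    {τ : Type} [Fintype τ] (x : τ → C) (T : τ → H →L[ℂ] H)
    (hT : ∀ t c y, T t (π c y) = π c (T t y)) (ε : ℝ) (hε : 0 < ε) :
    ∃ (ι : Type) (_ : Fintype ι) (a : ι → C) (f : C →ₗ[ℂ] Matrix ι ι ℂ), nqCPC f ∧ ‖∑ j, star (a j) * a j‖ ≤ 1 ∧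
      ∀ t, ‖⟪ξ, T t (π (nqTheta a f (x t)) ξ)⟫_ℂ - ⟪ξ, T t (π (x t) ξ)⟫_ℂ‖ < ε := by
  choose x' hx' using fun t => hq (x t)
  obtain ⟨ι, _, a, f, h1, h2, h3, h4⟩ := nq_main hK (π.comp q) ξ x' T (fun t c y => hT t (q c) y) ε hε
  obtain ⟨g, g1, g2⟩ := nq_descend q hq f h1 fun b hb => h3 b (by
    rw [NonUnitalStarAlgHom.comp_apply, hb, map_zero])
  refine ⟨ι, inferInstance, fun j => q (a j), g, g1, ?_, fun t => ?_⟩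
  · have : ∑ j, star (q (a j)) * q (a j) = q (∑ j, star (a j) * a j) := by
      simp only [map_sum, map_mul, map_star]
    rw [this]
    exact (NonUnitalStarAlgHom.norm_apply_le q _).trans h2
  · have : nqTheta (fun j => q (a j)) g (x t) = q (nqTheta a f (x' t)) := by
      simp only [nqTheta, ← hx', g2, map_sum, map_smul, map_mul, map_star]
    rw [this]
    have := h4 t
    rwa [NonUnitalStarAlgHom.comp_apply, NonUnitalStarAlgHom.comp_apply, hx'] at this

def nqW {τ : Type} (c : τ → C) : Set (τ → C) :=
  {w | ∃ (ι : Type) (_ : Fintype ι) (a : ι → C) (f : C →ₗ[ℂ] Matrix ι ι ℂ), nqCPC f ∧ ‖∑ j, star (a j) * a j‖ ≤ 1 ∧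
    ∀ t, w t = nqTheta a f (c t)}

theorem nqTheta_smul {ι : Type} [Fintype ι] (a : ι → C) (f : C →ₗ[ℂ] Matrix ι ι ℂ) (s : ℝ) (x : C) :
    nqTheta (fun j => (s : ℂ) • a j) f x = ((s : ℂ) * s) • nqTheta a f x := by
  simp only [nqTheta, Finset.smul_sum]
  refine Finset.sum_congr rfl fun j _ => Finset.sum_congr rfl fun k _ => ?_
  rw [star_smul, smul_mul_smul_comm, smul_smul, smul_smul, Complex.star_def, Complex.conj_ofReal, mul_comm]

theorem nqW_convex {τ : Type} (c : τ → C) : Convex ℝ (nqW c) := by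
  rintro w1 ⟨ι1, _, a1, f1, h1, n1, e1⟩ w2 ⟨ι2, _, a2, f2, h2, n2, e2⟩ s1 s2 p1 p2 hs
  let ι : Bool → Type := fun b => if b then ι1 else ι2
  letI i1 : ∀ b, Fintype (ι b) := fun b => match b with
    | true => ‹Fintype ι1›
    | false => ‹Fintype ι2›
  let f : ∀ b, C →ₗ[ℂ] Matrix (ι b) (ι b) ℂ := fun b => match b with
    | true => f1
    | false => f2
  let a : (Σ b, ι b) → C := fun p => match p with
    | ⟨true, j⟩ => (√s1 : ℂ) • a1 j
    | ⟨false, j⟩ => (√s2 : ℂ) • a2 j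
  have hf : ∀ b, nqCPC (f b) := fun b => match b with
    | true => h1
    | false => h2
  have q1 : (√s1 : ℂ) * √s1 = (s1 : ℂ) := by exact_mod_cast Real.mul_self_sqrt p1
  have q2 : (√s2 : ℂ) * √s2 = (s2 : ℂ) := by exact_mod_cast Real.mul_self_sqrt p2
  refine ⟨Σ b, ι b, inferInstance, a, nqSig f, nqCPC.sig hf, ?_, fun t => ?_⟩
  · rw [Fintype.sum_sigma, Fintype.sum_bool]
    change ‖∑ j : ι1, star ((√s1 : ℂ) • a1 j) * ((√s1 : ℂ) • a1 j) + ∑ j : ι2, star ((√s2 : ℂ) • a2 j) * ((√s2 : ℂ) • a2 j)‖ ≤ 1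
    simp only [star_smul, smul_mul_smul_comm, Complex.star_def, Complex.conj_ofReal, q1, q2, ← Finset.smul_sum]
    refine (norm_add_le _ _).trans ?_
    rw [norm_smul, norm_smul, Complex.norm_real, Complex.norm_real, Real.norm_of_nonneg p1, Real.norm_of_nonneg p2]
    nlinarith
  · rw [nqSig_theta, Fintype.sum_bool]
    change s1 • w1 t + s2 • w2 t = nqTheta (fun j => (√s1 : ℂ) • a1 j) f1 (c t) + nqTheta (fun j => (√s2 : ℂ) • a2 j) f2 (c t)
    rw [nqTheta_smul, nqTheta_smul, q1, q2, e1, e2, Complex.coe_smul, Complex.coe_smul]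

theorem nqTheta_star {ι : Type} [Fintype ι] [DecidableEq ι] (a : ι → C) (f : C →ₗ[ℂ] Matrix ι ι ℂ) (hf : nqCPC f) (x : C) :
    star (nqTheta a f x) = nqTheta a f (star x) := by
  simp only [nqTheta, star_sum, star_smul, star_mul, star_star]
  conv_rhs => rw [Finset.sum_comm]
  refine Finset.sum_congr rfl fun j _ => Finset.sum_congr rfl fun k _ => ?_
  rw [hf.herm_entry (star x) k j, star_star]; rfl

end Push


section Jordan
open scoped InnerProductSpace ComplexOrder
open ComplexConjugate ContinuousLinearMap Filter Topology

variable {C : Type*} [NonUnitalCStarAlgebra C]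

theorem nq_jordan_real [PartialOrder C] [StarOrderedRing C] (φ : C →L[ℝ] ℝ) :
    ∃ p m : C →ₗ[ℝ] ℝ, (∀ x, 0 ≤ x → 0 ≤ p x) ∧ (∀ x, 0 ≤ x → 0 ≤ m x) ∧ ∀ x, p x - m x = φ x := by
  let s : PointedCone ℝ (C × C × ℝ) :=
    { carrier := {z | ∃ u w, 0 ≤ z.1 - u ∧ 0 ≤ z.2.1 - w ∧ ‖u‖ + ‖w‖ ≤ z.2.2}
      add_mem' := by
        rintro z z' ⟨u, w, h1, h2, h3⟩ ⟨u', w', h1', h2', h3'⟩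
        refine ⟨u + u', w + w', ?_, ?_, ?_⟩
        · have := add_nonneg h1 h1'
          convert this using 1
          simp only [Prod.fst_add]; abel
        · have := add_nonneg h2 h2'
          convert this using 1
          simp only [Prod.fst_add, Prod.snd_add]; abel
        · have a := norm_add_le u u'
          have b := norm_add_le w w'
          simp only [Prod.snd_add]
          linarith
      zero_mem' := ⟨0, 0, by simp, by simp, by simp⟩
      smul_mem' := by
        rintro ⟨r, hr⟩ z ⟨u, w, h1, h2, h3⟩
        refine ⟨r • u, r • w, ?_, ?_, ?_⟩
        · have := smul_nonneg hr h1
          rwa [smul_sub] at this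
        · have := smul_nonneg hr h2
          rwa [smul_sub] at this
        · rw [norm_smul, norm_smul, Real.norm_of_nonneg hr, ← mul_add]
          exact mul_le_mul_of_nonneg_left h3 hr }
  have hs : ∀ z, z ∈ s ↔ ∃ u w, 0 ≤ z.1 - u ∧ 0 ≤ z.2.1 - w ∧ ‖u‖ + ‖w‖ ≤ z.2.2 := fun z => Iff.rfl
  let D : Submodule ℝ (C × C × ℝ) :=
    { carrier := {z | z.2.1 = -z.1}
      add_mem' := by
        intro a b ha hb
        simp only [Set.mem_setOf_eq] at *
        simp only [Prod.snd_add, Prod.fst_add, ha, hb]; abel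
      zero_mem' := by simp
      smul_mem' := by
        intro r a ha
        simp only [Set.mem_setOf_eq] at *
        simp [ha] }
  let F : C × C × ℝ →ₗ[ℝ] ℝ :=
    { toFun := fun z => φ z.1 + 2 * ‖φ‖ * z.2.2
      map_add' := by intro a b; simp; ring
      map_smul' := by intro a b; simp; ring }
  obtain ⟨g, hg1, hg2⟩ := riesz_extension s ⟨D, F.comp D.subtype⟩ (by
    rintro ⟨⟨x, y, t⟩, hz⟩ ⟨u, w, h1, h2, h3⟩
    have hy : y = -x := hz
    subst hy
    change 0 ≤ φ x + 2 * ‖φ‖ * t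
    simp only at h1 h2 h3
    have hle : x - u ≤ (x - u) + (-x - w) := le_add_of_nonneg_right h2
    have hn := CStarAlgebra.norm_le_norm_of_nonneg_of_le h1 hle
    have e : (x - u) + (-x - w) = -(u + w) := by abel
    rw [e, norm_neg] at hn
    have h4 := norm_add_le u w
    have hx : ‖x‖ ≤ 2 * t := by
      have := norm_add_le (x - u) u
      rw [sub_add_cancel] at this
      linarith [norm_nonneg w]
    have h5 := φ.le_opNorm x
    rw [Real.norm_eq_abs] at h5
    have h6 := mul_le_mul_of_nonneg_left hx (norm_nonneg φ)
    linarith [neg_abs_le (φ x)]) (by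
    rintro ⟨x, y, t⟩
    refine ⟨⟨(0, 0, ‖x‖ + ‖y‖ - t), by change (0:C) = -0; simp⟩, ?_⟩
    exact ⟨x, y, by simp, by simp, by simp⟩)
  have hpos1 : ∀ x : C, 0 ≤ x → (x, (0:C), (0:ℝ)) ∈ s := fun x hx => ⟨0, 0, by simpa using hx, by simp, by simp⟩
  have hpos2 : ∀ x : C, 0 ≤ x → ((0:C), x, (0:ℝ)) ∈ s := fun x hx => ⟨0, 0, by simp, by simpa using hx, by simp⟩
  refine ⟨g.comp (LinearMap.inl ℝ C (C × ℝ)), g.comp ((LinearMap.inr ℝ C (C × ℝ)).comp (LinearMap.inl ℝ C ℝ)),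
    fun x hx => hg2 _ (hpos1 x hx), fun x hx => hg2 _ (hpos2 x hx), fun x => ?_⟩
  have := hg1 ⟨(x, -x, 0), rfl⟩
  change g (x, -x, 0) = φ x + 2 * ‖φ‖ * 0 at this
  simp only [LinearMap.comp_apply, LinearMap.inl_apply, LinearMap.inr_apply]
  rw [← map_sub]
  have e : ((x, 0) : C × C × ℝ) - (0, x, 0) = (x, -x, 0) := by ext <;> simp
  rw [e, this]; simp

/-- complexification of a positive real functional -/
theorem nq_complexify [PartialOrder C] [StarOrderedRing C] (p : C →ₗ[ℝ] ℝ) (hp : ∀ x, 0 ≤ x → 0 ≤ p x) :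
    ∃ f : C →ₚ[ℂ] ℂ, ∀ x, IsSelfAdjoint x → (f x).re = p x := by
  let L : C →ₗ[ℂ] ℂ :=
    { toFun := fun x => (p (realPart x : C) : ℂ) + Complex.I * (p (imaginaryPart x : C) : ℂ)
      map_add' := by intro x y; simp; ring
      map_smul' := by
        intro z x
        simp only [realPart_smul, imaginaryPart_smul, RingHom.id_apply, smul_eq_mul]
        apply Complex.ext <;> simp }
  have hL : ∀ x : C, IsSelfAdjoint x → L x = p x := by
    intro x hx
    change (p (realPart x : C) : ℂ) + Complex.I * (p (imaginaryPart x : C) : ℂ) = _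
    rw [hx.coe_realPart, hx.imaginaryPart]; simp
  refine ⟨PositiveLinearMap.mk₀ L fun x hx => ?_, fun x hx => ?_⟩
  · rw [hL x (IsSelfAdjoint.of_nonneg hx)]
    exact_mod_cast hp x hx
  · change (L x).re = _
    rw [hL x hx]; simp

end Jordan


section GNSV
open scoped InnerProductSpace ComplexOrder
open ComplexConjugate ContinuousLinearMap Filter Topology

variable {C : Type*} [NonUnitalCStarAlgebra C]

theorem nq_gns_bound [PartialOrder C] [StarOrderedRing C] (f : C →ₚ[ℂ] ℂ) :
    ∃ K : ℝ, ∀ x : f.PreGNS, ‖f (f.ofPreGNS x)‖ ≤ K * ‖x‖ := by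
  obtain ⟨K, hK⟩ := f.exists_norm_apply_le
  refine ⟨√K, fun x => ?_⟩
  obtain ⟨l, _, h1, h2, h3, h4⟩ := nq_apx C
  have hfc : Continuous f := AddMonoidHomClass.continuous_of_bound f K hK
  have ht : Tendsto (fun e => ‖f (e * f.ofPreGNS x)‖) l (𝓝 ‖f (f.ofPreGNS x)‖) :=
    (continuous_norm.tendsto _).comp ((hfc.tendsto _).comp (h1 _))
  refine le_of_tendsto ht ?_
  filter_upwards [h3, h4] with e he hs
  have e1 : f (e * f.ofPreGNS x) = ⟪f.toPreGNS e, x⟫_ℂ := by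
    rw [f.preGNS_inner_def, f.ofPreGNS_toPreGNS, hs]
  rw [e1]
  refine (norm_inner_le_norm _ _).trans ?_
  gcongr
  refine Real.le_sqrt_of_sq_le ?_
  have e2 := f.preGNS_norm_sq (f.toPreGNS e)
  have e3 : ‖f.toPreGNS e‖ ^ 2 = ‖f (star e * e)‖ := by
    rw [f.ofPreGNS_toPreGNS] at e2
    rw [← e2]; simp
  rw [e3]
  refine (hK _).trans ?_
  rw [CStarRing.norm_star_mul_self]
  have : ‖e‖ * ‖e‖ ≤ 1 := mul_le_one₀ he (norm_nonneg _) he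
  have hk : (0:ℝ) ≤ K := K.2
  nlinarith

theorem nq_gns_vec [PartialOrder C] [StarOrderedRing C] (f : C →ₚ[ℂ] ℂ) :
    ∃ η : f.GNS, ∀ a, ⟪η, f.gnsNonUnitalStarAlgHom a η⟫_ℂ = f a := by
  obtain ⟨K, hK⟩ := nq_gns_bound f
  let L0 : f.PreGNS →ₗ[ℂ] ℂ :=
    { toFun := fun x => f (f.ofPreGNS x)
      map_add' := fun x y => by rw [map_add, map_add]
      map_smul' := fun c x => by rw [map_smul, map_smul]; rfl }
  let L : f.PreGNS →L[ℂ] ℂ := L0.mkContinuous K hK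
  let M : f.GNS →L[ℂ] ℂ := L.extend (UniformSpace.Completion.toComplL (𝕜 := ℂ))
  have hM : ∀ x : f.PreGNS, M (x : f.GNS) = f (f.ofPreGNS x) := fun x =>
    ContinuousLinearMap.extend_eq (e := UniformSpace.Completion.toComplL (𝕜 := ℂ)) L
      (UniformSpace.Completion.denseRange_coe) (UniformSpace.Completion.isUniformInducing_coe _) x
  let η := (InnerProductSpace.toDual ℂ f.GNS).symm M
  have hη : ∀ x : f.PreGNS, ⟪η, (x : f.GNS)⟫_ℂ = f (f.ofPreGNS x) := fun x => by
    rw [InnerProductSpace.toDual_symm_apply, hM]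
  have key : ∀ a, f.gnsNonUnitalStarAlgHom a η = ((f.toPreGNS a : f.PreGNS) : f.GNS) := by
    intro a
    refine ext_inner_right ℂ fun v => ?_
    induction v using UniformSpace.Completion.induction_on with
    | hp => apply isClosed_eq <;> fun_prop
    | ih b =>
      rw [nq_pi_star, f.gnsNonUnitalStarAlgHom_apply_coe, hη, UniformSpace.Completion.inner_coe, f.preGNS_inner_def,
        f.leftMulMapPreGNS_apply]
      simp
  exact ⟨η, fun a => by rw [key, hη, f.ofPreGNS_toPreGNS]⟩

/-- diagonal operators on a finite Hilbert sum -/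
noncomputable def nqDiag {σ : Type} [Fintype σ] {G : σ → Type*} [∀ s, NormedAddCommGroup (G s)] [∀ s, InnerProductSpace ℂ (G s)]
    (S : ∀ s, G s →L[ℂ] G s) : PiLp 2 G →L[ℂ] PiLp 2 G :=
  ((PiLp.continuousLinearEquiv 2 ℂ G).symm : (∀ s, G s) →L[ℂ] PiLp 2 G) ∘L
    (ContinuousLinearMap.pi fun s => S s ∘L ContinuousLinearMap.proj s) ∘L
    ((PiLp.continuousLinearEquiv 2 ℂ G) : PiLp 2 G →L[ℂ] (∀ s, G s))

theorem nqDiag_apply {σ : Type} [Fintype σ] {G : σ → Type*} [∀ s, NormedAddCommGroup (G s)] [∀ s, InnerProductSpace ℂ (G s)]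
    (S : ∀ s, G s →L[ℂ] G s) (x : PiLp 2 G) (s : σ) : nqDiag S x s = S s (x s) := rfl

theorem nq_sum_rep [PartialOrder C] [StarOrderedRing C] {σ : Type} [Fintype σ] (f : σ → C →ₚ[ℂ] ℂ) :
    ∃ (π : C →⋆ₙₐ[ℂ] (PiLp 2 (fun s => (f s).GNS) →L[ℂ] PiLp 2 (fun s => (f s).GNS))) (ξ : PiLp 2 (fun s => (f s).GNS))
      (T : σ → PiLp 2 (fun s => (f s).GNS) →L[ℂ] PiLp 2 (fun s => (f s).GNS)),
      (∀ s c y, T s (π c y) = π c (T s y)) ∧ ∀ s c, ⟪ξ, T s (π c ξ)⟫_ℂ = f s c := by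
  classical
  choose η hη using fun s => nq_gns_vec (f s)
  let π : C →⋆ₙₐ[ℂ] (PiLp 2 (fun s => (f s).GNS) →L[ℂ] PiLp 2 (fun s => (f s).GNS)) :=
    { toFun := fun c => nqDiag fun s => (f s).gnsNonUnitalStarAlgHom c
      map_smul' := fun z c => by
        ext x s
        simp only [nqDiag_apply, map_smul]; rfl
      map_zero' := by
        ext x s
        simp only [nqDiag_apply, map_zero]; rfl
      map_add' := fun a b => by
        ext x s
        simp only [nqDiag_apply, map_add]; rfl
      map_mul' := fun a b => by
        ext x s
        simp only [nqDiag_apply, map_mul]; rfl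
      map_star' := fun a => by
        rw [ContinuousLinearMap.star_eq_adjoint, eq_adjoint_iff]
        intro x y
        simp only [PiLp.inner_apply, nqDiag_apply]
        exact Finset.sum_congr rfl fun s _ => by rw [nq_pi_star, star_star] }
  have hπ : ∀ c x s, π c x s = (f s).gnsNonUnitalStarAlgHom c (x s) := fun c x s => rfl
  refine ⟨π, WithLp.toLp 2 η, fun s => nqDiag fun r => if r = s then 1 else 0, fun s c y => ?_, fun s c => ?_⟩
  · ext r
    rw [nqDiag_apply, hπ, hπ, nqDiag_apply]
    split_ifs <;> simp
  · rw [PiLp.inner_apply, Finset.sum_eq_single s]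
    · rw [nqDiag_apply, hπ, if_pos rfl]; exact hη s c
    · intro r _ hr
      rw [nqDiag_apply, if_neg hr]; simp
    · simp

end GNSV


section Final
open scoped InnerProductSpace ComplexOrder
open ComplexConjugate ContinuousLinearMap Filter Topology

variable {B C : Type*} [NonUnitalCStarAlgebra B] [NonUnitalCStarAlgebra C]

theorem nq_mem_closure (hK : nqK B) (q : B →⋆ₙₐ[ℂ] C) (hq : Function.Surjective q) {τ : Type} [Fintype τ]
    (c : τ → C) (hc : ∀ t, IsSelfAdjoint (c t)) : c ∈ closure (nqW c) := by
  classical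
  letI := CStarAlgebra.spectralOrder C
  haveI := CStarAlgebra.spectralOrderedRing C
  by_contra hcon
  obtain ⟨φ, u, h1, h2⟩ := geometric_hahn_banach_closed_point (nqW_convex c).closure isClosed_closure hcon
  have hsum : ∀ w : τ → C, φ w = ∑ t, (φ ∘L ContinuousLinearMap.single ℝ (fun _ : τ => C) t) (w t) := by
    intro w
    conv_lhs => rw [← Finset.univ_sum_single w]
    rw [map_sum]; rfl
  choose p m hp hm hpm using fun t => nq_jordan_real (φ ∘L ContinuousLinearMap.single ℝ (fun _ : τ => C) t)
  choose P hP using fun t => nq_complexify (p t) (hp t)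
  choose M hM using fun t => nq_complexify (m t) (hm t)
  have hval : ∀ w : τ → C, (∀ t, IsSelfAdjoint (w t)) → φ w = ∑ t, ((P t (w t)).re - (M t (w t)).re) := by
    intro w hw
    rw [hsum]
    exact Finset.sum_congr rfl fun t _ => by rw [hP t _ (hw t), hM t _ (hw t), hpm]
  let f : τ × Bool → C →ₚ[ℂ] ℂ := fun s => if s.2 then P s.1 else M s.1
  obtain ⟨π, ξ, T, hT, hf⟩ := nq_sum_rep f
  let N : ℝ := 2 * Fintype.card τ + 1
  have hN : 0 < N := by positivity
  obtain ⟨ι, _, a, g, g1, g2, g3⟩ := nq_push hK q hq π ξ (fun s : τ × Bool => c s.1) T hT ((φ c - u) / N)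
    (div_pos (by linarith) hN)
  let w : τ → C := fun t => nqTheta a g (c t)
  have hw : w ∈ nqW c := ⟨ι, inferInstance, a, g, g1, g2, fun t => rfl⟩
  have hws : ∀ t, IsSelfAdjoint (w t) := fun t => by
    change star (nqTheta a g (c t)) = nqTheta a g (c t)
    rw [nqTheta_star a g g1, (hc t).star_eq]
  have h3 := h1 w (subset_closure hw)
  have h4 : ∀ s, ‖f s (w s.1) - f s (c s.1)‖ < (φ c - u) / N := fun s => by
    have := g3 s
    rwa [hf, hf] at this
  have h5 : φ c - φ w ≤ ∑ t : τ, 2 * ((φ c - u) / N) := by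
    rw [hval c hc, hval w hws, ← Finset.sum_sub_distrib]
    refine Finset.sum_le_sum fun t _ => ?_
    have a1 := (Complex.abs_re_le_norm _).trans (h4 (t, true)).le
    have a2 := (Complex.abs_re_le_norm _).trans (h4 (t, false)).le
    rw [Complex.sub_re, abs_le] at a1 a2
    simp only [f, if_true, Bool.false_eq_true, if_false] at a1 a2
    rw [← hval c hc]
    linarith [a1.1, a1.2, a2.1, a2.2]
  rw [Finset.sum_const, Finset.card_univ, nsmul_eq_mul] at h5
  have h6 : (φ c - u) / N * N = φ c - u := div_mul_cancel₀ _ hN.ne'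
  have h7 : 0 < (φ c - u) / N := div_pos (by linarith) hN
  have h8 : (φ c - u) / N * N = (Fintype.card τ) * (2 * ((φ c - u) / N)) + (φ c - u) / N := by
    simp only [N]; ring
  linarith

theorem nqTheta_lin {ι : Type} [Fintype ι] (a : ι → C) (f : C →ₗ[ℂ] Matrix ι ι ℂ) (x y : C) (z : ℂ) :
    nqTheta a f (x + z • y) = nqTheta a f x + z • nqTheta a f y := by
  simp only [nqTheta, map_add, map_smul, Matrix.add_apply, Matrix.smul_apply, add_smul, Finset.sum_add_distrib,
    Finset.smul_sum, smul_smul, smul_eq_mul]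

theorem nqK_quot (hK : nqK B) (q : B →⋆ₙₐ[ℂ] C) (hq : Function.Surjective q) : nqK C := by
  intro F ε hε
  choose x y hx hy hxy _ _ using fun c : C => nq_sa_decomp c
  let e := F.equivFin.symm
  let c : Fin F.card × Bool → C := fun s => if s.2 then x (e s.1) else y (e s.1)
  have hc : ∀ t, IsSelfAdjoint (c t) := by
    rintro ⟨i, b⟩
    cases b
    · exact hy _
    · exact hx _
  obtain ⟨w, ⟨ι, hι, a, f, f1, f2, f3⟩, hw⟩ := Metric.mem_closure_iff.1 (nq_mem_closure hK q hq c hc) (ε / 2) (by linarith)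
  refine ⟨ι, hι, a, f, f1, f2, fun b hb => ?_⟩
  have hd : ∀ t, ‖nqTheta a f (c t) - c t‖ ≤ ε / 2 := fun t => by
    rw [← f3, ← dist_eq_norm, dist_comm]
    exact (dist_le_pi_dist c w t).trans hw.le
  have d1 := hd (F.equivFin ⟨b, hb⟩, true)
  have d2 := hd (F.equivFin ⟨b, hb⟩, false)
  simp only [c, e, if_true, Bool.false_eq_true, if_false, Equiv.symm_apply_apply] at d1 d2
  have e1 : nqTheta a f b - b = (nqTheta a f (x b) - x b) + Complex.I • (nqTheta a f (y b) - y b) := by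
    conv_lhs => rw [hxy b, nqTheta_lin]
    rw [smul_sub]; abel
  rw [e1]
  refine (norm_add_le _ _).trans ?_
  rw [norm_smul, Complex.norm_I, one_mul]
  linarith

end Final

/-- A quotient of a nuclear C*-algebra (i.e. the image of a surjective
*-homomorphism, equivalently the quotient by a closed two-sided ideal) is
nuclear. -/
theorem isNuclear_quotient
    {B C : Type*}
    [NonUnitalNormedRing B] [StarRing B] [CStarRing B] [NormedSpace ℂ B]
    [IsScalarTower ℂ B B] [SMulCommClass ℂ B B] [StarModule ℂ B] [CompleteSpace B]
    [NonUnitalNormedRing C] [StarRing C] [CStarRing C] [NormedSpace ℂ C]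
    [IsScalarTower ℂ C C] [SMulCommClass ℂ C C] [StarModule ℂ C] [CompleteSpace C]
    (π : B →⋆ₙₐ[ℂ] C) (hsurj : Function.Surjective π)
    (hB : IsNuclear B) : IsNuclear C := by
  letI : NonUnitalCStarAlgebra B := {}
  letI : NonUnitalCStarAlgebra C := {}
  exact nuclear_of_nqK (nqK_quot (nqK_of_nuclear hB) π hsurj)
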